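/- Let n ≥ 1, let N = e₁ be the first standard basis vector of ℍⁿ (quaternionic n-space), and let S^{4n-1} denote the unit sphere of ℍⁿ ≅ ℝ^{4n}. The orbit map θ_N : Sp(n) → S^{4n-1}, A ↦ A·N, induces a nonzero map on (4n-1)-st singular homology with real coefficients, θ_{N*} : H_{4n-1}(Sp(n); ℝ) → H_{4n-1}(S^{4n-1}; ℝ) ≅ ℝ. (Dually, the pullback of the fundamental cohomology class of S^{4n-1} is nonzero in H^{4n-1}(Sp(n); ℝ); this is the obstruction showing the transitive Sp(n)-action on S^{4n-1} admits no homotopy comoment map.) -/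

import Mathlib

open CategoryTheory Quaternion

/-- The singular chain complex functor with real coefficients, defined via the singular
simplicial set. -/
noncomputable def singularChainComplexFunctor : TopCat.{0} ⥤ ChainComplex (ModuleCat.{0} ℝ) ℕ :=
  TopCat.toSSet ⋙ ((SimplicialObject.whiskering _ _).obj (ModuleCat.free ℝ)) ⋙
    AlgebraicTopology.alternatingFaceMapComplex _

/-- Singular homology with real coefficients, as a functor `TopCat ⥤ ModuleCat ℝ`. -/
noncomputable def singularHomologyFunctor (n : ℕ) : TopCat.{0} ⥤ ModuleCat.{0} ℝ :=
  singularChainComplexFunctor ⋙ HomologicalComplex.homologyFunctor _ _ n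

/-- Formal real linear combinations of finite sequences of points of `D`. -/
abbrev ListChain (D : Type*) := List D →₀ ℝ

namespace ListChain

variable {D D' : Type*}

/-- Prepend the vertex `x` to all sequences. -/
noncomputable def cone (x : D) : ListChain D →ₗ[ℝ] ListChain D :=
  Finsupp.lmapDomain ℝ ℝ (List.cons x)

/-- The alternating sum of the sequences obtained by deleting one vertex. -/
noncomputable def bdList : List D → ListChain D
  | [] => 0
  | x :: l => Finsupp.single l 1 - cone x (bdList l)

/-- The boundary operator. -/
noncomputable def bd : ListChain D →ₗ[ℝ] ListChain D :=
  Finsupp.linearCombination ℝ bdList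

/-- The chain map induced by a map on vertices. -/
noncomputable def push (f : D → D') : ListChain D →ₗ[ℝ] ListChain D' :=
  Finsupp.lmapDomain ℝ ℝ (List.map f)

/-- Subdivision of sequences of length `n`, where `b l` is used as the barycenter of `l`. -/
noncomputable def sd (b : List D → D) : ℕ → ListChain D →ₗ[ℝ] ListChain D
  | 0 => LinearMap.id
  | n + 1 => Finsupp.linearCombination ℝ fun l => cone (b l) (sd b n (bdList l))

/-- The chain homotopy between the identity and the subdivision. -/
noncomputable def sdHtpy (b : List D → D) : ℕ → ListChain D →ₗ[ℝ] ListChain D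
  | 0 => 0
  | n + 1 => Finsupp.linearCombination ℝ fun l =>
      cone (b l) (Finsupp.single l 1 - sdHtpy b n (bdList l))

/-- The prism over a sequence. -/
noncomputable def prismList (f g : D → D') : List D → ListChain D'
  | [] => 0
  | x :: l => cone (f x) (cone (g x) (Finsupp.single (l.map g) 1)) - cone (f x) (prismList f g l)

/-- The prism operator, a chain homotopy between `push f` and `push g`. -/
noncomputable def prism (f g : D → D') : ListChain D →ₗ[ℝ] ListChain D' :=
  Finsupp.linearCombination ℝ (prismList f g)

@[simp] lemma cone_single (x : D) (l : List D) (r : ℝ) :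
    cone x (Finsupp.single l r) = Finsupp.single (x :: l) r := by
  simp [cone]

@[simp] lemma push_single (f : D → D') (l : List D) (r : ℝ) :
    push f (Finsupp.single l r) = Finsupp.single (l.map f) r := by
  simp [push]

@[simp] lemma bd_single (l : List D) : bd (Finsupp.single l 1) = bdList l := by
  simp [bd]

@[simp] lemma prism_single (f g : D → D') (l : List D) :
    prism f g (Finsupp.single l 1) = prismList f g l := by
  simp [prism]

@[simp] lemma sd_succ_single (b : List D → D) (n : ℕ) (l : List D) :
    sd b (n + 1) (Finsupp.single l 1) = cone (b l) (sd b n (bdList l)) := by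
  simp [sd]

@[simp] lemma sdHtpy_succ_single (b : List D → D) (n : ℕ) (l : List D) :
    sdHtpy b (n + 1) (Finsupp.single l 1) =
      cone (b l) (Finsupp.single l 1 - sdHtpy b n (bdList l)) := by
  simp [sdHtpy]

/-- Two linear maps on chains agree when they agree on sequences. -/
lemma hom_ext {M : Type*} [AddCommGroup M] [Module ℝ M] {f g : ListChain D →ₗ[ℝ] M}
    (h : ∀ l, f (Finsupp.single l 1) = g (Finsupp.single l 1)) : f = g :=
  Finsupp.lhom_ext' fun l => LinearMap.ext_ring (by simpa using h l)

lemma bd_cone (x : D) (c : ListChain D) : bd (cone x c) = c - cone x (bd c) := by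
  have : bd ∘ₗ cone x = LinearMap.id - cone x ∘ₗ bd :=
    hom_ext fun l => by simp [bdList]
  exact LinearMap.congr_fun this c

lemma bd_bd (c : ListChain D) : bd (bd c) = 0 := by
  have : (bd ∘ₗ bd : ListChain D →ₗ[ℝ] _) = 0 := hom_ext fun l => by
    induction l with
    | nil => simp [bdList]
    | cons x l ih =>
      simp only [LinearMap.comp_apply, bd_single, LinearMap.zero_apply] at ih ⊢
      simp [bdList, bd_cone, ih]
  exact LinearMap.congr_fun this c

lemma push_cone (f : D → D') (x : D) (c : ListChain D) :
    push f (cone x c) = cone (f x) (push f c) := by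
  have : push f ∘ₗ cone x = cone (f x) ∘ₗ push f := hom_ext fun l => by simp
  exact LinearMap.congr_fun this c

lemma push_push {D'' : Type*} (f : D → D') (g : D' → D'') (c : ListChain D) :
    push g (push f c) = push (g ∘ f) c := by
  have : push g ∘ₗ push f = push (g ∘ f) := hom_ext fun l => by simp
  exact LinearMap.congr_fun this c

lemma bdList_map (f : D → D') (l : List D) : bdList (l.map f) = push f (bdList l) := by
  induction l with
  | nil => simp [bdList]
  | cons x l ih => simp [bdList, push_cone, ih]

lemma bd_sd (b : List D → D) (n : ℕ) (c : ListChain D) :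
    bd (sd b (n + 1) c) = sd b n (bd c) := by
  induction n generalizing c with
  | zero =>
    have : bd ∘ₗ sd b 1 = sd b 0 ∘ₗ bd := hom_ext fun l => by
      simp only [LinearMap.comp_apply, sd_succ_single, bd_single, bd_cone]
      rw [← bd_single, sd, LinearMap.id_apply, bd_bd]; simp
    exact LinearMap.congr_fun this c
  | succ n ih =>
    have : bd ∘ₗ sd b (n + 2) = sd b (n + 1) ∘ₗ bd := hom_ext fun l => by
      rw [LinearMap.comp_apply, sd_succ_single, bd_cone, ih, ← bd_single, bd_bd]
      simp
    exact LinearMap.congr_fun this c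

lemma bd_sd_iterate (b : List D → D) (n k : ℕ) (c : ListChain D) :
    bd ((sd b (n + 1) ^ k) c) = (sd b n ^ k) (bd c) := by
  induction k generalizing c with
  | zero => simp
  | succ k ih => rw [pow_succ, pow_succ, Module.End.mul_apply, Module.End.mul_apply, ih, bd_sd]

lemma bd_sdHtpy (b : List D → D) (n : ℕ) (c : ListChain D) :
    bd (sdHtpy b (n + 1) c) + sdHtpy b n (bd c) = c - sd b (n + 1) c := by
  induction n generalizing c with
  | zero =>
    have : bd ∘ₗ sdHtpy b 1 + sdHtpy b 0 ∘ₗ bd = LinearMap.id - sd b 1 := hom_ext fun l => by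
      simp [sdHtpy, sd, bdList]
    exact LinearMap.congr_fun this c
  | succ n ih =>
    have : bd ∘ₗ sdHtpy b (n + 2) + sdHtpy b (n + 1) ∘ₗ bd = LinearMap.id - sd b (n + 2) :=
      hom_ext fun l => by
        have h := ih (bdList l)
        rw [← bd_single, bd_bd, map_zero, add_zero] at h
        simp only [LinearMap.add_apply, LinearMap.comp_apply, sdHtpy_succ_single, bd_cone,
          LinearMap.sub_apply, LinearMap.id_apply, sd_succ_single, map_sub, ← bd_single, h]
        abel
    exact LinearMap.congr_fun this c

lemma bd_prism (f g : D → D') (c : ListChain D) :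
    bd (prism f g c) + prism f g (bd c) = push g c - push f c := by
  have : bd ∘ₗ prism f g + prism f g ∘ₗ bd = push g - push f := hom_ext fun l => by
    induction l with
    | nil => simp [bdList, prismList]
    | cons x l ih =>
      have key : ∀ c, prism f g (cone x c) =
          cone (f x) (cone (g x) (push g c)) - cone (f x) (prism f g c) := fun c => by
        have : prism f g ∘ₗ cone x = cone (f x) ∘ₗ cone (g x) ∘ₗ push g -
            cone (f x) ∘ₗ prism f g := hom_ext fun l => by simp [prismList]
        exact LinearMap.congr_fun this c
      have ih' : prism f g (bdList l) = Finsupp.single (l.map g) 1 - Finsupp.single (l.map f) 1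
          - bd (prismList f g l) := by
        rw [eq_sub_iff_add_eq, add_comm]; simpa using ih
      simp [prismList, bdList, bd_cone, key, ih', bdList_map]
      abel
  exact LinearMap.congr_fun this c

/-- Naturality of the subdivision. -/
lemma push_sd {b : List D → D} {b' : List D' → D'} {f : D → D'}
    (h : ∀ l ≠ [], f (b l) = b' (l.map f)) (n : ℕ) (c : ListChain D) :
    push f (sd b n c) = sd b' n (push f c) := by
  induction n generalizing c with
  | zero => simp [sd]
  | succ n ih =>
    have : push f ∘ₗ sd b (n + 1) = sd b' (n + 1) ∘ₗ push f := hom_ext fun l => by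
      rcases l with _ | ⟨x, l⟩
      · simp [bdList]
      · rw [LinearMap.comp_apply, sd_succ_single, push_cone, ih, h _ (by simp), ← bdList_map]
        simp
    exact LinearMap.congr_fun this c

lemma push_sd_iterate {b : List D → D} {b' : List D' → D'} {f : D → D'}
    (h : ∀ l ≠ [], f (b l) = b' (l.map f)) (n k : ℕ) (c : ListChain D) :
    push f ((sd b n ^ k) c) = (sd b' n ^ k) (push f c) := by
  induction k generalizing c with
  | zero => simp
  | succ k ih => rw [pow_succ, pow_succ, Module.End.mul_apply, Module.End.mul_apply, ih, push_sd h]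

/-! ### Supports -/

/-- Chains all of whose sequences lie in `s`. -/
noncomputable abbrev supp (s : Set (List D)) : Submodule ℝ (ListChain D) := Finsupp.supported ℝ ℝ s

lemma single_mem {s : Set (List D)} {l : List D} (h : l ∈ s) (r : ℝ) :
    Finsupp.single l r ∈ supp s := Finsupp.single_mem_supported ℝ r h

lemma map_mem {M : Type*} [AddCommGroup M] [Module ℝ M] {s : Set (List D)} {N : Submodule ℝ M}
    {f : ListChain D →ₗ[ℝ] M} (h : ∀ l ∈ s, f (Finsupp.single l 1) ∈ N) {c : ListChain D}
    (hc : c ∈ supp s) : f c ∈ N := by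
  have : supp s ≤ N.comap f := by
    rw [supp, Finsupp.supported_eq_span_single, Submodule.span_le]
    rintro _ ⟨l, hl, rfl⟩
    exact h l hl
  exact this hc

lemma map_eq {M : Type*} [AddCommGroup M] [Module ℝ M] {s : Set (List D)}
    {f g : ListChain D →ₗ[ℝ] M} (h : ∀ l ∈ s, f (Finsupp.single l 1) = g (Finsupp.single l 1))
    {c : ListChain D} (hc : c ∈ supp s) : f c = g c := by
  have := map_mem (f := f - g) (N := ⊥) (fun l hl => by simp [h l hl]) hc
  simpa [sub_eq_zero] using this

lemma map_eq_zero {M : Type*} [AddCommGroup M] [Module ℝ M] {s : Set (List D)}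
    {f : ListChain D →ₗ[ℝ] M} (h : ∀ l ∈ s, f (Finsupp.single l 1) = 0)
    {c : ListChain D} (hc : c ∈ supp s) : f c = 0 := by
  simpa using map_eq (g := 0) (by simpa using h) hc

lemma supp_mono {s t : Set (List D)} (h : ∀ l ∈ s, l ∈ t) : supp s ≤ supp t :=
  Finsupp.supported_mono h

lemma mem_supp_and {p q : List D → Prop} {c : ListChain D} (hp : c ∈ supp {l | p l})
    (hq : c ∈ supp {l | q l}) : c ∈ supp {l | p l ∧ q l} := by
  rw [Finsupp.mem_supported] at *
  exact fun l hl => ⟨hp hl, hq hl⟩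

lemma cone_mem {x : D} {s t : Set (List D)} (h : ∀ l ∈ s, x :: l ∈ t) {c : ListChain D}
    (hc : c ∈ supp s) : cone x c ∈ supp t :=
  map_mem (fun l hl => by simpa using single_mem (h l hl) 1) hc

/-- The boundary of a sequence consists of sequences of length one less with vertices in it. -/
lemma bdList_mem (l : List D) :
    bdList l ∈ supp {l' | l'.length + 1 = l.length ∧ ∀ x ∈ l', x ∈ l} := by
  induction l with
  | nil => simp [bdList]
  | cons x l ih =>
    refine sub_mem (single_mem (by simp +contextual) 1) (cone_mem ?_ ih)
    rintro l' ⟨h, h'⟩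
    refine ⟨by simpa using h, ?_⟩
    simp only [List.mem_cons, forall_eq_or_imp, true_or, true_and]
    exact fun y hy => Or.inr (h' y hy)

/-- The prism over a sequence has one more vertex, all taken from the two images. -/
lemma prismList_mem (f g : D → D') (l : List D) :
    prismList f g l ∈ supp {l' | l'.length = l.length + 1 ∧ ∀ y ∈ l', ∃ x ∈ l, y = f x ∨ y = g x} := by
  induction l with
  | nil => simp [prismList]
  | cons x l ih =>
    refine sub_mem ?_ (cone_mem ?_ ih)
    · simp only [cone_single]
      refine single_mem (show _ ∧ _ from ⟨by simp, ?_⟩) 1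
      intro y hy
      simp only [List.mem_cons, List.mem_map] at hy
      rcases hy with rfl | rfl | ⟨z, hz, rfl⟩
      · exact ⟨x, by simp⟩
      · exact ⟨x, by simp⟩
      · exact ⟨z, by simp [hz]⟩
    · rintro l' ⟨h, h'⟩
      refine ⟨by simpa using h, ?_⟩
      intro y hy
      rcases List.mem_cons.1 hy with rfl | hy
      · exact ⟨x, by simp⟩
      · obtain ⟨z, hz, hz'⟩ := h' y hy
        exact ⟨z, by simp [hz], hz'⟩

/-- Subdivision preserves lengths and subsets which are closed under barycenters. -/
lemma sd_mem {b : List D → D} {S : Set D} (hS : ∀ l ≠ [], (∀ x ∈ l, x ∈ S) → b l ∈ S) (n : ℕ)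
    {c : ListChain D} (hc : c ∈ supp {l | l.length = n ∧ ∀ x ∈ l, x ∈ S}) :
    sd b n c ∈ supp {l | l.length = n ∧ ∀ x ∈ l, x ∈ S} := by
  induction n generalizing c with
  | zero => simpa [sd] using hc
  | succ n ih =>
    refine map_mem (fun l hl => ?_) hc
    obtain ⟨h1, h2⟩ := hl
    rw [sd_succ_single]
    refine cone_mem ?_ (ih (supp_mono ?_ (bdList_mem l)))
    · rintro l' ⟨h, h'⟩
      refine ⟨by simp [h], ?_⟩
      intro x hx
      rcases List.mem_cons.1 hx with rfl | hx
      · exact hS _ (by rintro rfl; simp at h1) h2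
      · exact h' x hx
    · rintro l' ⟨h, h'⟩
      exact ⟨by omega, fun x hx => h2 _ (h' x hx)⟩

lemma sdHtpy_mem {b : List D → D} {S : Set D} (hS : ∀ l ≠ [], (∀ x ∈ l, x ∈ S) → b l ∈ S) (n : ℕ)
    {c : ListChain D} (hc : c ∈ supp {l | l.length = n ∧ ∀ x ∈ l, x ∈ S}) :
    sdHtpy b n c ∈ supp {l | l.length = n + 1 ∧ ∀ x ∈ l, x ∈ S} := by
  induction n generalizing c with
  | zero => simp [sdHtpy]
  | succ n ih =>
    refine map_mem (fun l hl => ?_) hc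
    obtain ⟨h1, h2⟩ := id hl
    rw [sdHtpy_succ_single]
    refine cone_mem ?_ (sub_mem (single_mem hl 1) (ih (supp_mono ?_ (bdList_mem l))))
    · rintro l' ⟨h, h'⟩
      refine ⟨by simp [h], ?_⟩
      intro x hx
      rcases List.mem_cons.1 hx with rfl | hx
      · exact hS _ (by rintro rfl; simp at h1) h2
      · exact h' x hx
    · rintro l' ⟨h, h'⟩
      exact ⟨by omega, fun x hx => h2 _ (h' x hx)⟩

lemma sd_iterate_mem {b : List D → D} {S : Set D}
    (hS : ∀ l ≠ [], (∀ x ∈ l, x ∈ S) → b l ∈ S) (n k : ℕ)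
    {c : ListChain D} (hc : c ∈ supp {l | l.length = n ∧ ∀ x ∈ l, x ∈ S}) :
    (sd b n ^ k) c ∈ supp {l | l.length = n ∧ ∀ x ∈ l, x ∈ S} := by
  induction k with
  | zero => simpa
  | succ k ih => rw [pow_succ', Module.End.mul_apply]; exact sd_mem hS n ih

end ListChain

namespace ListChain

/-! ### The mesh of iterated barycentric subdivisions -/

section Mesh

lemma norm_list_sum_le {E : Type*} [SeminormedAddCommGroup E] {l : List E} {d : ℝ} (h : ∀ x ∈ l, ‖x‖ ≤ d) :
    ‖l.sum‖ ≤ l.length * d := by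
  induction l with
  | nil => simp
  | cons y l ih =>
    simp only [List.mem_cons, forall_eq_or_imp] at h
    have := norm_add_le y l.sum
    simp only [List.sum_cons, List.length_cons, Nat.cast_add, Nat.cast_one]
    linarith [ih h.2]

variable {E : Type*} [NormedAddCommGroup E] [NormedSpace ℝ E]

/-- The barycenter of a sequence of points. -/
noncomputable def avg (l : List E) : E := (l.length : ℝ)⁻¹ • l.sum

lemma list_sum_map_sub (l : List E) (x : E) :
    (l.map (· - x)).sum = l.sum - (l.length : ℝ) • x := by
  induction l with
  | nil => simp
  | cons y l ih => simp [ih, add_smul]; abel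

lemma avg_sub {l : List E} (hl : l ≠ []) (x : E) :
    avg l - x = (l.length : ℝ)⁻¹ • (l.map (· - x)).sum := by
  have : (l.length : ℝ) ≠ 0 := by simpa using hl
  rw [list_sum_map_sub, smul_sub, smul_smul, inv_mul_cancel₀ this, one_smul, avg]

lemma avg_mem {S : Set E} (hS : Convex ℝ S) {l : List E} (hl : l ≠ []) (h : ∀ x ∈ l, x ∈ S) :
    avg l ∈ S := by
  have : avg l = ∑ i : Fin l.length, (l.length : ℝ)⁻¹ • l.get i := by
    rw [← Finset.smul_sum, avg, ← List.sum_ofFn, List.ofFn_get]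
  rw [this]
  have : (l.length : ℝ) ≠ 0 := by simpa using hl
  refine hS.sum_mem (fun i _ => by positivity) (by simp [this]) fun i _ => h _ (List.get_mem _ _)

lemma norm_sub_avg_le {N : ℕ} {d : ℝ} (hd : 0 ≤ d) {l : List E} (hN : l.length ≤ N + 1)
    (h : ∀ x ∈ l, ∀ y ∈ l, ‖x - y‖ ≤ d) {x : E} (hx : x ∈ l) :
    ‖x - avg l‖ ≤ N / (N + 1) * d := by
  rw [norm_sub_rev, avg_sub (List.ne_nil_of_mem hx)]
  obtain ⟨s, t, rfl⟩ := List.append_of_mem hx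
  have h1 : ‖((s ++ x :: t).map (· - x)).sum‖ ≤ (s.length + t.length) * d := by
    simp only [List.map_append, List.map_cons, sub_self, List.sum_append, List.sum_cons, zero_add]
    refine (norm_add_le _ _).trans ?_
    rw [add_mul]
    refine add_le_add ?_ ?_
    · simpa using norm_list_sum_le (l := s.map (· - x)) (d := d) (by simp; grind)
    · simpa using norm_list_sum_le (l := t.map (· - x)) (d := d) (by simp; grind)
  obtain ⟨a, ha⟩ : ∃ a : ℕ, a = s.length + t.length := ⟨_, rfl⟩
  have hl : (s ++ x :: t).length = a + 1 := by simp [ha]; omega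
  have haN : (a : ℝ) ≤ N := by exact_mod_cast (by omega)
  rw [norm_smul, norm_inv, Real.norm_natCast, hl]
  rw [show (s.length : ℝ) + t.length = a by simp [ha]] at h1
  calc ((a + 1 : ℕ) : ℝ)⁻¹ * _ ≤ ((a + 1 : ℕ) : ℝ)⁻¹ * (a * d) := by gcongr
    _ = a / (a + 1) * d := by push_cast; ring
    _ ≤ N / (N + 1) * d := by
      gcongr ?_ * _
      rw [div_le_div_iff₀ (by positivity) (by positivity)]
      linarith

/-- One subdivision step shrinks simplices of dimension at most `N` by the factor `N / (N + 1)`. -/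
lemma sd_single_mesh {N : ℕ} {d : ℝ} (hd : 0 ≤ d) (n : ℕ) (hn : n ≤ N + 1) (l : List E)
    (hl : l.length = n) (h : ∀ x ∈ l, ∀ y ∈ l, ‖x - y‖ ≤ d) :
    sd avg n (Finsupp.single l 1) ∈ supp {l' | l'.length = n ∧
      (∀ u ∈ l', ∀ z R, (∀ x ∈ l, ‖x - z‖ ≤ R) → ‖u - z‖ ≤ R) ∧
      ∀ u ∈ l', ∀ v ∈ l', ‖u - v‖ ≤ N / (N + 1) * d} := by
  induction n generalizing l with
  | zero =>
    obtain rfl := List.eq_nil_of_length_eq_zero hl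
    exact single_mem (by simp) 1
  | succ n ih =>
    have hne : l ≠ [] := by rintro rfl; simp at hl
    rw [sd_succ_single]
    have hc : (0 : ℝ) ≤ N / (N + 1) * d := by positivity
    refine cone_mem (s := {l' | l'.length = n ∧
      (∀ u ∈ l', ∀ z R, (∀ x ∈ l, ‖x - z‖ ≤ R) → ‖u - z‖ ≤ R) ∧
      ∀ u ∈ l', ∀ v ∈ l', ‖u - v‖ ≤ N / (N + 1) * d}) ?_ (map_mem ?_ (bdList_mem l))
    · rintro l' ⟨h1, h2, h3⟩
      have h4 : ∀ u ∈ l', ‖u - avg l‖ ≤ N / (N + 1) * d := fun u hu =>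
        h2 u hu _ _ fun x hx => norm_sub_avg_le hd (by omega) h hx
      refine ⟨by simp [h1], ?_, ?_⟩
      · intro u hu z R hR
        rcases List.mem_cons.1 hu with rfl | hu
        · have := avg_mem (convex_closedBall z R) hne (by simpa [dist_eq_norm] using hR)
          simpa [dist_eq_norm] using this
        · exact h2 u hu z R hR
      · intro u hu v hv
        rcases List.mem_cons.1 hu with rfl | hu <;> rcases List.mem_cons.1 hv with rfl | hv
        · simpa using hc
        · rw [norm_sub_rev]; exact h4 v hv
        · exact h4 u hu
        · exact h3 u hu v hv
    · rintro l' ⟨h1, h2⟩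
      refine supp_mono ?_ (ih (by omega) l' (by omega) fun x hx y hy => h x (h2 x hx) y (h2 y hy))
      rintro l'' ⟨h3, h4, h5⟩
      exact ⟨h3, fun u hu z R hR => h4 u hu z R fun x hx => hR x (h2 x hx), h5⟩

lemma sd_iterate_mesh {N n : ℕ} {d : ℝ} (hd : 0 ≤ d) (hn : n ≤ N + 1) (k : ℕ) {c : ListChain E}
    (hc : c ∈ supp {l | l.length = n ∧ ∀ x ∈ l, ∀ y ∈ l, ‖x - y‖ ≤ d}) :
    (sd avg n ^ k) c ∈ supp {l | l.length = n ∧ ∀ x ∈ l, ∀ y ∈ l,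
      ‖x - y‖ ≤ (N / (N + 1) : ℝ) ^ k * d} := by
  induction k with
  | zero => simpa using hc
  | succ k ih =>
    rw [pow_succ' (sd avg n), Module.End.mul_apply]
    refine map_mem (fun l hl => supp_mono ?_ (sd_single_mesh (by positivity) n hn l hl.1 hl.2)) ih
    rintro l' ⟨h1, -, h2⟩
    refine ⟨h1, fun x hx y hy => (h2 x hx y hy).trans_eq (by ring)⟩

/-- The simplices of iterated barycentric subdivisions become arbitrarily small. -/
lemma eventually_mesh {n : ℕ} {c : ListChain E} (hc : c ∈ supp {l | l.length = n}) {δ : ℝ}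
    (hδ : 0 < δ) :
    ∀ᶠ k in Filter.atTop, (sd avg n ^ k) c ∈
      supp {l | l.length = n ∧ ∀ x ∈ l, ∀ y ∈ l, ‖x - y‖ < δ} := by
  obtain ⟨d, hd, hcd⟩ : ∃ d, 0 ≤ d ∧
      c ∈ supp {l | l.length = n ∧ ∀ x ∈ l, ∀ y ∈ l, ‖x - y‖ ≤ d} := by
    classical
    let s : Finset E := c.support.biUnion fun l => l.toFinset
    obtain ⟨R, hR⟩ := s.finite_toSet.isBounded.exists_norm_le
    refine ⟨2 * max R 0, by positivity, ?_⟩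
    rw [Finsupp.mem_supported] at hc ⊢
    refine fun l hl => ⟨hc hl, fun x hx y hy => ?_⟩
    have h1 := hR x (by simpa [s] using ⟨l, by simpa using hl, by assumption⟩)
    have h2 := hR y (by simpa [s] using ⟨l, by simpa using hl, by assumption⟩)
    have := norm_sub_le x y
    linarith [le_max_left R 0]
  have hlim : Filter.Tendsto (fun k => (n / (n + 1) : ℝ) ^ k * d) Filter.atTop (nhds (0 * d)) :=
    (tendsto_pow_atTop_nhds_zero_of_lt_one (by positivity)
      ((div_lt_one (by positivity)).2 (by linarith))).mul_const d
  rw [zero_mul] at hlim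
  filter_upwards [hlim.eventually_lt_const hδ] with k hk
  refine supp_mono ?_ (sd_iterate_mesh (N := n) hd (by omega) k hcd)
  exact fun l hl => ⟨hl.1, fun x hx y hy => (hl.2 x hx y hy).trans_lt hk⟩

end Mesh
end ListChain

namespace ListChain

/-! ### The volume cochain -/

section Volume

variable {J : Type*}

/-- The affine embedding `x ↦ (1, x)`. -/
def homogenize (x : J → ℝ) : Option J → ℝ := fun o => o.elim 1 x

/-- The exterior product of the homogenized vertices. -/
noncomputable def wedge : ListChain (J → ℝ) →ₗ[ℝ] ExteriorAlgebra ℝ (Option J → ℝ) :=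
  Finsupp.linearCombination ℝ fun l =>
    (l.map fun x => ExteriorAlgebra.ι ℝ (homogenize x)).prod

@[simp] lemma wedge_single (l : List (J → ℝ)) :
    wedge (Finsupp.single l 1) = (l.map fun x => ExteriorAlgebra.ι ℝ (homogenize x)).prod := by
  simp [wedge]

lemma wedge_single_eq_ιMulti (l : List (J → ℝ)) :
    wedge (Finsupp.single l 1) =
      ExteriorAlgebra.ιMulti ℝ l.length fun i => homogenize (l.get i) := by
  rw [wedge_single, ExteriorAlgebra.ιMulti_apply]
  conv_lhs => rw [← List.ofFn_get l]
  rw [List.map_ofFn]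
  rfl

lemma wedge_cone (x : J → ℝ) (c : ListChain (J → ℝ)) :
    wedge (cone x c) = ExteriorAlgebra.ι ℝ (homogenize x) * wedge c := by
  have : wedge ∘ₗ cone x = LinearMap.mulLeft ℝ (ExteriorAlgebra.ι ℝ (homogenize x)) ∘ₗ wedge :=
    hom_ext fun l => by simp
  exact LinearMap.congr_fun this c

lemma wedge_bdList (l : List (J → ℝ)) :
    wedge (bdList l) = CliffordAlgebra.contractLeft (LinearMap.proj none : (Option J → ℝ) →ₗ[ℝ] ℝ)
      (wedge (Finsupp.single l 1)) := by
  induction l with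
  | nil => simp [bdList]
  | cons x l ih =>
    rw [bdList, map_sub, wedge_cone, ih, wedge_single, wedge_single, List.map_cons, List.prod_cons,
      ExteriorAlgebra.ι, CliffordAlgebra.contractLeft_ι_mul]
    simp [homogenize]

/-- The determinant as a linear form on the exterior algebra. -/
noncomputable def topForm (J : Type*) [Fintype J] [DecidableEq J] :
    ExteriorAlgebra ℝ (Option J → ℝ) →ₗ[ℝ] ℝ :=
  ExteriorAlgebra.liftAlternating fun i =>
    if h : Fintype.card (Option J) = i then
      (Matrix.detRowAlternating (n := Option J) (R := ℝ)).domDomCongr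
        ((Fintype.equivFin _).trans (finCongr h))
    else 0

variable [Fintype J] [DecidableEq J]

/-- The (normalized) oriented volume of simplices of full dimension, extended by zero. -/
noncomputable def vol : ListChain (J → ℝ) →ₗ[ℝ] ℝ := topForm J ∘ₗ wedge

lemma topForm_ιMulti_of_ne {i : ℕ} (h : Fintype.card (Option J) ≠ i) (v : Fin i → Option J → ℝ) :
    topForm J (ExteriorAlgebra.ιMulti ℝ i v) = 0 := by
  rw [topForm, ExteriorAlgebra.liftAlternating_apply_ιMulti, dif_neg h, AlternatingMap.zero_apply]

lemma topForm_ιMulti_of_eq {i : ℕ} (h : Fintype.card (Option J) = i) (v : Fin i → Option J → ℝ) :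
    topForm J (ExteriorAlgebra.ιMulti ℝ i v) =
      Matrix.det (Matrix.of fun o => v (Fin.cast h (Fintype.equivFin _ o))) := by
  rw [topForm, ExteriorAlgebra.liftAlternating_apply_ιMulti, dif_pos h]
  rfl

lemma vol_single_of_ne {l : List (J → ℝ)} (h : Fintype.card (Option J) ≠ l.length) :
    vol (Finsupp.single l 1) = 0 := by
  rw [vol, LinearMap.comp_apply, wedge_single_eq_ιMulti, topForm_ιMulti_of_ne h]

lemma vol_single_of_eq {l : List (J → ℝ)} (h : Fintype.card (Option J) = l.length) :
    vol (Finsupp.single l 1) = Matrix.det (Matrix.of fun o =>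
      homogenize (l.get (Fin.cast h (Fintype.equivFin _ o)))) := by
  rw [vol, LinearMap.comp_apply, wedge_single_eq_ιMulti, topForm_ιMulti_of_eq h]

/-- The volume is a cocycle. -/
lemma vol_bd (c : ListChain (J → ℝ)) : vol (bd c) = 0 := by
  have : vol ∘ₗ bd = (0 : ListChain (J → ℝ) →ₗ[ℝ] ℝ) := hom_ext fun l => by
    rw [LinearMap.comp_apply, bd_single, LinearMap.zero_apply]
    by_cases h : Fintype.card (Option J) < l.length
    · rw [vol, LinearMap.comp_apply, wedge_bdList, wedge_single_eq_ιMulti,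
        AlternatingMap.map_linearDependent, map_zero, map_zero]
      intro hl
      have := hl.fintype_card_le_finrank
      simp at this h
      omega
    · refine map_eq_zero (fun l' hl' => vol_single_of_ne ?_) (bdList_mem l)
      have := hl'.1
      omega
  exact LinearMap.congr_fun this c

/-- Simplices in a coordinate hyperplane have volume zero. -/
lemma vol_eq_zero_of_facet {l : List (J → ℝ)} {i : J} {s : ℝ} (h : ∀ x ∈ l, x i = s) :
    vol (Finsupp.single l 1) = 0 := by
  by_cases hl : Fintype.card (Option J) = l.length
  · rw [vol_single_of_eq hl]
    refine Matrix.exists_mulVec_eq_zero_iff.1 ⟨fun o => o.elim (-s) (Pi.single i 1), ?_, ?_⟩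
    · exact fun h => by simpa using congrFun h (some i)
    · ext o
      simp [Matrix.mulVec, dotProduct, Fintype.sum_option, homogenize, Pi.single_apply,
        h _ (List.getElem_mem _)]
  · exact vol_single_of_ne hl

lemma vol_push_mul (d : J → ℝ) (c : ListChain (J → ℝ)) :
    vol (push (fun x => d * x) c) = (∏ i, d i) * vol c := by
  have : vol ∘ₗ push (fun x => d * x) = (∏ i, d i) • vol := hom_ext fun l => by
    rw [LinearMap.comp_apply, push_single, LinearMap.smul_apply, smul_eq_mul]
    by_cases hl : Fintype.card (Option J) = l.length
    · rw [vol_single_of_eq hl, vol_single_of_eq (by simpa using hl)]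
      have := Matrix.det_mul_row (homogenize d) (Matrix.of fun o =>
        homogenize (l.get (Fin.cast hl (Fintype.equivFin _ o))))
      rw [Fintype.prod_option] at this
      simp only [homogenize, Option.elim_none, one_mul, Option.elim_some] at this
      rw [← this]
      congr 1
      ext o o'
      cases o' <;> simp [homogenize]
    · rw [vol_single_of_ne hl, vol_single_of_ne (by simpa using hl), mul_zero]
  exact LinearMap.congr_fun this c

end Volume

/-! ### The fundamental chain of the cube -/

section Cube

variable {J : Type*} [DecidableEq J]

/-- Translation in a coordinate direction, which moves one facet of the cube `[-1,1]ᴶ` to the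
opposite one. -/
def shift (i : J) (x : J → ℝ) : J → ℝ := x + Pi.single i 2

/-- The triangulated face of the cube `[-1,1]ᴶ` spanned by the given coordinate directions at the
vertex `(-1, …, -1)`. -/
noncomputable def cube : List J → ListChain (J → ℝ)
  | [] => Finsupp.single [fun _ => -1] 1
  | i :: L => prism id (shift i) (cube L)

/-- The vertices of the faces used in `cube`. -/
def face (L : List J) : Set (J → ℝ) :=
  {x | (∀ i, x i ∈ Set.Icc (-1) 1) ∧ ∀ i ∉ L, x i = -1}

lemma shift_mem_face {i : J} {L : List J} {x : J → ℝ} (hi : i ∉ L) (hx : x ∈ face L) :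
    shift i x ∈ face (i :: L) := by
  refine ⟨fun j => ?_, fun j hj => ?_⟩
  · rcases eq_or_ne j i with rfl | hj
    · simp [shift, hx.2 _ hi]; norm_num
    · simpa [shift, hj] using hx.1 j
  · simp only [List.mem_cons, not_or] at hj
    simp [shift, hj.1, hx.2 _ hj.2]

lemma face_subset_cons {J : Type*} {i : J} {L : List J} : face L ⊆ face (i :: L) :=
  fun _ hx => ⟨hx.1, fun j hj => hx.2 j (by simp_all)⟩

lemma cube_mem {L : List J} (hL : L.Nodup) :
    cube L ∈ supp {l | l.length = L.length + 1 ∧ ∀ x ∈ l, x ∈ face L} := by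
  induction L with
  | nil => exact single_mem (by simp [face]) 1
  | cons i L ih =>
    rw [List.nodup_cons] at hL
    refine map_mem (fun l hl => ?_) (ih hL.2)
    rw [prism_single]
    refine supp_mono ?_ (prismList_mem _ _ l)
    rintro l' ⟨h1, h2⟩
    refine ⟨by simp [h1, hl.1], fun y hy => ?_⟩
    obtain ⟨x, hx, rfl | rfl⟩ := h2 y hy
    · exact face_subset_cons (hl.2 _ hx)
    · exact shift_mem_face hL.1 (hl.2 x hx)

/-- The boundary of the cube consists of simplices which lie in facets. -/
lemma bd_cube_mem {L : List J} (hL : L.Nodup) :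
    bd (cube L) ∈ supp {l | l.length = L.length ∧ (∀ x ∈ l, x ∈ face L) ∧
      (L ≠ [] → ∃ i ∈ L, ∃ s, (s = -1 ∨ s = 1) ∧ ∀ x ∈ l, x i = s)} := by
  induction L with
  | nil => simp [cube, bdList]; exact single_mem (by simp) 1
  | cons i L ih =>
    rw [List.nodup_cons] at hL
    rw [cube, eq_sub_of_add_eq (bd_prism id (shift i) (cube L))]
    refine sub_mem (sub_mem ?_ ?_) ?_
    · refine map_mem (fun l hl => ?_) (cube_mem hL.2)
      rw [push_single]
      refine single_mem ?_ 1
      refine ⟨by simp [hl.1], ?_, fun _ => ⟨i, by simp, 1, by simp, ?_⟩⟩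
      · simp only [List.mem_map, forall_exists_index, and_imp, forall_apply_eq_imp_iff₂]
        exact fun x hx => shift_mem_face hL.1 (hl.2 x hx)
      · simp only [List.mem_map, forall_exists_index, and_imp, forall_apply_eq_imp_iff₂]
        intro x hx
        simp [shift, (hl.2 x hx).2 _ hL.1]; norm_num
    · refine map_mem (fun l hl => ?_) (cube_mem hL.2)
      rw [push_single, List.map_id]
      refine single_mem ?_ 1
      exact ⟨by simp [hl.1], fun x hx => face_subset_cons (hl.2 x hx),
        fun _ => ⟨i, by simp, -1, by simp, fun x hx => (hl.2 x hx).2 _ hL.1⟩⟩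
    · refine map_mem (fun l hl => ?_) (ih hL.2)
      rw [prism_single]
      refine supp_mono ?_ (prismList_mem _ _ l)
      rintro l' ⟨h1, h2⟩
      refine ⟨by simp [h1, hl.1], fun y hy => ?_, fun _ => ?_⟩
      · obtain ⟨x, hx, rfl | rfl⟩ := h2 y hy
        · exact face_subset_cons (hl.2.1 _ hx)
        · exact shift_mem_face hL.1 (hl.2.1 x hx)
      · rcases eq_or_ne L [] with rfl | hne
        · have := hl.1
          obtain rfl := List.eq_nil_of_length_eq_zero this
          refine ⟨i, by simp, 1, by simp, fun x hx => ?_⟩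
          obtain ⟨y, hy, -⟩ := h2 x hx
          simp at hy
        · obtain ⟨j, hj, s, hs, h3⟩ := hl.2.2 hne
          refine ⟨j, by simp [hj], s, hs, fun y hy => ?_⟩
          have hij : j ≠ i := by rintro rfl; exact hL.1 hj
          obtain ⟨x, hx, rfl | rfl⟩ := h2 y hy
          · exact h3 _ hx
          · simpa [shift, hij] using h3 x hx

/-- A linear map which takes the same values on opposite facets vanishes on the boundary of the
cube. -/
lemma map_bd_cube_eq_zero {M : Type*} [AddCommGroup M] [Module ℝ M] (L : List J) (hL : L.Nodup)
    (hne : L ≠ []) (Λ : ListChain (J → ℝ) →ₗ[ℝ] M)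
    (h : ∀ i ∈ L, ∀ l : List (J → ℝ), l.length = L.length → (∀ x ∈ l, x ∈ face L ∧ x i = -1) →
      Λ (Finsupp.single (l.map (shift i)) 1) = Λ (Finsupp.single l 1)) :
    Λ (bd (cube L)) = 0 := by
  induction L generalizing Λ with
  | nil => exact absurd rfl hne
  | cons i L ih =>
    rw [List.nodup_cons] at hL
    have h1 : Λ (push (shift i) (cube L)) = Λ (cube L) := by
      refine map_eq (f := Λ ∘ₗ push (shift i)) (fun l hl => ?_) (cube_mem hL.2)
      rw [LinearMap.comp_apply, push_single]
      exact h i (by simp) l hl.1 fun x hx => ⟨face_subset_cons (hl.2 x hx), (hl.2 x hx).2 i hL.1⟩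
    have h2 : (Λ ∘ₗ prism id (shift i)) (bd (cube L)) = 0 := by
      rcases eq_or_ne L [] with rfl | hL'
      · simp [cube, bdList, prismList]
      refine ih hL.2 hL' _ fun j hj l hl hl' => ?_
      have hcomm : ∀ l : List (J → ℝ), prismList id (shift i) (l.map (shift j)) =
          push (shift j) (prismList id (shift i) l) := by
        intro l
        induction l with
        | nil => simp [prismList]
        | cons x l ih =>
          have : ∀ x, shift i (shift j x) = shift j (shift i x) := fun x => by
            simp only [shift]; abel
          simp [prismList, ih, push_cone, this, Function.comp_def]
      rw [LinearMap.comp_apply, LinearMap.comp_apply, prism_single, prism_single, hcomm]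
      refine map_eq (f := Λ ∘ₗ push (shift j)) (fun l' hl'' => ?_) (prismList_mem _ _ l)
      rw [LinearMap.comp_apply, push_single]
      refine h j (by simp [hj]) l' (by simp [hl''.1, hl]) fun y hy => ?_
      have hij : j ≠ i := by rintro rfl; exact hL.1 hj
      obtain ⟨x, hx, rfl | rfl⟩ := hl''.2 y hy
      · exact ⟨face_subset_cons (hl' _ hx).1, (hl' _ hx).2⟩
      · exact ⟨shift_mem_face hL.1 (hl' _ hx).1, by simpa [shift, hij] using (hl' _ hx).2⟩
    rw [cube, eq_sub_of_add_eq (bd_prism id (shift i) (cube L)), map_sub, map_sub, h1]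
    simpa [show push id (cube L) = cube L by simp [push]] using h2

end Cube

section CubeVolume

variable {J : Type*} [DecidableEq J]

lemma wedge_prismList (i : J) (l : List (J → ℝ)) :
    wedge (prismList id (shift i) l) = -(l.length : ℝ) •
      (ExteriorAlgebra.ι ℝ (Pi.single (some i) 2) * wedge (Finsupp.single l 1)) := by
  have hs : ∀ x : J → ℝ, homogenize (shift i x) = homogenize x + Pi.single (some i) 2 := by
    intro x; ext o; cases o <;> simp [homogenize, shift, Pi.single_apply]
  have hmap : ∀ l : List (J → ℝ), ExteriorAlgebra.ι ℝ (Pi.single (some i) 2) *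
      wedge (Finsupp.single (l.map (shift i)) 1) =
      ExteriorAlgebra.ι ℝ (Pi.single (some i) 2) * wedge (Finsupp.single l 1) := by
    intro l
    induction l with
    | nil => simp
    | cons x l ih =>
      have anti := ExteriorAlgebra.ι_add_mul_swap (R := ℝ)
        (Pi.single (some i) 2 : Option J → ℝ) (homogenize x)
      have sq := ExteriorAlgebra.ι_sq_zero (R := ℝ) (Pi.single (some i) 2 : Option J → ℝ)
      rw [List.map_cons, ← cone_single, ← cone_single, wedge_cone, wedge_cone, hs, map_add,
        ← mul_assoc, mul_add, sq, add_zero, ← mul_assoc, eq_neg_of_add_eq_zero_left anti, neg_mul,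
        mul_assoc, ih]
      noncomm_ring
  induction l with
  | nil => simp [prismList]
  | cons x l ih =>
    have anti := ExteriorAlgebra.ι_add_mul_swap (R := ℝ)
      (Pi.single (some i) 2 : Option J → ℝ) (homogenize x)
    have sq := ExteriorAlgebra.ι_sq_zero (R := ℝ) (homogenize x)
    rw [prismList, map_sub, id, wedge_cone, wedge_cone, wedge_cone, ih, ← cone_single,
      wedge_cone, hs, map_add, add_mul, hmap, mul_add, ← mul_assoc, sq, ← mul_assoc, ← mul_assoc,
      eq_neg_of_add_eq_zero_left anti, mul_smul_comm, ← mul_assoc]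
    simp only [List.length_cons, neg_mul]
    push_cast
    rw [zero_mul]
    module

/-- The functional dual to `e_i`, normalized to vanish at the vertex `(-1, …, -1)`. -/
noncomputable def vertexDual (i : J) : (Option J → ℝ) →ₗ[ℝ] ℝ :=
  LinearMap.proj (R := ℝ) (φ := fun _ : Option J => ℝ) (some i) +
    LinearMap.proj (R := ℝ) (φ := fun _ : Option J => ℝ) none

lemma wedge_cube_ne_zero {L : List J} (hL : L.Nodup) :
    wedge (cube L) ≠ 0 ∧ ∀ i ∉ L, CliffordAlgebra.contractLeft (vertexDual i) (wedge (cube L)) = 0 := by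
  induction L with
  | nil =>
    refine ⟨?_, fun i _ => ?_⟩
    · intro h
      have h' : ExteriorAlgebra.ι ℝ (homogenize fun _ : J => -1) = 0 := by simpa [cube] using h
      rw [ExteriorAlgebra.ι_eq_zero_iff] at h'
      simpa [homogenize] using congrFun h' none
    · simp only [cube, wedge_single, List.map_cons, List.map_nil, List.prod_cons, List.prod_nil,
        mul_one]
      rw [ExteriorAlgebra.ι, CliffordAlgebra.contractLeft_ι]
      simp [vertexDual, homogenize]
  | cons i L ih =>
    rw [List.nodup_cons] at hL
    obtain ⟨ih1, ih2⟩ := ih hL.2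
    have h : wedge (cube (i :: L)) = -(L.length + 1 : ℝ) •
        (ExteriorAlgebra.ι ℝ (Pi.single (some i) 2) * wedge (cube L)) := by
      refine map_eq (f := wedge ∘ₗ prism id (shift i)) (g := -(L.length + 1 : ℝ) •
        (LinearMap.mulLeft ℝ (ExteriorAlgebra.ι ℝ (Pi.single (some i) 2)) ∘ₗ wedge))
        (fun l hl => ?_) (cube_mem hL.2)
      rw [LinearMap.comp_apply, prism_single, wedge_prismList, hl.1]
      simp
    have hj : ∀ j, CliffordAlgebra.contractLeft (vertexDual j) (wedge (cube (i :: L))) =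
        -(L.length + 1 : ℝ) • ((vertexDual j (Pi.single (some i) 2)) • wedge (cube L) -
          ExteriorAlgebra.ι ℝ (Pi.single (some i) 2) *
            CliffordAlgebra.contractLeft (vertexDual j) (wedge (cube L))) := fun j => by
      rw [h, map_smul, ExteriorAlgebra.ι, CliffordAlgebra.contractLeft_ι_mul]
    refine ⟨fun h0 => ?_, fun j hji => ?_⟩
    · have := hj i
      rw [h0, map_zero, ih2 i hL.1, mul_zero, sub_zero, eq_comm, smul_eq_zero,
        smul_eq_zero] at this
      rcases this with h1 | h1 | h1
      · have : (0 : ℝ) < L.length + 1 := by positivity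
        linarith
      · simp [vertexDual] at h1
      · exact ih1 h1
    · simp only [List.mem_cons, not_or] at hji
      rw [hj, ih2 j hji.2]
      simp [vertexDual, hji.1]

/-- In top degree the exterior product is a multiple of the volume. -/
lemma exists_wedge_eq_vol_smul [Fintype J] : ∃ w : ExteriorAlgebra ℝ (Option J → ℝ),
    ∀ c ∈ supp {l : List (J → ℝ) | l.length = Fintype.card J + 1}, wedge c = vol c • w := by
  let e := Fintype.equivFin (Option J)
  let f := (ExteriorAlgebra.ιMulti ℝ (M := Option J → ℝ)
    (Fintype.card (Option J))).domDomCongr e.symm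
  let w := f (Pi.basisFun ℝ (Option J))
  let g := (LinearMap.toSpanSingleton ℝ _ w).compAlternatingMap
    (Matrix.detRowAlternating (n := Option J) (R := ℝ))
  have hf : f = g := by
    refine Module.Basis.ext_alternating (Pi.basisFun ℝ (Option J)) fun v hv => ?_
    let σ := Equiv.ofBijective v (Finite.injective_iff_bijective.1 hv)
    change f (Pi.basisFun ℝ (Option J) ∘ σ) = g (Pi.basisFun ℝ (Option J) ∘ σ)
    rw [AlternatingMap.map_perm, AlternatingMap.map_perm]
    congr 1
    rw [LinearMap.compAlternatingMap_apply, LinearMap.toSpanSingleton_apply]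
    have : Matrix.detRowAlternating (R := ℝ) (Pi.basisFun ℝ (Option J)) = 1 := by
      rw [← Matrix.det_one (n := Option J)]
      change Matrix.det _ = _
      congr 1
      ext i j
      simp [Matrix.one_apply, Pi.single_apply, eq_comm]
    rw [this, one_smul]
  refine ⟨w, fun c hc => ?_⟩
  refine map_eq (g := LinearMap.toSpanSingleton ℝ _ w ∘ₗ vol) (fun l hl => ?_) hc
  have hl' : Fintype.card (Option J) = l.length := by rw [hl, Fintype.card_option]
  rw [LinearMap.comp_apply, vol_single_of_eq hl', wedge_single_eq_ιMulti]
  have key : ∀ (n : ℕ) (v : Fin n → Option J → ℝ) (h : Fintype.card (Option J) = n),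
      ExteriorAlgebra.ιMulti ℝ n v =
        ExteriorAlgebra.ιMulti ℝ (Fintype.card (Option J)) (v ∘ Fin.cast h) := by
    rintro n v rfl
    rfl
  have := congrArg (fun g => g fun o => homogenize (l.get (Fin.cast hl' (e o)))) hf
  refine Eq.trans ?_ this
  rw [key _ _ hl']
  simp only [f, AlternatingMap.domDomCongr_apply]
  congr 1
  ext i : 1
  simp

/-- The volume of the cube is nonzero. -/
lemma vol_cube_ne_zero [Fintype J] {L : List J} (hL : L.Nodup) (hL' : L.length = Fintype.card J) :
    vol (cube L) ≠ 0 := by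
  obtain ⟨w, hw⟩ := exists_wedge_eq_vol_smul (J := J)
  intro h0
  refine (wedge_cube_ne_zero hL).1 ?_
  rw [hw _ (supp_mono (fun l hl => hl.1.trans (by rw [hL'])) (cube_mem hL)), h0, zero_smul]

end CubeVolume
end ListChain

namespace ListChain

open Filter Topology

/-! ### Subdivisions of the cube and their degrees -/

section Degree

variable {J : Type*} [Fintype J]

/-- The coordinatewise retraction onto the cube. -/
def clamp (x : J → ℝ) : J → ℝ := fun i => max (-1) (min 1 (x i))

/-- The given sequence lies in a facet of the cube. -/
def InFacet (l : List (J → ℝ)) : Prop :=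
  ∃ i s, (s = -1 ∨ s = 1) ∧ ∀ x ∈ l, x ∈ Set.Icc (-1) 1 ∧ x i = s

lemma exists_clamp_eq [Nonempty J] {f f' : (J → ℝ) → J → ℝ} {l : List (J → ℝ)}
    (h1 : ∀ x ∈ l, 4 ≤ ‖f' x‖) (h2 : ∀ x ∈ l, ‖f x - f' x‖ ≤ ‖f' x‖ / 2)
    (h3 : ∀ x ∈ l, ∀ y ∈ l, ‖f' x - f' y‖ ≤ 1 / 2) :
    ∃ i s, ∀ x ∈ l, clamp (f x) i = s ∧ clamp (f' x) i = s := by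
  rcases l with _ | ⟨x₀, l⟩
  · exact ⟨Classical.arbitrary J, 0, by simp⟩
  obtain ⟨i, hi⟩ := Finite.exists_max fun i => ‖f' x₀ i‖
  have hx₀ : x₀ ∈ x₀ :: l := by simp
  have hM : ‖f' x₀‖ = ‖f' x₀ i‖ :=
    le_antisymm ((pi_norm_le_iff_of_nonneg (norm_nonneg _)).2 hi) (norm_le_pi_norm _ i)
  have h4 := h1 x₀ hx₀
  have key : ∀ x ∈ x₀ :: l, |f' x i - f' x₀ i| ≤ 1 / 2 ∧ |f x i - f' x i| ≤ |f' x₀ i| / 2 + 1 / 4 := by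
    intro x hx
    have h5 := h3 x hx x₀ hx₀
    have h6 := norm_le_pi_norm (f' x - f' x₀) i
    have h7 := norm_le_pi_norm (f x - f' x) i
    have h8 := norm_sub_norm_le (f' x) (f' x₀)
    simp only [Pi.sub_apply, Real.norm_eq_abs] at h6 h7 hM
    have := h2 x hx
    constructor <;> linarith
  rw [hM, Real.norm_eq_abs] at h4
  rcases le_total 0 (f' x₀ i) with h | h
  · refine ⟨i, 1, fun x hx => ?_⟩
    obtain ⟨h5, h6⟩ := key x hx
    rw [abs_of_nonneg h] at h4 h6
    rw [abs_le] at h5 h6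
    simp only [clamp]
    rw [min_eq_left (by linarith), min_eq_left (by linarith)]
    norm_num
  · refine ⟨i, -1, fun x hx => ?_⟩
    obtain ⟨h5, h6⟩ := key x hx
    rw [abs_of_nonpos h] at h4 h6
    rw [abs_le] at h5 h6
    simp only [clamp]
    rw [min_eq_right (by linarith), min_eq_right (by linarith), max_eq_left (by linarith),
      max_eq_left (by linarith)]
    simp

/-- The boundary of the cube. -/
def cubeBoundary (J : Type*) : Set (J → ℝ) := {x | x ∈ Set.Icc (-1) 1 ∧ ∃ i, x i = -1 ∨ x i = 1}

lemma InFacet.mem_cubeBoundary {J : Type*} {l : List (J → ℝ)} (h : InFacet l) {x : J → ℝ} (hx : x ∈ l) :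
    x ∈ cubeBoundary J := by
  obtain ⟨i, s, hs, h⟩ := h
  refine ⟨(h x hx).1, i, ?_⟩
  rwa [(h x hx).2]

lemma isCompact_cubeBoundary : IsCompact (cubeBoundary J) := by
  have : cubeBoundary J = Set.Icc (-1) 1 ∩ ⋃ i, {x : J → ℝ | x i = -1 ∨ x i = 1} := by
    ext x; simp [cubeBoundary]
  rw [this]
  refine isCompact_Icc.inter_right (isClosed_iUnion_of_finite fun i => ?_)
  exact (isClosed_eq (continuous_apply i) continuous_const).union
    (isClosed_eq (continuous_apply i) continuous_const)

lemma InFacet.mem_map_of_convex {l : List (J → ℝ)} (h : InFacet l) (k : ℕ) :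
    (sd avg l.length ^ k) (Finsupp.single l 1) ∈ supp {l' | l'.length = l.length ∧ InFacet l'} := by
  obtain ⟨i, s, hs, h⟩ := h
  have hconv : Convex ℝ {x : J → ℝ | x ∈ Set.Icc (-1) 1 ∧ x i = s} := by
    refine (convex_Icc _ _).inter (convex_hyperplane (f := fun x : J → ℝ => x i) ⟨?_, ?_⟩ s)
    · intros; rfl
    · intros; rfl
  refine supp_mono ?_ (sd_iterate_mem (S := {x : J → ℝ | x ∈ Set.Icc (-1) 1 ∧ x i = s})
    (fun l hl h => avg_mem hconv hl h) _ k
    (single_mem (show _ ∧ _ from ⟨rfl, h⟩) 1))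
  exact fun l' hl' => ⟨hl'.1, i, s, hs, hl'.2⟩

lemma sdHtpy_inFacet {l : List (J → ℝ)} (h : InFacet l) :
    sdHtpy avg l.length (Finsupp.single l 1) ∈ supp {l' | InFacet l'} := by
  obtain ⟨i, s, hs, h⟩ := h
  have hconv : Convex ℝ {x : J → ℝ | x ∈ Set.Icc (-1) 1 ∧ x i = s} := by
    refine (convex_Icc _ _).inter (convex_hyperplane (f := fun x : J → ℝ => x i) ⟨?_, ?_⟩ s)
    · intros; rfl
    · intros; rfl
  refine supp_mono ?_ (sdHtpy_mem (S := {x : J → ℝ | x ∈ Set.Icc (-1) 1 ∧ x i = s})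
    (fun l hl h => avg_mem hconv hl h) _
    (single_mem (show _ ∧ _ from ⟨rfl, h⟩) 1))
  exact fun l' hl' => ⟨i, s, hs, hl'.2⟩

variable [DecidableEq J]

/-- The iterated barycentric subdivisions of the cube `[-1,1]ᴶ`. -/
noncomputable def cubeSd (J : Type*) [Fintype J] [DecidableEq J] (k : ℕ) : ListChain (J → ℝ) :=
  (sd avg (Fintype.card J + 1) ^ k) (cube (Finset.univ : Finset J).toList)

lemma cubeSd_mem (k : ℕ) : cubeSd J k ∈
    supp {l | l.length = Fintype.card J + 1 ∧ ∀ x ∈ l, x ∈ Set.Icc (-1) 1} := by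
  refine sd_iterate_mem (fun l hl h => avg_mem (convex_Icc _ _) hl h) _ k
    (supp_mono ?_ (cube_mem (Finset.nodup_toList _)))
  rintro l ⟨h1, h2⟩
  refine ⟨by simpa using h1, fun x hx => ⟨fun i => ((h2 x hx).1 i).1, fun i => ((h2 x hx).1 i).2⟩⟩

lemma bd_cubeSd_mem [Nonempty J] (k : ℕ) : bd (cubeSd J k) ∈
    supp {l | l.length = Fintype.card J ∧ InFacet l} := by
  rw [cubeSd, bd_sd_iterate]
  refine map_mem (fun l hl => ?_) (bd_cube_mem (Finset.nodup_toList _))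
  have h1 : l.length = Fintype.card J := by simpa using hl.1
  rw [← h1]
  refine InFacet.mem_map_of_convex ?_ k
  obtain ⟨i, -, s, hs, h2⟩ := hl.2.2 (by simp [Finset.univ_eq_empty_iff])
  exact ⟨i, s, hs, fun x hx => ⟨⟨fun i => ((hl.2.1 x hx).1 i).1, fun i => ((hl.2.1 x hx).1 i).2⟩,
    h2 x hx⟩⟩

lemma eventually_mesh_cubeSd {δ : ℝ} (hδ : 0 < δ) : ∀ᶠ k in atTop, cubeSd J k ∈
    supp {l | ∀ x ∈ l, ∀ y ∈ l, ‖x - y‖ < δ} := by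
  filter_upwards [eventually_mesh (c := cube (Finset.univ : Finset J).toList)
    (n := Fintype.card J + 1) (supp_mono (fun l hl => by simpa using hl.1)
      (cube_mem (Finset.nodup_toList _))) hδ] with k hk
  exact supp_mono (fun l hl => hl.2) hk

lemma eventually_mesh_bd_cubeSd {δ : ℝ} (hδ : 0 < δ) : ∀ᶠ k in atTop, bd (cubeSd J k) ∈
    supp {l | ∀ x ∈ l, ∀ y ∈ l, ‖x - y‖ < δ} := by
  filter_upwards [eventually_mesh_cubeSd (J := J) hδ] with k hk
  refine map_mem (fun l hl => ?_) hk
  rw [bd_single]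
  refine supp_mono ?_ (bdList_mem l)
  exact fun l' hl' x hx y hy => hl x (hl'.2 x hx) y (hl'.2 y hy)

lemma vol_eq_zero_of_inFacet {l : List (J → ℝ)} (h : InFacet l) : vol (Finsupp.single l 1) = 0 := by
  obtain ⟨i, s, -, h⟩ := h
  exact vol_eq_zero_of_facet fun x hx => (h x hx).2

lemma vol_sd {c : ListChain (J → ℝ)}
    (hc : bd c ∈ supp {l | l.length = Fintype.card J ∧ InFacet l}) :
    vol (sd avg (Fintype.card J + 1) c) = vol c := by
  have h0 : (vol ∘ₗ sdHtpy avg (Fintype.card J)) (bd c) = 0 := by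
    refine map_eq_zero (fun l hl => ?_) hc
    rw [LinearMap.comp_apply, ← hl.1]
    exact map_eq_zero (fun l' hl' => vol_eq_zero_of_inFacet hl') (sdHtpy_inFacet hl.2)
  have h : sd avg (Fintype.card J + 1) c = c - bd (sdHtpy avg (Fintype.card J + 1) c) -
      sdHtpy avg (Fintype.card J) (bd c) := by
    rw [sub_sub, bd_sdHtpy, sub_sub_cancel]
  rw [LinearMap.comp_apply] at h0
  rw [h, map_sub, map_sub, vol_bd, h0, sub_zero, sub_zero]

lemma vol_cubeSd [Nonempty J] (k : ℕ) :
    vol (cubeSd J k) = vol (cube (Finset.univ : Finset J).toList) := by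
  induction k with
  | zero => simp [cubeSd]
  | succ k ih =>
    have h : cubeSd J (k + 1) = sd avg (Fintype.card J + 1) (cubeSd J k) := by
      rw [cubeSd, pow_succ' (sd _ _), Module.End.mul_apply, cubeSd]
    rw [h, vol_sd (bd_cubeSd_mem k), ih]

lemma vol_cubeSd_ne_zero [Nonempty J] (k : ℕ) : vol (cubeSd J k) ≠ 0 := by
  rw [vol_cubeSd]
  exact vol_cube_ne_zero (Finset.nodup_toList _) (by simp)

/-- If two maps send the simplices of the boundary to common hyperplanes, then the image chains have
the same volume. -/
lemma vol_push_eq {f g : (J → ℝ) → J → ℝ} {k : ℕ} {s : Set (List (J → ℝ))}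
    (hs : bd (cubeSd J k) ∈ supp s)
    (h : ∀ l ∈ s, ∃ i s, ∀ x ∈ l, f x i = s ∧ g x i = s) :
    vol (push f (cubeSd J k)) = vol (push g (cubeSd J k)) := by
  have h1 := congrArg vol (bd_prism f g (cubeSd J k))
  have h0 : vol (prism f g (bd (cubeSd J k))) = 0 := by
    refine map_eq_zero (f := vol ∘ₗ prism f g) (fun l hl => ?_) hs
    rw [LinearMap.comp_apply, prism_single]
    refine map_eq_zero (fun l' hl' => ?_) (prismList_mem f g l)
    obtain ⟨i, s, h⟩ := h l hl
    refine vol_eq_zero_of_facet (i := i) (s := s) fun y hy => ?_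
    obtain ⟨x, hx, rfl | rfl⟩ := hl'.2 y hy
    exacts [(h x hx).1, (h x hx).2]
  rw [map_add, vol_bd, h0, add_zero, map_sub] at h1
  linarith

/-- Sufficiently close maps have the same degree. -/
lemma eventually_vol_push_eq [Nonempty J] {f f' : (J → ℝ) → J → ℝ} (hf' : Continuous f')
    (h1 : ∀ x ∈ cubeBoundary J, 4 ≤ ‖f' x‖)
    (h2 : ∀ x ∈ cubeBoundary J, ‖f x - f' x‖ ≤ ‖f' x‖ / 2) :
    ∀ᶠ k in atTop, vol (push (clamp ∘ f) (cubeSd J k)) = vol (push (clamp ∘ f') (cubeSd J k)) := by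
  have huc := (isCompact_cubeBoundary (J := J)).uniformContinuousOn_of_continuous hf'.continuousOn
  obtain ⟨δ, hδ, h⟩ := Metric.uniformContinuousOn_iff.1 huc (1 / 2) (by norm_num)
  filter_upwards [eventually_mesh_bd_cubeSd (J := J) hδ] with k hk
  refine vol_push_eq (mem_supp_and hk (bd_cubeSd_mem k)) ?_
  rintro l ⟨hl1, -, hl2⟩
  refine exists_clamp_eq (fun x hx => h1 x (hl2.mem_cubeBoundary hx))
    (fun x hx => h2 x (hl2.mem_cubeBoundary hx)) fun x hx y hy => ?_
  rw [← dist_eq_norm]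
  exact (h x (hl2.mem_cubeBoundary hx) y (hl2.mem_cubeBoundary hy)
    (by rw [dist_eq_norm]; exact hl1 x hx y hy)).le

/-- Homotopy invariance of the degree. -/
lemma eventually_vol_push_eq_of_homotopy [Nonempty J] {h : ℝ → (J → ℝ) → J → ℝ}
    (hc : Continuous fun p : ℝ × (J → ℝ) => h p.1 p.2)
    (hb : ∀ s ∈ Set.Icc (0 : ℝ) 1, ∀ x ∈ cubeBoundary J, 4 ≤ ‖h s x‖) :
    ∀ᶠ k in atTop, vol (push (clamp ∘ h 0) (cubeSd J k)) =
      vol (push (clamp ∘ h 1) (cubeSd J k)) := by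
  let F : unitInterval → Germ (atTop : Filter ℕ) ℝ := fun s =>
    ((fun k => vol (push (clamp ∘ h s) (cubeSd J k)) : ℕ → ℝ) : Germ atTop ℝ)
  have hF : IsLocallyConstant F := by
    rw [IsLocallyConstant.iff_eventually_eq]
    intro s₀
    have : ∀ᶠ s : ℝ in 𝓝 (s₀ : ℝ), ∀ x ∈ cubeBoundary J, ‖h s x - h s₀ x‖ < 2 := by
      refine isCompact_cubeBoundary.eventually_forall_of_forall_eventually fun x _ => ?_
      have hc' : Continuous fun p : ℝ × (J → ℝ) => ‖h p.1 p.2 - h s₀ p.2‖ :=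
        (hc.sub (hc.comp (continuous_const.prodMk continuous_snd))).norm
      exact hc'.continuousAt.eventually_lt continuousAt_const (by simp)
    filter_upwards [continuous_subtype_val.continuousAt.eventually this] with s hs
    refine Germ.coe_eq.2 ?_
    refine eventually_vol_push_eq (hc.comp (continuous_const.prodMk continuous_id))
      (hb s₀ s₀.2) fun x hx => (hs x hx).le.trans ?_
    linarith [hb s₀ s₀.2 x hx]
  exact Germ.coe_eq.1 (hF.apply_eq_of_preconnectedSpace 0 1)

end Degree
end ListChain

namespace ListChain

open Filter Topology

section LocalDegree

variable {J : Type*} [Fintype J] [DecidableEq J]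

/-- Every invertible real matrix can be joined to a diagonal matrix with entries `±1` by a path of
invertible matrices. -/
lemma exists_path_to_diagonal (A : Matrix J J ℝ) (hA : A.det ≠ 0) :
    ∃ d : J → ℝ, (∀ i, d i = 1 ∨ d i = -1) ∧ ∃ γ : ℝ → Matrix J J ℝ, Continuous γ ∧ γ 0 = A ∧
      γ 1 = Matrix.diagonal d ∧ ∀ s ∈ Set.Icc (0 : ℝ) 1, (γ s).det ≠ 0 := by
  refine Matrix.diagonal_transvection_induction_of_det_ne_zero (fun A => ∃ d : J → ℝ,
    (∀ i, d i = 1 ∨ d i = -1) ∧ ∃ γ : ℝ → Matrix J J ℝ, Continuous γ ∧ γ 0 = A ∧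
      γ 1 = Matrix.diagonal d ∧ ∀ s ∈ Set.Icc (0 : ℝ) 1, (γ s).det ≠ 0) A hA ?_ ?_ ?_
  · intro D hD
    have hD' : ∀ i, D i ≠ 0 := by simpa [Finset.prod_eq_zero_iff] using hD
    refine ⟨fun i => SignType.sign (D i), fun i => ?_,
      fun s => Matrix.diagonal fun i => (1 - s) * D i + s * SignType.sign (D i), ?_, ?_, ?_, ?_⟩
    · rcases (hD' i).lt_or_gt with h | h <;> simp [h]
    · exact Continuous.matrix_diagonal (by fun_prop)
    · simp
    · simp
    · intro s hs
      rw [Matrix.det_diagonal, Finset.prod_ne_zero_iff]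
      intro i _
      rcases (hD' i).lt_or_gt with h | h
      · simp only [sign_neg h, SignType.coe_neg_one]
        rcases hs.1.eq_or_lt with rfl | h0
        · simpa using h.ne
        · nlinarith [hs.2, mul_nonneg (sub_nonneg.2 hs.2) (neg_nonneg.2 h.le)]
      · simp only [sign_pos h, SignType.coe_one]
        rcases hs.1.eq_or_lt with rfl | h0
        · simpa using h.ne'
        · nlinarith [hs.2, mul_nonneg (sub_nonneg.2 hs.2) h.le]
  · intro t
    refine ⟨fun _ => 1, fun _ => Or.inl rfl,
      fun s => Matrix.transvection t.i t.j ((1 - s) * t.c), ?_, ?_, ?_, ?_⟩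
    · simp only [Matrix.transvection]
      refine continuous_const.add ?_
      refine continuous_matrix fun a b => ?_
      simp only [Matrix.single_apply]
      split_ifs <;> fun_prop
    · simp [Matrix.TransvectionStruct.toMatrix]
    · simp
    · intro s _
      rw [Matrix.det_transvection_of_ne _ _ t.hij]
      exact one_ne_zero
  · rintro A B - - hPA hPB
    obtain ⟨d, hd, γ, h1, h2, h3, h4⟩ := hPA
    obtain ⟨d', hd', γ', h1', h2', h3', h4'⟩ := hPB
    refine ⟨fun i => d i * d' i, fun i => ?_, fun s => γ s * γ' s, h1.mul h1', ?_, ?_, ?_⟩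
    · rcases hd i with h | h <;> rcases hd' i with h' | h' <;> simp [h, h']
    · simp [h2, h2']
    · simp [h3, h3']
    · intro s hs
      rw [Matrix.det_mul]
      exact mul_ne_zero (h4 s hs) (h4' s hs)

/-- An invertible linear map with positive determinant has local degree one. -/
lemma eventually_vol_linear [Nonempty J] (A : Matrix J J ℝ) (hA : 0 < A.det) {c : J → ℝ}
    (hc : ∀ i, c i ∈ Set.Ioo (-1) 1) :
    ∃ R : ℝ, ∀ r ≥ R, (∀ x ∈ cubeBoundary J, 4 ≤ ‖r • A.mulVec (x - c)‖) ∧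
      ∀ᶠ k in atTop, vol (push (clamp ∘ fun x => r • A.mulVec (x - c)) (cubeSd J k)) =
        vol (cubeSd J k) := by
  obtain ⟨d, hd, γ, hγ, hγ0, hγ1, hdet⟩ := exists_path_to_diagonal A hA.ne'
  have hprod : ∏ i, d i = 1 := by
    have hpos : 0 < (γ 1).det := by
      by_contra! h
      have hcont : ContinuousOn (fun s => (γ s).det) (Set.Icc 0 1) := hγ.matrix_det.continuousOn
      obtain ⟨s, hs, hs'⟩ := intermediate_value_Icc' zero_le_one hcont
        ⟨h, (by rw [hγ0]; exact hA.le)⟩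
      exact hdet s hs hs'
    rw [hγ1, Matrix.det_diagonal] at hpos
    have habs : |∏ i, d i| = 1 := by
      rw [Finset.abs_prod]
      refine Finset.prod_eq_one fun i _ => ?_
      rcases hd i with h | h <;> simp [h]
    rwa [abs_of_pos hpos] at habs
  have hmem : ∀ x ∈ cubeBoundary J, x - c ≠ 0 := by
    rintro x ⟨-, i, h⟩ h0
    have h1 := congrFun h0 i
    have h2 := hc i
    simp only [Pi.sub_apply, Pi.zero_apply] at h1
    rcases h with h | h <;> linarith [h2.1, h2.2]
  have hcont : Continuous fun p : ℝ × (J → ℝ) => (γ p.1).mulVec (p.2 - c) :=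
    (hγ.comp continuous_fst).matrix_mulVec (by fun_prop)
  obtain ⟨κ, hκ, hκ'⟩ : ∃ κ : ℝ, 0 < κ ∧ ∀ s ∈ Set.Icc (0 : ℝ) 1, ∀ x ∈ cubeBoundary J,
      κ ≤ ‖(γ s).mulVec (x - c)‖ := by
    have hK := (isCompact_Icc (a := (0 : ℝ)) (b := 1)).prod (isCompact_cubeBoundary (J := J))
    rcases (Set.Icc (0 : ℝ) 1 ×ˢ cubeBoundary J).eq_empty_or_nonempty with he | hne
    · refine ⟨1, one_pos, fun s hs x hx => ?_⟩
      have : (s, x) ∈ Set.Icc (0 : ℝ) 1 ×ˢ cubeBoundary J := ⟨hs, hx⟩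
      simp [he] at this
    · obtain ⟨p, hp, hmin⟩ := hK.exists_isMinOn hne hcont.norm.continuousOn
      refine ⟨‖(γ p.1).mulVec (p.2 - c)‖, ?_, fun s hs x hx => hmin (a := (s, x)) ⟨hs, hx⟩⟩
      rw [norm_pos_iff]
      intro h0
      exact hmem _ hp.2 (Matrix.eq_zero_of_mulVec_eq_zero (hdet _ hp.1) h0)
  obtain ⟨R', hR'⟩ : ∃ R' : ℝ, ∀ r ≥ R', ∀ i, 1 ≤ r * (1 - c i) ∧ 1 ≤ r * (1 + c i) := by
    have : ∀ᶠ r : ℝ in atTop, ∀ i, 1 ≤ r * (1 - c i) ∧ 1 ≤ r * (1 + c i) := by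
      rw [eventually_all]
      intro i
      exact ((tendsto_id.atTop_mul_const (by linarith [(hc i).2])).eventually_ge_atTop 1).and
        ((tendsto_id.atTop_mul_const (by linarith [(hc i).1])).eventually_ge_atTop 1)
    exact eventually_atTop.1 this
  refine ⟨max R' (4 / κ), fun r hr => ?_⟩
  have hr1 : 4 / κ ≤ r := (le_max_right _ _).trans hr
  have hr0 : 0 < r := (by positivity : (0 : ℝ) < 4 / κ).trans_le hr1
  have hb : ∀ s ∈ Set.Icc (0 : ℝ) 1, ∀ x ∈ cubeBoundary J, 4 ≤ ‖r • (γ s).mulVec (x - c)‖ := by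
    intro s hs x hx
    rw [norm_smul, Real.norm_of_nonneg hr0.le]
    rw [div_le_iff₀ hκ] at hr1
    exact hr1.trans (mul_le_mul_of_nonneg_left (hκ' s hs x hx) hr0.le)
  refine ⟨fun x hx => by simpa [hγ0] using hb 0 (by simp) x hx, ?_⟩
  filter_upwards [eventually_vol_push_eq_of_homotopy (h := fun s x => r • (γ s).mulVec (x - c))
    (hcont.const_smul r) hb] with k hk
  rw [hγ0, hγ1] at hk
  rw [hk]
  have h1 := vol_push_mul d (cubeSd J k)
  rw [hprod, one_mul] at h1
  rw [← h1]
  refine vol_push_eq (bd_cubeSd_mem k) ?_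
  rintro l ⟨-, i, s, hs, hl⟩
  refine ⟨i, d i * s, fun x hx => ⟨?_, by simp [(hl x hx).2]⟩⟩
  obtain ⟨h2, h3⟩ := hR' r ((le_max_left _ _).trans hr) i
  simp only [Function.comp_apply, clamp, Pi.smul_apply, Matrix.mulVec_diagonal, Pi.sub_apply,
    (hl x hx).2, smul_eq_mul]
  rcases hd i with h | h <;> rcases hs with rfl | rfl <;> rw [h]
  · rw [min_eq_right (by linarith), max_eq_left (by linarith)]; norm_num
  · rw [min_eq_left (by linarith)]; norm_num
  · rw [min_eq_left (by linarith)]; norm_num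
  · rw [min_eq_right (by linarith), max_eq_left (by linarith)]; norm_num

end LocalDegree
end ListChain

namespace ListChain

open Filter Topology

section Localization

variable {X J : Type*} [Fintype J]

/-- Local data at a nondegenerate zero. -/
lemma exists_local_bound {H : (J → ℝ) → J → ℝ} {κ : (J → ℝ) → ℝ} (hκ : Continuous κ) {c : J → ℝ}
    {L : (J → ℝ) →L[ℝ] (J → ℝ)} (hL : 0 < LinearMap.det (L : (J → ℝ) →ₗ[ℝ] (J → ℝ)))
    (hd : HasFDerivAt H L c) (h0 : H c = 0) (hc : 0 < κ c) :
    ∃ K > 0, (∀ v, ‖v‖ ≤ K * ‖L v‖) ∧ ∃ ρ > 0, ∀ x, dist x c < ρ →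
      0 < κ x ∧ ‖H x - L (x - c)‖ ≤ ‖L (x - c)‖ / 2 := by
  have hker : LinearMap.ker (L : (J → ℝ) →ₗ[ℝ] (J → ℝ)) = ⊥ := by
    refine (LinearMap.isUnit_iff_ker_eq_bot _).1 ((LinearMap.isUnit_iff_isUnit_det _).2 ?_)
    exact hL.ne'.isUnit
  obtain ⟨K, hK, hK'⟩ := (L : (J → ℝ) →ₗ[ℝ] (J → ℝ)).exists_antilipschitzWith hker
  have hK0 : (0 : ℝ) < K := hK
  have hb : ∀ v, ‖v‖ ≤ K * ‖L v‖ := fun v => by simpa using hK'.le_mul_dist v 0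
  refine ⟨K, hK0, hb, ?_⟩
  have h1 : ∀ᶠ x in 𝓝 c, 0 < κ x := hκ.continuousAt.eventually_const_lt hc
  have h2 := hd.isLittleO.bound (c := 1 / (2 * K)) (by positivity)
  obtain ⟨ρ, hρ, h⟩ := Metric.eventually_nhds_iff.1 (h1.and h2)
  refine ⟨ρ, hρ, fun x hx => ⟨(h hx).1, ?_⟩⟩
  have h3 := (h hx).2
  rw [h0, sub_zero] at h3
  calc ‖H x - L (x - c)‖ ≤ 1 / (2 * K) * ‖x - c‖ := h3
    _ ≤ 1 / (2 * K) * (K * ‖L (x - c)‖) := by gcongr; exact hb _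
    _ = ‖L (x - c)‖ / 2 := by field_simp

variable [DecidableEq J]

open scoped Classical in
/-- The volume cochain pulled back along `clamp ∘ r • g`, restricted to the region `0 < κ`. -/
noncomputable def locVol (g : X → J → ℝ) (κ : X → ℝ) (r : ℝ) : ListChain X →ₗ[ℝ] ℝ :=
  Finsupp.linearCombination ℝ fun l =>
    if ∀ x ∈ l, 0 < κ x then vol (Finsupp.single (l.map fun x => clamp (r • g x)) 1) else 0

lemma locVol_single_of_pos {g : X → J → ℝ} {κ : X → ℝ} {r : ℝ} {l : List X}
    (h : ∀ x ∈ l, 0 < κ x) : locVol g κ r (Finsupp.single l 1) =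
      vol (Finsupp.single (l.map fun x => clamp (r • g x)) 1) := by
  simp [locVol, if_pos h]

lemma locVol_single_of_not {g : X → J → ℝ} {κ : X → ℝ} {r : ℝ} {l : List X}
    (h : ¬ ∀ x ∈ l, 0 < κ x) : locVol g κ r (Finsupp.single l 1) = 0 := by
  simp only [locVol, Finsupp.linearCombination_single, if_neg h, smul_zero]

lemma locVol_push {Y : Type*} (G : Y → X) (g : X → J → ℝ) (κ : X → ℝ) (r : ℝ) (c : ListChain Y) :
    locVol g κ r (push G c) = locVol (g ∘ G) (κ ∘ G) r c := by
  have : locVol g κ r ∘ₗ push G = locVol (g ∘ G) (κ ∘ G) r := hom_ext fun l => by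
    simp [locVol, Function.comp_def]
  exact LinearMap.congr_fun this c

/-- Counting zeros: the localized volume of the cube is a positive multiple of its volume when all
zeros in the region `0 < κ` are nondegenerate and positively oriented. -/
theorem eventually_locVol_cubeSd [Nonempty J] {H : (J → ℝ) → J → ℝ} {κ : (J → ℝ) → ℝ}
    (hH : Continuous H) (hκ : Continuous κ) (hsep : ∀ x ∈ Set.Icc (-1) 1, κ x = 0 → H x ≠ 0)
    (hz : ∀ c ∈ Set.Icc (-1) 1, 0 < κ c → H c = 0 → (∀ i, c i ∈ Set.Ioo (-1) 1) ∧
      ∃ L : (J → ℝ) →L[ℝ] (J → ℝ), 0 < LinearMap.det (L : (J → ℝ) →ₗ[ℝ] (J → ℝ)) ∧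
        HasFDerivAt H L c)
    (hex : ∃ c ∈ Set.Icc (-1) 1, 0 < κ c ∧ H c = 0) :
    ∀ᶠ r in atTop, ∀ᶠ k in atTop, locVol H κ r (cubeSd J k) ≠ 0 := by
  let Z : Set (J → ℝ) := {c | c ∈ Set.Icc (-1) 1 ∧ 0 < κ c ∧ H c = 0}
  have hZ : IsCompact Z := by
    have : Z = Set.Icc (-1) 1 ∩ ({x | 0 ≤ κ x} ∩ {x | H x = 0}) := by
      ext x
      refine ⟨fun h => ⟨h.1, h.2.1.le, h.2.2⟩, fun h => ⟨h.1, h.2.1.lt_of_ne fun h' => ?_, h.2.2⟩⟩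
      exact hsep x h.1 h'.symm h.2.2
    rw [this]
    exact isCompact_Icc.inter_right ((isClosed_le continuous_const hκ).inter
      (isClosed_eq hH continuous_const))
  have hloc : ∀ c ∈ Z, ∃ L : (J → ℝ) →L[ℝ] (J → ℝ), ∃ K R ρ : ℝ, 0 < K ∧ 0 < ρ ∧
      (∀ v, ‖v‖ ≤ K * ‖L v‖) ∧
      (∀ x, dist x c < ρ → 0 < κ x ∧ ‖H x - L (x - c)‖ ≤ ‖L (x - c)‖ / 2) ∧
      ∀ r ≥ R, (∀ x ∈ cubeBoundary J, 4 ≤ ‖r • L (x - c)‖) ∧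
        ∀ᶠ k in atTop, vol (push (clamp ∘ fun x => r • L (x - c)) (cubeSd J k)) =
          vol (cubeSd J k) := by
    rintro c ⟨h1, h2, h3⟩
    obtain ⟨h4, L, hL, hd⟩ := hz c h1 h2 h3
    obtain ⟨K, hK, hK', ρ, hρ, hρ'⟩ := exists_local_bound hκ hL hd h3 h2
    obtain ⟨R, hR⟩ := eventually_vol_linear (LinearMap.toMatrix' (L : (J → ℝ) →ₗ[ℝ] (J → ℝ)))
      (by rwa [LinearMap.det_toMatrix']) h4
    refine ⟨L, K, R, ρ, hK, hρ, hK', hρ', ?_⟩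
    simpa only [LinearMap.toMatrix'_mulVec, ContinuousLinearMap.coe_coe] using hR
  choose! L K R ρ hK hρ hL hball hlin using hloc
  have hiso : ∀ c ∈ Z, ∀ x ∈ Z, dist x c < ρ c → x = c := by
    intro c hc x hx hd
    have h1 := (hball c hc x hd).2
    rw [hx.2.2, zero_sub, norm_neg] at h1
    have h2 := hL c hc (x - c)
    have h3 : ‖L c (x - c)‖ = 0 := le_antisymm (by linarith) (norm_nonneg _)
    rw [h3, mul_zero] at h2
    exact sub_eq_zero.1 (norm_le_zero_iff.1 h2)
  have hfin : Z.Finite := by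
    obtain ⟨t, ht⟩ := hZ.elim_nhds_subcover' (fun c _ => Metric.ball c (ρ c))
      fun c hc => Metric.ball_mem_nhds c (hρ c hc)
    refine (t.finite_toSet.image Subtype.val).subset fun x hx => ?_
    obtain ⟨c, hc, hxc⟩ := Set.mem_iUnion₂.1 (ht hx)
    exact ⟨c, hc, (hiso c c.2 x hx hxc).symm⟩
  obtain ⟨T, hT⟩ : ∃ T : Finset (J → ℝ), ∀ c, c ∈ T ↔ c ∈ Z := ⟨hfin.toFinset, by simp⟩
  have hTne : (T.card : ℝ) ≠ 0 := by
    obtain ⟨c, hc⟩ := hex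
    have : T.Nonempty := ⟨c, (hT c).2 hc⟩
    exact_mod_cast this.card_pos.ne'
  obtain ⟨δ, hδρ, hδ⟩ : ∃ δ : ℝ, (∀ c ∈ T, 4 * δ < ρ c) ∧ 0 < δ := by
    have h1 : ∀ᶠ δ : ℝ in 𝓝[>] 0, ∀ c ∈ T, 4 * δ < ρ c := by
      refine (eventually_all_finset T).2 fun c hc => ?_
      have : Tendsto (fun δ : ℝ => 4 * δ) (𝓝[>] 0) (𝓝 (4 * 0)) :=
        (continuous_const.mul continuous_id).continuousAt.tendsto.mono_left nhdsWithin_le_nhds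
      rw [mul_zero] at this
      exact this.eventually_lt_const (hρ c ((hT c).1 hc))
    exact (h1.and self_mem_nhdsWithin).exists
  have hdisj : ∀ c ∈ T, ∀ c' ∈ T, ∀ x, dist x c < 2 * δ → dist x c' < 2 * δ → c = c' := by
    intro c hc c' hc' x h1 h2
    refine hiso c' ((hT _).1 hc') c ((hT _).1 hc) ?_
    have := dist_triangle_left c c' x
    linarith [hδρ c' hc']
  obtain ⟨ε, hε, hfar⟩ : ∃ ε > 0, ∀ x ∈ Set.Icc (-1) 1, 0 ≤ κ x → (∀ c ∈ T, δ ≤ dist x c) →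
      ε ≤ ‖H x‖ := by
    have hcomp : IsCompact (Set.Icc (-1 : J → ℝ) 1 ∩ ({x | 0 ≤ κ x} ∩ {x | ∀ c ∈ T, δ ≤ dist x c})) :=
      isCompact_Icc.inter_right ((isClosed_le continuous_const hκ).inter (by
        simp only [Set.ofPred_forall]
        exact isClosed_biInter fun c _ => isClosed_le continuous_const (by fun_prop)))
    rcases Set.eq_empty_or_nonempty
      (Set.Icc (-1 : J → ℝ) 1 ∩ ({x | 0 ≤ κ x} ∩ {x | ∀ c ∈ T, δ ≤ dist x c})) with he | hne
    · refine ⟨1, one_pos, fun x h1 h2 h3 => ?_⟩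
      have hx : x ∈ Set.Icc (-1 : J → ℝ) 1 ∩ ({x | 0 ≤ κ x} ∩ {x | ∀ c ∈ T, δ ≤ dist x c}) :=
        ⟨h1, h2, h3⟩
      rw [he] at hx
      exact absurd hx (Set.notMem_empty _)
    · obtain ⟨p, hp, hmin⟩ := hcomp.exists_isMinOn hne hH.norm.continuousOn
      refine ⟨‖H p‖, norm_pos_iff.2 fun h0 => ?_, fun x h1 h2 h3 => hmin ⟨h1, h2, h3⟩⟩
      have hpZ : p ∈ Z := ⟨hp.1, hp.2.1.lt_of_ne fun h' => hsep p hp.1 h'.symm h0, h0⟩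
      have := hp.2.2 p ((hT p).2 hpZ)
      rw [dist_self] at this
      linarith
  have hlarge : ∀ᶠ r in atTop, ∀ c ∈ T, R c ≤ r ∧ 4 * K c ≤ r * δ :=
    (eventually_all_finset T).2 fun c _ => (eventually_ge_atTop _).and
      ((tendsto_id.atTop_mul_const hδ).eventually_ge_atTop _)
  filter_upwards [hlarge, (tendsto_id.atTop_mul_const hε).eventually_ge_atTop 4,
    eventually_gt_atTop 0] with r hr1 hr2 hr0
  simp only [id] at hr2
  let f : (J → ℝ) → (J → ℝ) → J → ℝ := fun c x =>
    if dist x c < 2 * δ then r • H x else r • L c (x - c)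
  have hf : ∀ c ∈ T, ∀ x, ‖f c x - r • L c (x - c)‖ ≤ ‖r • L c (x - c)‖ / 2 := by
    intro c hc x
    simp only [f]
    split_ifs with h
    · rw [← smul_sub, norm_smul, norm_smul, mul_div_assoc]
      gcongr
      exact (hball c ((hT c).1 hc) x (by linarith [hδρ c hc])).2
    · simp only [sub_self, norm_zero]
      positivity
  have huc : ∀ g : (J → ℝ) → J → ℝ, Continuous g → ∃ η > 0, ∀ x ∈ Set.Icc (-1 : J → ℝ) 1,
      ∀ y ∈ Set.Icc (-1 : J → ℝ) 1, ‖x - y‖ < η → ‖g x - g y‖ ≤ 1 / 2 := by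
    intro g hg
    obtain ⟨η, hη, h⟩ := Metric.uniformContinuousOn_iff.1
      ((isCompact_Icc (a := (-1 : J → ℝ)) (b := 1)).uniformContinuousOn_of_continuous
        hg.continuousOn) (1 / 2) (by norm_num)
    exact ⟨η, hη, fun x hx y hy hxy => by simpa [dist_eq_norm] using (h x hx y hy (by
      rwa [dist_eq_norm])).le⟩
  obtain ⟨η, hη, hη'⟩ := huc (fun x => r • H x) (hH.const_smul r)
  choose θ hθ hθ' using fun c => huc (fun x => r • L c (x - c)) (by fun_prop)
  have hdeg : ∀ᶠ k in atTop, ∀ c ∈ T, vol (push (clamp ∘ f c) (cubeSd J k)) =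
      vol (cubeSd J k) ∧ cubeSd J k ∈ supp {l | ∀ x ∈ l, ∀ y ∈ l, ‖x - y‖ < θ c} := by
    refine (eventually_all_finset T).2 fun c hc => ?_
    have h := hlin c ((hT c).1 hc) r (hr1 c hc).1
    filter_upwards [h.2, eventually_vol_push_eq (f := f c) (f' := fun x => r • L c (x - c))
      (by fun_prop) h.1 fun x _ => hf c hc x, eventually_mesh_cubeSd (J := J) (hθ c)] with k h1 h2 h3
    exact ⟨h2.trans h1, h3⟩
  filter_upwards [hdeg, eventually_mesh_cubeSd (J := J) hδ, eventually_mesh_cubeSd (J := J) hη]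
    with k hk1 hk2 hk3
  have hmain : locVol H κ r (cubeSd J k) = ∑ c ∈ T, vol (push (clamp ∘ f c) (cubeSd J k)) := by
    have hθall : cubeSd J k ∈ supp {l : List (J → ℝ) | ∀ c ∈ T, ∀ x ∈ l, ∀ y ∈ l, ‖x - y‖ < θ c} := by
      intro l hl c hc
      exact (hk1 c hc).2 hl
    have hsum : ∑ c ∈ T, vol (push (clamp ∘ f c) (cubeSd J k)) =
        (∑ c ∈ T, vol ∘ₗ push (clamp ∘ f c)) (cubeSd J k) := by
      simp [LinearMap.sum_apply]
    rw [hsum]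
    refine map_eq (D := J → ℝ) (fun l hl => ?_) (mem_supp_and (mem_supp_and (cubeSd_mem (J := J) k) hθall)
      (mem_supp_and hk2 hk3))
    obtain ⟨⟨⟨-, hIcc⟩, hlθ⟩, hlδ, hlη⟩ := hl
    simp only [LinearMap.sum_apply, LinearMap.comp_apply, push_single]
    have hvanish : ∀ c ∈ T, (∀ x ∈ l, δ ≤ dist x c) →
        vol (J := J) (Finsupp.single (l.map (clamp ∘ f c)) 1) = 0 := by
      intro c hc hl
      obtain ⟨i, s, his⟩ := exists_clamp_eq (f := f c) (f' := fun x => r • L c (x - c)) (l := l)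
        (fun x hx => by
          have h1 := hl x hx
          have h2 := hL c ((hT c).1 hc) (x - c)
          have h3 := (hr1 c hc).2
          have h4 := hK c ((hT c).1 hc)
          rw [norm_smul, Real.norm_of_nonneg hr0.le]
          rw [dist_eq_norm] at h1
          refine le_of_mul_le_mul_left ?_ h4
          calc K c * 4 = 4 * K c := mul_comm _ _
            _ ≤ r * δ := h3
            _ ≤ r * (K c * ‖L c (x - c)‖) := by gcongr; exact h1.trans h2
            _ = K c * (r * ‖L c (x - c)‖) := by ring)
        (fun x _ => hf c hc x)
        (fun x hx y hy => hθ' c x (hIcc x hx) y (hIcc y hy) (hlθ c hc x hx y hy))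
      refine vol_eq_zero_of_facet (i := i) (s := s) fun y hy => ?_
      obtain ⟨x, hx, rfl⟩ := List.mem_map.1 hy
      exact (his x hx).1
    have hnear : ∀ c, ¬ (∀ x ∈ l, dist x c < 2 * δ) → ∀ x ∈ l, δ ≤ dist x c := by
      intro c h x hx
      by_contra! hlt
      refine h fun y hy => ?_
      have h1 := hlδ y hy x hx
      rw [← dist_eq_norm] at h1
      linarith [dist_triangle y x c]
    rcases eq_or_ne l [] with rfl | hne
    · have hv : vol (Finsupp.single ([] : List (J → ℝ)) 1) = 0 :=
        vol_single_of_ne (by simp)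
      rw [locVol_single_of_pos (by simp)]
      simp [hv]
    by_cases hcase : ∃ c ∈ T, ∀ x ∈ l, dist x c < 2 * δ
    · obtain ⟨c, hc, hlc⟩ := hcase
      rw [Finset.sum_eq_single_of_mem c hc fun c' hc' hcc' => hvanish c' hc' (hnear c' fun h => by
        obtain ⟨x, hx⟩ := List.exists_mem_of_ne_nil l hne
        exact hcc' (hdisj c' hc' c hc x (h x hx) (hlc x hx)))]
      rw [locVol_single_of_pos fun x hx => (hball c ((hT c).1 hc) x
        (by linarith [hlc x hx, hδρ c hc])).1]
      congr 2
      refine List.map_congr_left fun x hx => ?_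
      simp only [Function.comp_apply, f, if_pos (hlc x hx)]
    · push Not at hcase
      rw [Finset.sum_eq_zero fun c hc => hvanish c hc (hnear c fun h => by
        obtain ⟨x, hx, hxc⟩ := hcase c hc
        exact absurd (h x hx) (not_lt.2 hxc))]
      by_cases hpos : ∀ x ∈ l, 0 < κ x
      · rw [locVol_single_of_pos hpos]
        obtain ⟨i, s, his⟩ := exists_clamp_eq (f := fun x => r • H x) (f' := fun x => r • H x)
          (l := l) (fun x hx => by
            rw [norm_smul, Real.norm_of_nonneg hr0.le]
            refine hr2.trans ?_
            gcongr
            refine hfar x (hIcc x hx) (hpos x hx).le fun c hc => hnear c (fun h => ?_) x hx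
            obtain ⟨x, hx, hxc⟩ := hcase c hc
            exact absurd (h x hx) (not_lt.2 hxc))
          (fun x _ => by simp only [sub_self, norm_zero]; positivity)
          (fun x hx y hy => hη' x (hIcc x hx) y (hIcc y hy) (hlη x hx y hy))
        refine vol_eq_zero_of_facet (i := i) (s := s) fun y hy => ?_
        obtain ⟨x, hx, rfl⟩ := List.mem_map.1 hy
        exact (his x hx).1
      · exact locVol_single_of_not hpos
  rw [hmain, Finset.sum_congr rfl fun c hc => (hk1 c hc).1, Finset.sum_const, nsmul_eq_mul]
  exact mul_ne_zero hTne (vol_cubeSd_ne_zero k)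

end Localization
end ListChain

namespace ListChain

open Filter Topology

section Simplex

lemma map_avg {E F : Type*} [NormedAddCommGroup E] [NormedSpace ℝ E] [NormedAddCommGroup F]
    [NormedSpace ℝ F] (f : E →ₗ[ℝ] F) (l : List E) : f (avg l) = avg (l.map f) := by
  simp [avg, map_list_sum]

variable {ι ι' : Type*} [Fintype ι] [Nonempty ι] [Fintype ι'] [Nonempty ι']

/-- Barycenters in the standard simplex. -/
noncomputable def simplexAvg (l : List (stdSimplex ℝ ι)) : stdSimplex ℝ ι :=
  if h : l = [] then Classical.arbitrary _ else
    ⟨avg (l.map Subtype.val), avg_mem (convex_stdSimplex ℝ ι) (fun h' => h (List.map_eq_nil_iff.1 h'))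
      fun x hx => by obtain ⟨y, -, rfl⟩ := List.mem_map.1 hx; exact y.2⟩

lemma coe_simplexAvg {l : List (stdSimplex ℝ ι)} (h : l ≠ []) :
    (simplexAvg l).val = avg (l.map Subtype.val) := by
  rw [simplexAvg, dif_neg h]

lemma map_simplexAvg (f : ι → ι') {l : List (stdSimplex ℝ ι)} (h : l ≠ []) :
    stdSimplex.map f (simplexAvg l) = simplexAvg (l.map (stdSimplex.map f)) := by
  apply Subtype.ext
  rw [coe_simplexAvg (by simpa using h)]
  change FunOnFinite.linearMap ℝ ℝ f (simplexAvg l).val = _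
  rw [coe_simplexAvg h, map_avg, List.map_map, List.map_map]
  rfl

/-- The iterated barycentric subdivisions of the standard simplex. -/
noncomputable def simplexSd (m k : ℕ) : ListChain (stdSimplex ℝ (Fin (m + 1))) :=
  (sd simplexAvg (m + 1) ^ k) (Finsupp.single (List.ofFn fun i => stdSimplex.vertex i) 1)

lemma bdList_ofFn {D : Type*} {m : ℕ} (v : Fin (m + 1) → D) : bdList (List.ofFn v) =
    ∑ i : Fin (m + 1), (-1 : ℝ) ^ (i : ℕ) • Finsupp.single (List.ofFn fun j => v (i.succAbove j)) 1 := by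
  induction m with
  | zero => simp [bdList]
  | succ m ih =>
    rw [List.ofFn_succ, bdList, ih, Fin.sum_univ_succ (n := m + 1), sub_eq_add_neg, map_sum,
      ← Finset.sum_neg_distrib]
    congr 1
    · simp
    · refine Finset.sum_congr rfl fun i _ => ?_
      rw [map_smul, cone_single]
      simp [List.ofFn_succ, pow_succ]

lemma bd_simplexSd (m k : ℕ) : bd (simplexSd (m + 1) k) =
    ∑ i : Fin (m + 2), (-1 : ℝ) ^ (i : ℕ) • push (stdSimplex.map (Fin.succAbove i)) (simplexSd m k) := by
  rw [simplexSd, bd_sd_iterate, bd_single, bdList_ofFn, map_sum]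
  refine Finset.sum_congr rfl fun i _ => ?_
  rw [map_smul, simplexSd, push_sd_iterate fun l hl => map_simplexAvg _ hl, push_single, List.map_ofFn]
  simp [Function.comp_def]

/-- The affine simplex spanned by a sequence. -/
noncomputable def affineSimplex {E : Type*} [NormedAddCommGroup E] [NormedSpace ℝ E] (w : ι → E) :
    C(stdSimplex ℝ ι, E) :=
  ⟨fun x => ∑ i, x.val i • w i, continuous_finsetSum _ fun i _ =>
    ((continuous_apply i).comp continuous_subtype_val).smul continuous_const⟩

lemma push_affineSimplex {E : Type*} [NormedAddCommGroup E] [NormedSpace ℝ E] {m : ℕ}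
    (w : Fin (m + 1) → E) (k : ℕ) :
    push (affineSimplex w) (simplexSd m k) =
      (sd avg (m + 1) ^ k) (Finsupp.single (List.ofFn w) 1) := by
  rw [simplexSd, push_sd_iterate (b' := avg), push_single, List.map_ofFn]
  · congr 3
    funext i
    simp [affineSimplex, Pi.single_apply]
  · intro l hl
    change Fintype.linearCombination ℝ w (simplexAvg l).val = _
    rw [coe_simplexAvg hl, map_avg, List.map_map]
    rfl

lemma simplexSd_eventually_mesh (m : ℕ) {δ : ℝ} (hδ : 0 < δ) : ∀ᶠ k in atTop, simplexSd m k ∈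
    supp {l | l.length = m + 1 ∧ ∀ x ∈ l, ∀ y ∈ l, dist x y < δ} := by
  classical
  filter_upwards [eventually_mesh (c := Finsupp.single
    (List.ofFn fun i : Fin (m + 1) => (stdSimplex.vertex i : stdSimplex ℝ (Fin (m + 1))).val) 1)
    (n := m + 1) (single_mem (by simp) 1) hδ] with k hk
  let p : (Fin (m + 1) → ℝ) → stdSimplex ℝ (Fin (m + 1)) := fun x =>
    if h : x ∈ stdSimplex ℝ (Fin (m + 1)) then ⟨x, h⟩ else Classical.arbitrary _
  have hp : ∀ x : stdSimplex ℝ (Fin (m + 1)), p x.val = x := fun x => dif_pos x.2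
  have h1 : push p (push Subtype.val (simplexSd m k)) = simplexSd m k := by
    rw [push_push]
    have : push (p ∘ Subtype.val) = LinearMap.id := hom_ext fun l => by
      simp [Function.comp_def, hp]
    rw [this, LinearMap.id_apply]
  have h2 : push Subtype.val (simplexSd m k) = (sd avg (m + 1) ^ k) (Finsupp.single
    (List.ofFn fun i : Fin (m + 1) => (stdSimplex.vertex i : stdSimplex ℝ (Fin (m + 1))).val) 1) := by
    rw [simplexSd, push_sd_iterate fun l hl => coe_simplexAvg hl, push_single, List.map_ofFn]
    rfl
  have h3 := sd_iterate_mem (b := avg) (S := stdSimplex ℝ (Fin (m + 1)))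
    (fun l hl h => avg_mem (convex_stdSimplex ℝ _) hl h) (m + 1) k
    (c := Finsupp.single
      (List.ofFn fun i : Fin (m + 1) => (stdSimplex.vertex i : stdSimplex ℝ (Fin (m + 1))).val) 1)
    (single_mem (show _ ∧ _ from ⟨by simp, fun x hx => by
      obtain ⟨i, rfl⟩ := (List.mem_ofFn' _ _).1 hx
      exact Subtype.property _⟩) 1)
  rw [← h1, h2]
  refine map_mem (fun l hl => ?_) (mem_supp_and hk h3)
  rw [push_single]
  refine single_mem (show _ ∧ _ from ⟨by simpa using hl.1.1, fun x hx y hy => ?_⟩) 1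
  obtain ⟨x, hx', rfl⟩ := List.mem_map.1 hx
  obtain ⟨y, hy', rfl⟩ := List.mem_map.1 hy
  simp only [p, dif_pos (hl.2.2 x hx'), dif_pos (hl.2.2 y hy')]
  rw [Subtype.dist_eq, dist_eq_norm]
  exact hl.1.2 x hx' y hy'

end Simplex

section Cocycle

variable {X J : Type*} [Fintype J] [DecidableEq J]

lemma locVol_bdList_of_pos {g : X → J → ℝ} {κ : X → ℝ} {r : ℝ} {l : List X}
    (h : ∀ x ∈ l, 0 < κ x) : locVol g κ r (bdList l) = 0 := by
  have : locVol g κ r (bdList l) = (vol ∘ₗ push fun x => clamp (r • g x)) (bdList l) := by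
    refine map_eq (fun l' hl' => ?_) (bdList_mem l)
    rw [locVol_single_of_pos fun x hx => h x (hl'.2 x hx), LinearMap.comp_apply, push_single]
  rw [this, LinearMap.comp_apply, ← bdList_map, ← bd_single, vol_bd]

lemma locVol_bdList_of_neg {g : X → J → ℝ} {κ : X → ℝ} {r : ℝ} {l : List X} (hl : 2 ≤ l.length)
    (h : ∀ x ∈ l, κ x < 0) : locVol g κ r (bdList l) = 0 := by
  refine map_eq_zero (fun l' hl' => locVol_single_of_not fun h' => ?_) (bdList_mem l)
  have := hl'.1
  obtain ⟨x, hx⟩ := List.exists_mem_of_ne_nil l' (by rintro rfl; simp at this; omega)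
  exact (h x (hl'.2 x hx)).not_gt (h' x hx)

lemma locVol_bdList_of_facet {g : X → J → ℝ} {κ : X → ℝ} {r : ℝ} {l : List X} {i : J} {s : ℝ}
    (h : ∀ x ∈ l, clamp (r • g x) i = s) : locVol g κ r (bdList l) = 0 := by
  refine map_eq_zero (fun l' hl' => ?_) (bdList_mem l)
  by_cases h' : ∀ x ∈ l', 0 < κ x
  · rw [locVol_single_of_pos h']
    refine vol_eq_zero_of_facet (i := i) (s := s) fun y hy => ?_
    obtain ⟨x, hx, rfl⟩ := List.mem_map.1 hy
    exact h x (hl'.2 x hx)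
  · exact locVol_single_of_not h'

/-- The localized volume is asymptotically a cocycle on singular simplices. -/
lemma eventually_locVol_bd_simplexSd [TopologicalSpace X] {g : X → J → ℝ} {κ : X → ℝ} {r : ℝ}
    (hg : Continuous g) (hκ : Continuous κ) (hsep : ∀ x, κ x = 0 → 2 ≤ ‖r • g x‖) {m : ℕ}
    (hm : 1 ≤ m) (σ : C(stdSimplex ℝ (Fin (m + 1)), X)) :
    ∀ᶠ k in atTop, locVol g κ r (push σ (bd (simplexSd m k))) = 0 := by
  let U : Option (Option (J × Bool)) → Set X := fun o => o.elim {x | 0 < κ x} fun o =>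
    o.elim {x | κ x < 0} fun p => if p.2 then {x | 1 < (r • g x) p.1} else {x | (r • g x) p.1 < -1}
  have hU : ∀ o, IsOpen (U o) := by
    rintro (_ | _ | ⟨i, b⟩)
    · exact isOpen_lt continuous_const hκ
    · exact isOpen_lt hκ continuous_const
    · have : Continuous fun x => (r • g x) i := (continuous_apply i).comp (hg.const_smul r)
      cases b
      · exact isOpen_lt this continuous_const
      · exact isOpen_lt continuous_const this
  have hcov : ∀ x, ∃ o, x ∈ U o := by
    intro x
    rcases lt_trichotomy (κ x) 0 with h | h | h
    · exact ⟨some none, h⟩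
    · have h2 := hsep x h
      obtain ⟨i, hi⟩ : ∃ i, 1 < |(r • g x) i| := by
        by_contra! hcon
        have := (pi_norm_le_iff_of_nonneg zero_le_one).2 fun i => (Real.norm_eq_abs _).trans_le (hcon i)
        linarith
      rcases lt_abs.1 hi with h3 | h3
      · exact ⟨some (some (i, true)), h3⟩
      · exact ⟨some (some (i, false)), by change (r • g x) i < -1; linarith⟩
    · exact ⟨none, h⟩
  have hloc : ∀ o, ∀ l : List X, 2 ≤ l.length → (∀ x ∈ l, x ∈ U o) → locVol g κ r (bdList l) = 0 := by
    rintro (_ | _ | ⟨i, b⟩) l hl h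
    · exact locVol_bdList_of_pos h
    · exact locVol_bdList_of_neg hl h
    · cases b
      · refine locVol_bdList_of_facet (i := i) (s := -1) fun x hx => ?_
        have : (r • g x) i < -1 := h x hx
        rw [clamp, min_eq_right (by linarith), max_eq_left this.le]
      · refine locVol_bdList_of_facet (i := i) (s := 1) fun x hx => ?_
        have : 1 < (r • g x) i := h x hx
        rw [clamp, min_eq_left this.le]
        norm_num
  obtain ⟨δ, hδ, hball⟩ := lebesgue_number_lemma_of_metric (c := fun o => σ ⁻¹' U o)
    (isCompact_univ (X := stdSimplex ℝ (Fin (m + 1)))) (fun o => (hU o).preimage σ.continuous)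
    fun x _ => Set.mem_iUnion.2 (hcov (σ x))
  filter_upwards [simplexSd_eventually_mesh m hδ] with k hk
  change (locVol g κ r ∘ₗ push σ ∘ₗ bd) (simplexSd m k) = 0
  refine map_eq_zero (fun l hl => ?_) hk
  rw [LinearMap.comp_apply, LinearMap.comp_apply, bd_single, ← bdList_map]
  have hne : l ≠ [] := by rintro rfl; simpa using hl.1
  obtain ⟨x, hx⟩ := List.exists_mem_of_ne_nil l hne
  obtain ⟨o, ho⟩ := hball x trivial
  refine hloc o _ (by rw [List.length_map, hl.1]; omega) fun y hy => ?_
  obtain ⟨z, hz, rfl⟩ := List.mem_map.1 hy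
  exact ho (hl.2 z hz x hx)

end Cocycle
end ListChain

namespace SingularChain

open CategoryTheory Opposite Simplicial

/-- The chain of a singular simplex. -/
noncomputable def ofSimplex {X : TopCat.{0}} {m : ℕ} (σ : C(stdSimplex ℝ (Fin (m + 1)), X)) :
    (singularChainComplexFunctor.obj X).X m :=
  ModuleCat.freeMk (R := ℝ) ((X.toSSetObjEquiv (op ⦋m⦌)).symm σ)

lemma hom_ext {X : TopCat.{0}} {m : ℕ} {M : ModuleCat.{0} ℝ}
    {f g : (singularChainComplexFunctor.obj X).X m ⟶ M}
    (h : ∀ σ : C(stdSimplex ℝ (Fin (m + 1)), X), f (ofSimplex σ) = g (ofSimplex σ)) : f = g := by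
  refine ModuleCat.free_hom_ext fun x => ?_
  have := h (X.toSSetObjEquiv (op ⦋m⦌) x)
  rw [ofSimplex, Equiv.symm_apply_apply] at this
  exact this

/-- The linear extension of a function on singular simplices. -/
noncomputable def desc {X : TopCat.{0}} {m : ℕ} {M : ModuleCat.{0} ℝ}
    (f : C(stdSimplex ℝ (Fin (m + 1)), X) → M) : (singularChainComplexFunctor.obj X).X m ⟶ M :=
  ModuleCat.freeDesc (↾fun x => f (X.toSSetObjEquiv (op ⦋m⦌) x))

lemma desc_ofSimplex {X : TopCat.{0}} {m : ℕ} {M : ModuleCat.{0} ℝ}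
    (f : C(stdSimplex ℝ (Fin (m + 1)), X) → M) (σ : C(stdSimplex ℝ (Fin (m + 1)), X)) :
    desc f (ofSimplex σ) = f σ := by
  refine (ModuleCat.freeDesc_apply _ _).trans ?_
  simp

/-- The inclusion of a face of the standard simplex. -/
noncomputable def face {m : ℕ} (i : Fin (m + 2)) :
    C(stdSimplex ℝ (Fin (m + 1)), stdSimplex ℝ (Fin (m + 2))) :=
  ⟨stdSimplex.map i.succAbove, stdSimplex.continuous_map _⟩

lemma d_ofSimplex {X : TopCat.{0}} {m : ℕ} (σ : C(stdSimplex ℝ (Fin (m + 2)), X)) :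
    (singularChainComplexFunctor.obj X).d (m + 1) m (ofSimplex σ) =
      ∑ i : Fin (m + 2), (-1 : ℝ) ^ (i : ℕ) • ofSimplex (σ.comp (face i)) := by
  have : (singularChainComplexFunctor.obj X).d (m + 1) m = ∑ i : Fin (m + 2), (-1 : ℤ) ^ (i : ℕ) •
      (ModuleCat.free ℝ).map ((TopCat.toSSet.obj X).δ i) :=
    AlgebraicTopology.AlternatingFaceMapComplex.obj_d_eq _ m
  rw [this]
  have happ : ∀ (a : (ModuleCat.free ℝ).obj (TopCat.toSSet.obj X _⦋m + 1⦌)),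
      (∑ i : Fin (m + 2), (-1 : ℤ) ^ (i : ℕ) •
        (ModuleCat.free ℝ).map ((TopCat.toSSet.obj X).δ i)).hom a =
      ∑ i : Fin (m + 2), (-1 : ℝ) ^ (i : ℕ) •
        ((ModuleCat.free ℝ).map ((TopCat.toSSet.obj X).δ i)).hom a := by
    intro a
    rw [ModuleCat.hom_sum, LinearMap.sum_apply]
    refine Finset.sum_congr rfl fun i _ => ?_
    rw [ModuleCat.hom_zsmul, LinearMap.smul_apply, ← Int.cast_smul_eq_zsmul ℝ]
    simp
  refine (happ _).trans (Finset.sum_congr rfl fun i _ => ?_)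
  congr 1
  refine (ModuleCat.free_map_apply _ _).trans ?_
  rfl

lemma map_ofSimplex {X Y : TopCat.{0}} (f : X ⟶ Y) {m : ℕ} (σ : C(stdSimplex ℝ (Fin (m + 1)), X)) :
    (singularChainComplexFunctor.map f).f m (ofSimplex σ) = ofSimplex (f.hom.comp σ) := by
  refine (ModuleCat.free_map_apply _ _).trans ?_
  rfl

lemma homologyMap_ne_zero {K L : ChainComplex (ModuleCat.{0} ℝ) ℕ} (φ : K ⟶ L) {m : ℕ}
    {M : ModuleCat.{0} ℝ} (z : K.X (m + 1)) (hz : K.d (m + 1) m z = 0) (f : L.X (m + 1) ⟶ M)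
    (hf : L.d (m + 2) (m + 1) ≫ f = 0) (h : f (φ.f (m + 1) z) ≠ 0) :
    HomologicalComplex.homologyMap φ (m + 1) ≠ 0 := by
  intro h0
  let p : ModuleCat.of ℝ ℝ ⟶ K.X (m + 1) := ModuleCat.ofHom (LinearMap.toSpanSingleton ℝ _ z)
  have hp : p ≫ K.d (m + 1) m = 0 := by
    ext
    simp [p, hz]
  have key : p ≫ φ.f (m + 1) ≫ f = 0 := by
    have : K.liftCycles p m (by simp) hp ≫ K.homologyπ (m + 1) ≫
      HomologicalComplex.homologyMap φ (m + 1) ≫ L.homologyι (m + 1) ≫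
        L.descOpcycles f (m + 2) (by simp) hf = p ≫ φ.f (m + 1) ≫ f := by
      simp [HomologicalComplex.p_descOpcycles]
    rw [← this, h0]
    simp
  apply h
  have := congrArg (fun q => q.hom (1 : ℝ)) key
  simpa [p] using this

end SingularChain

namespace ListChain

open CategoryTheory Filter Topology

section Detection

lemma affineSimplex_comp_face {E : Type*} [NormedAddCommGroup E] [NormedSpace ℝ E] {m : ℕ}
    (w : Fin (m + 2) → E) (i : Fin (m + 2)) :
    (affineSimplex w).comp (SingularChain.face i) = affineSimplex (fun j => w (i.succAbove j)) := by
  ext x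
  change Fintype.linearCombination ℝ w (FunOnFinite.linearMap ℝ ℝ i.succAbove x) =
    Fintype.linearCombination ℝ (fun j => w (i.succAbove j)) x.val
  have : Fintype.linearCombination ℝ w ∘ₗ FunOnFinite.linearMap ℝ ℝ i.succAbove =
      Fintype.linearCombination ℝ (fun j => w (i.succAbove j)) := by
    refine LinearMap.pi_ext' fun j => LinearMap.ext fun t => ?_
    simp [FunOnFinite.linearMap_piSingle, Fintype.linearCombination_apply_single]
  exact LinearMap.congr_fun this x.val

variable {J : Type} {Y : TopCat.{0}}

/-- The singular chain associated to a list chain via a continuous map. -/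
noncomputable def toSingular [Fintype J] (G : C(J → ℝ, Y)) (m : ℕ) :
    ListChain (J → ℝ) →ₗ[ℝ] (singularChainComplexFunctor.obj Y).X m :=
  Finsupp.linearCombination ℝ fun l =>
    if h : l.length = m + 1 then
      SingularChain.ofSimplex (G.comp (affineSimplex fun i : Fin (m + 1) => l.get (i.cast h.symm)))
    else 0

variable [Fintype J]

lemma toSingular_ofFn (G : C(J → ℝ, Y)) {m : ℕ} (w : Fin (m + 1) → J → ℝ) :
    toSingular G m (Finsupp.single (List.ofFn w) 1) =
      SingularChain.ofSimplex (G.comp (affineSimplex w)) := by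
  rw [toSingular, Finsupp.linearCombination_single, one_smul, dif_pos (List.length_ofFn)]
  congr 3
  funext i
  simp only [List.get_eq_getElem, List.getElem_ofFn, Fin.val_cast, Fin.eta]

lemma exists_eq_ofFn {D : Type*} {l : List D} {m : ℕ} (h : l.length = m) :
    ∃ w : Fin m → D, l = List.ofFn w := by
  subst h
  exact ⟨l.get, (List.ofFn_get l).symm⟩

lemma d_toSingular (G : C(J → ℝ, Y)) {m : ℕ} {c : ListChain (J → ℝ)}
    (hc : c ∈ supp {l | l.length = m + 2}) :
    (singularChainComplexFunctor.obj Y).d (m + 1) m (toSingular G (m + 1) c) =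
      toSingular G m (bd c) := by
  refine map_eq (f := ((singularChainComplexFunctor.obj Y).d (m + 1) m).hom ∘ₗ toSingular G (m + 1))
    (g := toSingular G m ∘ₗ bd) (fun l hl => ?_) hc
  obtain ⟨w, rfl⟩ := exists_eq_ofFn hl
  rw [LinearMap.comp_apply, LinearMap.comp_apply, toSingular_ofFn, bd_single, bdList_ofFn, map_sum]
  refine (SingularChain.d_ofSimplex _).trans (Finset.sum_congr rfl fun i _ => ?_)
  rw [map_smul, toSingular_ofFn, ContinuousMap.comp_assoc, affineSimplex_comp_face]

variable [DecidableEq J]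

lemma d_toSingular_cube {m : ℕ} (hJ : Fintype.card J = m + 1) (G : C(J → ℝ, Y))
    (hG : ∀ i x, x i = -1 → G (shift i x) = G x) :
    (singularChainComplexFunctor.obj Y).d (m + 1) m
      (toSingular G (m + 1) (cube (Finset.univ : Finset J).toList)) = 0 := by
  have hlen : (Finset.univ : Finset J).toList.length = m + 1 := by simpa using hJ
  rw [d_toSingular G (supp_mono (fun l hl => by have := hl.1; simp [hlen] at this; exact this)
    (cube_mem (Finset.nodup_toList _)))]
  refine map_bd_cube_eq_zero _ (Finset.nodup_toList _) (fun h => by rw [h] at hlen; simp at hlen) _ ?_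
  intro i _ l hl hx
  obtain ⟨w, rfl⟩ := exists_eq_ofFn (hl.trans hlen)
  rw [List.map_ofFn, toSingular_ofFn, toSingular_ofFn]
  congr 1
  ext x
  have hw : ∀ j, w j i = -1 := fun j => (hx (w j) ((List.mem_ofFn' w _).2 ⟨j, rfl⟩)).2
  have h1 : ∑ j, x.val j = 1 := x.2.2
  have h2 : affineSimplex (shift i ∘ w) x = shift i (affineSimplex w x) := by
    simp [affineSimplex, shift, Finset.sum_add_distrib, ← Finset.sum_smul, h1]
  change G (affineSimplex (shift i ∘ w) x) = G (affineSimplex w x)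
  rw [h2, hG]
  simp [affineSimplex, hw, h1]

/-- Sequences which vanish eventually. -/
def eventuallyZero : Submodule ℝ (ℕ → ℝ) where
  carrier := {u | ∀ᶠ k in atTop, u k = 0}
  add_mem' h h' := by
    filter_upwards [h, h'] with k h h'
    simp [h, h']
  zero_mem' := by simp
  smul_mem' a u h := by
    filter_upwards [h] with k h
    simp [h]

/-- The cocycle on singular chains given by the localized volume. -/
noncomputable def cocycle {X : TopCat.{0}} (g : X → J → ℝ) (κ : X → ℝ) (r : ℝ) (m : ℕ) :
    (singularChainComplexFunctor.obj X).X m ⟶ ModuleCat.of ℝ ((ℕ → ℝ) ⧸ eventuallyZero) :=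
  SingularChain.desc fun σ => eventuallyZero.mkQ fun k => locVol g κ r (push σ (simplexSd m k))

lemma d_cocycle {X : TopCat.{0}} {g : X → J → ℝ} {κ : X → ℝ} {r : ℝ} (hg : Continuous g)
    (hκ : Continuous κ) (hsep : ∀ x, κ x = 0 → 2 ≤ ‖r • g x‖) (m : ℕ) :
    (singularChainComplexFunctor.obj X).d (m + 1) m ≫ cocycle g κ r m = 0 := by
  refine SingularChain.hom_ext fun σ => ?_
  change cocycle g κ r m ((singularChainComplexFunctor.obj X).d (m + 1) m (SingularChain.ofSimplex σ))
    = 0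
  rw [SingularChain.d_ofSimplex, map_sum]
  have hi : ∀ i : Fin (m + 2), cocycle g κ r m
      ((-1 : ℝ) ^ (i : ℕ) • SingularChain.ofSimplex (σ.comp (SingularChain.face i))) =
      eventuallyZero.mkQ ((-1 : ℝ) ^ (i : ℕ) • fun k =>
        locVol g κ r (push (σ.comp (SingularChain.face i)) (simplexSd m k))) := by
    intro i
    rw [map_smul, map_smul]
    exact congrArg _ (SingularChain.desc_ofSimplex _ _)
  rw [Finset.sum_congr rfl fun i _ => hi i, ← map_sum]
  refine (Submodule.Quotient.mk_eq_zero _).2 ?_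
  change ∀ᶠ k in atTop, _
  filter_upwards [eventually_locVol_bd_simplexSd hg hκ hsep (m := m + 1) (by omega) σ] with k hk
  rw [← hk, bd_simplexSd, map_sum, map_sum, Finset.sum_apply]
  refine Finset.sum_congr rfl fun i _ => ?_
  rw [map_smul, map_smul, push_push]
  rfl

lemma cocycle_toSingular {X : TopCat.{0}} (g : X → J → ℝ) (κ : X → ℝ) (r : ℝ) (m : ℕ)
    (θ : Y ⟶ X) (G : C(J → ℝ, Y)) {c : ListChain (J → ℝ)} (hc : c ∈ supp {l | l.length = m + 1}) :
    cocycle g κ r m ((singularChainComplexFunctor.map θ).f m (toSingular G m c)) =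
      eventuallyZero.mkQ fun k => locVol (fun x => g (θ (G x))) (fun x => κ (θ (G x))) r
        ((sd avg (m + 1) ^ k) c) := by
  refine map_eq (f := (cocycle g κ r m).hom ∘ₗ ((singularChainComplexFunctor.map θ).f m).hom ∘ₗ
    toSingular G m) (g := eventuallyZero.mkQ ∘ₗ LinearMap.pi fun k =>
      locVol (fun x => g (θ (G x))) (fun x => κ (θ (G x))) r ∘ₗ (sd avg (m + 1) ^ k))
    (fun l hl => ?_) hc
  obtain ⟨w, rfl⟩ := exists_eq_ofFn hl
  rw [LinearMap.comp_apply, LinearMap.comp_apply, LinearMap.comp_apply, toSingular_ofFn]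
  refine (congrArg (cocycle g κ r m) (SingularChain.map_ofSimplex θ _)).trans ?_
  refine (SingularChain.desc_ofSimplex _ _).trans ?_
  congr 1
  funext k
  rw [LinearMap.pi_apply, LinearMap.comp_apply, ← push_affineSimplex, locVol_push (J := J)]
  exact (locVol_push (J := J) (affineSimplex w) (fun x => g (θ (G x))) (fun x => κ (θ (G x))) r _).symm

/-- A map is nonzero in homology if a periodic family of points of its source, parametrized by a
cube, hits a nondegenerate value positively. -/
theorem singularHomologyFunctor_map_ne_zero {X : TopCat.{0}} [CompactSpace X] [Nonempty J] {m : ℕ}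
    (hJ : Fintype.card J = m + 1) (θ : Y ⟶ X) (G : C(J → ℝ, Y))
    (hG : ∀ i x, x i = -1 → G (shift i x) = G x) {g : X → J → ℝ} {κ : X → ℝ}
    (hg : Continuous g) (hκ : Continuous κ) (hsep : ∀ x, κ x = 0 → g x ≠ 0)
    (hz : ∀ c ∈ Set.Icc (-1) 1, 0 < κ (θ (G c)) → g (θ (G c)) = 0 → (∀ i, c i ∈ Set.Ioo (-1) 1) ∧
      ∃ L : (J → ℝ) →L[ℝ] (J → ℝ), 0 < LinearMap.det (L : (J → ℝ) →ₗ[ℝ] (J → ℝ)) ∧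
        HasFDerivAt (fun x => g (θ (G x))) L c)
    (hex : ∃ c ∈ Set.Icc (-1) 1, 0 < κ (θ (G c)) ∧ g (θ (G c)) = 0) :
    (singularHomologyFunctor (m + 1)).map θ ≠ 0 := by
  have hθG : Continuous fun x => θ (G x) := θ.hom.continuous.comp G.continuous
  have h1 := eventually_locVol_cubeSd (H := fun x => g (θ (G x))) (κ := fun x => κ (θ (G x)))
    (hg.comp hθG) (hκ.comp hθG) (fun x _ h => hsep _ h) hz hex
  have h2 : ∀ᶠ r : ℝ in atTop, ∀ x, κ x = 0 → 2 ≤ ‖r • g x‖ := by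
    have hcomp : IsCompact {x | κ x = 0} := (isClosed_eq hκ continuous_const).isCompact
    rcases Set.eq_empty_or_nonempty {x | κ x = 0} with he | hne
    · refine Eventually.of_forall fun r x hx => ?_
      have : x ∈ {x | κ x = 0} := hx
      rw [he] at this
      exact absurd this (Set.notMem_empty _)
    · obtain ⟨p, hp, hmin⟩ := hcomp.exists_isMinOn hne hg.norm.continuousOn
      have hpos : 0 < ‖g p‖ := norm_pos_iff.2 (hsep p hp)
      filter_upwards [(tendsto_id.atTop_mul_const hpos).eventually_ge_atTop 2,
        eventually_ge_atTop 0] with r hr hr0 x hx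
      rw [norm_smul, Real.norm_of_nonneg hr0]
      exact hr.trans (mul_le_mul_of_nonneg_left (hmin hx) hr0)
  obtain ⟨r, hr1, hr2⟩ := (h1.and h2).exists
  have hmem : cube (Finset.univ : Finset J).toList ∈ supp {l | l.length = m + 1 + 1} :=
    supp_mono (fun l hl => by have := hl.1; simp [hJ] at this; exact this)
      (cube_mem (Finset.nodup_toList _))
  refine SingularChain.homologyMap_ne_zero (singularChainComplexFunctor.map θ) _
    (d_toSingular_cube hJ G hG) (cocycle g κ r (m + 1)) (d_cocycle hg hκ hr2 (m + 1)) ?_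
  rw [cocycle_toSingular _ _ _ _ _ _ hmem]
  intro h0
  have h3 : ∀ᶠ k in atTop, locVol (fun x => g (θ (G x))) (fun x => κ (θ (G x))) r
      ((sd avg (m + 1 + 1) ^ k) (cube (Finset.univ : Finset J).toList)) = 0 :=
    (Submodule.Quotient.mk_eq_zero _).1 h0
  rw [← hJ] at h3
  obtain ⟨k, hk, hk'⟩ := (h3.and hr1).exists
  exact hk' hk

end Detection
end ListChain

section Calculus

/-- The product rule at a zero of the second factor only requires continuity of the first factor. -/
theorem HasFDerivAt.clm_apply_of_eq_zero {E F G : Type*} [NormedAddCommGroup E] [NormedSpace ℝ E]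
    [NormedAddCommGroup F] [NormedSpace ℝ F] [NormedAddCommGroup G] [NormedSpace ℝ G]
    {M : E → F →L[ℝ] G} {f : E → F} {f' : E →L[ℝ] F} {x : E} (hf : HasFDerivAt f f' x)
    (hM : ContinuousAt M x) (h0 : f x = 0) :
    HasFDerivAt (fun y => M y (f y)) ((M x).comp f') x := by
  have h1 : HasFDerivAt (fun y => M x (f y)) ((M x).comp f') x := (M x).hasFDerivAt.comp x hf
  have h2 : HasFDerivAt (fun y => (M y - M x) (f y)) (0 : E →L[ℝ] G) x := by
    rw [hasFDerivAt_iff_isLittleO_nhds_zero]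
    simp only [h0, map_zero, sub_zero, zero_apply]
    have hO : (fun h => f (x + h)) =O[nhds 0] fun h : E => h := by
      have := hf.isBigO_sub
      have ht : Filter.Tendsto (fun h : E => x + h) (nhds 0) (nhds x) := by
        have : Continuous fun h : E => x + h := by fun_prop
        simpa using this.tendsto 0
      simpa [h0, Function.comp_def] using this.comp_tendsto ht
    have ho : (fun h => ‖M (x + h) - M x‖) =o[nhds 0] fun _ : E => (1 : ℝ) := by
      rw [Asymptotics.isLittleO_one_iff]
      have ht : Filter.Tendsto (fun h : E => x + h) (nhds 0) (nhds x) := by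
        have : Continuous fun h : E => x + h := by fun_prop
        simpa using this.tendsto 0
      have := ((hM.tendsto.comp ht).sub_const (M x)).norm
      simpa using this
    have := ho.mul_isBigO hO.norm_norm
    refine (Asymptotics.IsBigO.trans_isLittleO ?_ (this.congr_right fun h => one_mul _)).of_norm_right
    refine Asymptotics.IsBigO.of_bound 1 (Filter.Eventually.of_forall fun h => ?_)
    simpa using (M (x + h) - M x).le_opNorm (f (x + h))
  refine (h1.add h2).congr_fderiv (by simp) |>.congr_of_eventuallyEq ?_
  exact Filter.Eventually.of_forall fun y => by simp

end Calculus

namespace MonicCoeff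

open Polynomial

theorem continuous_coeff_prod {X ι : Type*} [TopologicalSpace X] (s : Finset ι) (f : ι → X → ℂ[X])
    (hf : ∀ i e, Continuous fun x => (f i x).coeff e) (e : ℕ) :
    Continuous fun x => (∏ i ∈ s, f i x).coeff e := by
  classical
  induction s using Finset.induction_on generalizing e with
  | empty => simpa using continuous_const
  | insert i s hi ih =>
    simp only [Finset.prod_insert hi, coeff_mul]
    exact continuous_finsetSum _ fun p _ => (hf i p.1).mul (ih p.2)

theorem differentiable_coeff_prod {X ι : Type*} [NormedAddCommGroup X] [NormedSpace ℂ X]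
    (s : Finset ι) (f : ι → X → ℂ[X])
    (hf : ∀ i e, Differentiable ℂ fun x => (f i x).coeff e) (e : ℕ) :
    Differentiable ℂ fun x => (∏ i ∈ s, f i x).coeff e := by
  classical
  induction s using Finset.induction_on generalizing e with
  | empty => simp
  | insert i s hi ih =>
    simp only [Finset.prod_insert hi, coeff_mul]
    exact Differentiable.fun_sum fun p _ => (hf i p.1).mul (ih p.2)

/-- The non-leading coefficients of a monic polynomial as functions of its roots. -/
noncomputable def coeffs {k : ℕ} (z : Fin k → ℂ) (e : Fin k) : ℂ := (∏ l, (X - C (z l))).coeff e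

theorem differentiable_coeffs (k : ℕ) : Differentiable ℂ (coeffs (k := k)) := by
  rw [differentiable_pi]
  intro e
  refine differentiable_coeff_prod _ (fun l (z : Fin k → ℂ) => X - C (z l)) (fun l e => ?_) _
  simp only [coeff_sub, coeff_X, coeff_C]
  split_ifs <;> fun_prop

theorem eval_prod_eq {k : ℕ} (z : Fin k → ℂ) (ξ : ℂ) :
    ∏ l, (ξ - z l) = ∑ e : Fin k, coeffs z e * ξ ^ (e : ℕ) + ξ ^ k := by
  have hm : (∏ l, (X - C (z l))).Monic := monic_prod_of_monic _ _ fun l _ => monic_X_sub_C _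
  have hd : (∏ l, (X - C (z l))).natDegree = k := by
    rw [natDegree_prod_of_monic _ _ fun l _ => monic_X_sub_C _]; simp
  have h := eval_eq_sum_range (p := ∏ l, (X - C (z l))) ξ
  rw [hd, Finset.sum_range_succ, Finset.sum_range] at h
  have hk : (∏ l, (X - C (z l))).coeff k = 1 := by
    simpa [Monic, leadingCoeff, hd] using hm
  rw [hk, one_mul, eval_prod] at h
  simpa [coeffs] using h

/-- The coefficients of a monic polynomial are a local coordinate system near distinct roots. -/
theorem injective_fderiv_coeffs {k : ℕ} {z : Fin k → ℂ} (hz : Function.Injective z) :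
    Function.Injective (fderiv ℂ coeffs z) := by
  classical
  rw [injective_iff_map_eq_zero]
  intro δ hδ
  funext l
  have hd := ((differentiable_coeffs k) z).hasFDerivAt
  have hd' := hasFDerivAt_pi'.1 hd
  have h1 : HasFDerivAt (fun w : Fin k → ℂ => ∑ e : Fin k, coeffs w e * z l ^ (e : ℕ) + z l ^ k)
      (∑ e : Fin k, z l ^ (e : ℕ) • ((ContinuousLinearMap.proj e).comp (fderiv ℂ coeffs z))) z :=
    (HasFDerivAt.fun_sum fun e _ => (hd' e).mul_const _).add_const _
  have h2 : HasFDerivAt (fun w : Fin k → ℂ => (z l - w l) * ∏ m ∈ Finset.univ.erase l, (z l - w m))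
      (-(∏ m ∈ Finset.univ.erase l, (z l - z m)) • (ContinuousLinearMap.proj l : (Fin k → ℂ) →L[ℂ] ℂ))
      z := by
    have ha : HasFDerivAt (fun w : Fin k → ℂ => z l - w l) (-ContinuousLinearMap.proj l) z :=
      ((ContinuousLinearMap.proj l : (Fin k → ℂ) →L[ℂ] ℂ).hasFDerivAt (x := z)).const_sub (z l)
    have hb : DifferentiableAt ℂ (fun w : Fin k → ℂ => ∏ m ∈ Finset.univ.erase l, (z l - w m)) z :=
      by fun_prop
    refine (ha.mul hb.hasFDerivAt).congr_fderiv ?_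
    ext v
    simp
  have h3 : (fun w : Fin k → ℂ => (z l - w l) * ∏ m ∈ Finset.univ.erase l, (z l - w m)) =
      fun w : Fin k → ℂ => ∑ e : Fin k, coeffs w e * z l ^ (e : ℕ) + z l ^ k := by
    funext w
    rw [← eval_prod_eq, Finset.mul_prod_erase _ (fun m => z l - w m) (Finset.mem_univ l)]
  rw [h3] at h2
  have hδ' : ∀ e, (fderiv ℂ coeffs z) δ e = 0 := fun e => congrFun hδ e
  have h4 : (0 : ℂ) = -(∏ m ∈ Finset.univ.erase l, (z l - z m)) * δ l := by
    simpa [hδ'] using congrArg (fun L => L δ) (h1.unique h2)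
  have h5 : -(∏ m ∈ Finset.univ.erase l, (z l - z m)) ≠ 0 :=
    neg_ne_zero.2 (Finset.prod_ne_zero_iff.2 fun m hm =>
      sub_ne_zero.2 fun h => (Finset.ne_of_mem_erase hm) (hz h).symm)
  simpa [h5] using (mul_eq_zero.1 h4.symm)

theorem det_fderiv_coeffs_pos {k : ℕ} {z : Fin k → ℂ} (hz : Function.Injective z) :
    0 < LinearMap.det ((fderiv ℂ coeffs z : (Fin k → ℂ) →ₗ[ℂ] (Fin k → ℂ)).restrictScalars ℝ) := by
  rw [LinearMap.det_restrictScalars, Algebra.norm_complex_apply, Complex.normSq_pos]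
  exact (LinearMap.isUnit_iff_isUnit_det _).1
    ((Module.End.isUnit_iff _).2 ⟨injective_fderiv_coeffs hz,
      LinearMap.surjective_of_injective (injective_fderiv_coeffs hz)⟩) |>.ne_zero

theorem exists_prod_eq_X_pow_add_one (k : ℕ) (hk : 0 < k) :
    ∃ z : Fin k → ℂ, ∏ l, (X - C (z l)) = (X ^ k + 1 : ℂ[X]) := by
  have hd : (X ^ k + 1 : ℂ[X]).natDegree = k := by
    simpa using natDegree_X_pow_add_C (n := k) (r := (1 : ℂ))
  have hm : (X ^ k + 1 : ℂ[X]).Monic := by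
    simpa using monic_X_pow_add_C (1 : ℂ) hk.ne'
  have hs := IsAlgClosed.splits (X ^ k + 1 : ℂ[X])
  have hp := hs.eq_prod_roots_of_monic hm
  have hc : (X ^ k + 1 : ℂ[X]).roots.toList.length = k := by
    rw [Multiset.length_toList, ← hs.natDegree_eq_card_roots, hd]
  refine ⟨fun l => (X ^ k + 1 : ℂ[X]).roots.toList.get (l.cast hc.symm), ?_⟩
  conv_rhs => rw [hp, ← Multiset.coe_toList (X ^ k + 1 : ℂ[X]).roots]
  rw [Multiset.map_coe, Multiset.prod_coe, ← List.prod_ofFn]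
  congr 1
  refine List.ext_get (by simp [hc]) fun i h1 h2 => by simp

theorem injective_of_prod_eq {k : ℕ} (hk : 0 < k) {z : Fin k → ℂ} {τ : ℂ} (hτ : τ ≠ 0)
    (h : ∏ l, (X - C (z l)) = (X ^ k + C τ : ℂ[X])) : Function.Injective z := by
  rw [← separable_prod_X_sub_C_iff, h, ← sub_neg_eq_add, ← C_neg]
  exact separable_X_pow_sub_C _ (by exact_mod_cast hk.ne') (neg_ne_zero.2 hτ)

end MonicCoeff

section Determinants

theorem LinearMap.det_pi_comp_proj_pos {ι M : Type*} [Fintype ι] [AddCommGroup M]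
    [Module ℝ M] [FiniteDimensional ℝ M] (f : ι → M →ₗ[ℝ] M) (hf : ∀ i, 0 < LinearMap.det (f i)) :
    0 < LinearMap.det (LinearMap.pi fun i => (f i).comp (LinearMap.proj i)) := by
  classical
  rw [LinearMap.det_pi]
  exact Finset.prod_pos fun i _ => hf i

/-- The quaternion `z + jw` attached to two complex numbers. -/
def Quaternion.ofComplexPair (z w : ℂ) : ℍ[ℝ] := ⟨z.re, z.im, w.re, -w.im⟩

namespace Quaternion

variable (z w : ℂ)

@[simp] theorem re_ofComplexPair : (ofComplexPair z w).re = z.re := rfl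

@[simp] theorem imI_ofComplexPair : (ofComplexPair z w).imI = z.im := rfl

@[simp] theorem imJ_ofComplexPair : (ofComplexPair z w).imJ = w.re := rfl

@[simp] theorem imK_ofComplexPair : (ofComplexPair z w).imK = -w.im := rfl

end Quaternion

/-- The coordinates of a quaternion. -/
noncomputable def Quaternion.coordBasis : Module.Basis (Fin 4) ℝ ℍ[ℝ] := Module.Basis.ofEquivFun
  { toFun := fun q => ![q.re, q.imI, q.imJ, q.imK]
    invFun := fun v => ofComplexPair ⟨v 0, v 1⟩ ⟨v 2, -v 3⟩
    map_add' := fun p q => by ext i; fin_cases i <;> simp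
    map_smul' := fun r q => by ext i; fin_cases i <;> simp
    left_inv := fun q => by ext <;> simp
    right_inv := fun v => by ext i; fin_cases i <;> simp }

theorem Quaternion.det_mulRight (q : ℍ[ℝ]) :
    LinearMap.det (LinearMap.mulRight ℝ q) = normSq q ^ 2 := by
  rw [← LinearMap.det_toMatrix coordBasis, Matrix.det_succ_row_zero]
  simp only [Fin.sum_univ_four, Matrix.det_fin_three, Matrix.submatrix_apply, LinearMap.toMatrix_apply,
    coordBasis, normSq_def', LinearMap.mulRight_apply]
  simp [Fin.succAbove]
  ring

theorem Quaternion.det_mulRight_pos {q : ℍ[ℝ]} (hq : q ≠ 0) :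
    0 < LinearMap.det (LinearMap.mulRight ℝ q) := by
  rw [det_mulRight]
  have := normSq_ne_zero.2 hq
  positivity

/-- The real diagonal map `x + iy ↦ x + iτy` of the complex plane. -/
noncomputable def Complex.stretch (τ : ℝ) : ℂ →L[ℝ] ℂ :=
  LinearMap.toContinuousLinearMap
    { toFun := fun z => ⟨z.re, τ * z.im⟩
      map_add' := fun z w => by apply Complex.ext <;> simp [mul_add]
      map_smul' := fun r z => by apply Complex.ext <;> simp; ring }

@[simp]
theorem Complex.stretch_apply (τ : ℝ) (z : ℂ) : stretch τ z = ⟨z.re, τ * z.im⟩ := rfl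

theorem Complex.det_stretch (τ : ℝ) : LinearMap.det (stretch τ : ℂ →ₗ[ℝ] ℂ) = τ := by
  rw [← LinearMap.det_toMatrix Complex.basisOneI, Matrix.det_fin_two]
  simp [LinearMap.toMatrix_apply]

/-- The map from the open square onto the plane which is radial and blows up at the boundary. -/
noncomputable def squareToPlane (u v : ℝ) : ℂ :=
  ⟨u / ((1 - u ^ 2) * (1 - v ^ 2)), v / ((1 - u ^ 2) * (1 - v ^ 2))⟩

theorem hasFDerivAt_squareToPlane {u v : ℝ} (hu : u ∈ Set.Ioo (-1) 1) (hv : v ∈ Set.Ioo (-1) 1) :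
    ∃ L : ℂ →L[ℝ] ℂ, 0 < LinearMap.det (L : ℂ →ₗ[ℝ] ℂ) ∧
      HasFDerivAt (fun z : ℂ => squareToPlane z.re z.im) L ⟨u, v⟩ := by
  have h1 : 0 < 1 - u ^ 2 := by nlinarith [hu.1, hu.2]
  have h2 : 0 < 1 - v ^ 2 := by nlinarith [hv.1, hv.2]
  have hre : HasFDerivAt (fun z : ℂ => z.re) Complex.reCLM ⟨u, v⟩ := Complex.reCLM.hasFDerivAt
  have him : HasFDerivAt (fun z : ℂ => z.im) Complex.imCLM ⟨u, v⟩ := Complex.imCLM.hasFDerivAt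
  have hb := ((hre.pow 2).const_sub 1).mul ((him.pow 2).const_sub 1)
  have hi := (hasDerivAt_inv (mul_pos h1 h2).ne').comp_hasFDerivAt (⟨u, v⟩ : ℂ) hb
  have h := ((hre.mul hi).smul_const (1 : ℂ)).add ((him.mul hi).smul_const Complex.I)
  refine ⟨_, ?_, h.congr_of_eventuallyEq (Filter.Eventually.of_forall fun z => ?_)⟩
  · rw [← LinearMap.det_toMatrix Complex.basisOneI, Matrix.det_fin_two]
    simp [LinearMap.toMatrix_apply, -Complex.real_smul]
    have key (i j : ℝ) (hi : 0 < i) (hj : 0 < j) :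
        u * (i * ((1 - u ^ 2) * (2 * v))) * (v * (i * ((1 - v ^ 2) * (2 * u)))) <
          (u * (i * ((1 - v ^ 2) * (2 * u))) + j) * (v * (i * ((1 - u ^ 2) * (2 * v))) + j) := by
      have : 0 < j * (2 * u ^ 2 * (1 - v ^ 2) * i + 2 * v ^ 2 * (1 - u ^ 2) * i) + j * j := by
        positivity
      linarith
    exact key _ _ (by positivity) (by positivity)
  · apply Complex.ext <;> simp [squareToPlane, div_eq_mul_inv, -Complex.real_smul, mul_comm, Complex.smul_re, Complex.smul_im]

theorem hasDerivAt_intervalToLine {t : ℝ} (ht : t ∈ Set.Ioo (-1) 1) :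
    ∃ d : ℝ, 0 < d ∧ HasDerivAt (fun t : ℝ => 3 * t / (2 * (1 - t ^ 2))) d t := by
  have h1 : 0 < 1 - t ^ 2 := by nlinarith [ht.1, ht.2]
  refine ⟨_, ?_, ((hasDerivAt_id t).const_mul 3).fun_div
    ((((hasDerivAt_id t).pow 2).const_sub 1).const_mul 2) (by simpa using h1.ne')⟩
  simp
  apply div_pos
  · nlinarith [sq_nonneg t]
  · positivity

end Determinants

/-- The quaternionic matrix which is right multiplication by `1 - μ` on the line spanned by `x`
and the identity on its orthogonal complement. -/
noncomputable def householder {ι : Type*} [Fintype ι] [DecidableEq ι] (x : ι → ℍ[ℝ]) (μ : ℍ[ℝ]) :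
    Matrix ι ι ℍ[ℝ] :=
  1 - Matrix.of fun i j => (∑ l, normSq (x l))⁻¹ • (x i * μ * star (x j))

section householder

theorem sum_normSq_pos {ι : Type*} [Fintype ι] {x : ι → ℍ[ℝ]} (hx : x ≠ 0) : 0 < ∑ l, normSq (x l) := by
  obtain ⟨l, hl⟩ := Function.ne_iff.1 hx
  exact Finset.sum_pos' (fun l _ => normSq_nonneg) ⟨l, Finset.mem_univ l,
    lt_of_le_of_ne normSq_nonneg (normSq_ne_zero.2 hl).symm⟩

variable {ι : Type*} [Fintype ι] [DecidableEq ι]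

theorem householder_zero (x : ι → ℍ[ℝ]) : householder x 0 = 1 := by
  refine Matrix.ext fun i j => ?_
  simp [householder]

theorem householder_mul_right (x : ι → ℍ[ℝ]) {μ ζ : ℍ[ℝ]} (hζ : ζ ≠ 0) (h : ζ * μ = μ * ζ) :
    householder (fun i => x i * ζ) μ = householder x μ := by
  have hn := normSq_ne_zero.2 hζ
  unfold householder
  congr 2
  refine Matrix.ext fun i j => ?_
  have e : x i * ζ * μ * (star ζ * star (x j)) = normSq ζ • (x i * μ * star (x j)) := by
    calc _ = x i * (ζ * μ) * star ζ * star (x j) := by noncomm_ring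
      _ = x i * μ * (ζ * star ζ) * star (x j) := by rw [h]; noncomm_ring
      _ = _ := by
        rw [self_mul_star, mul_coe_eq_smul, smul_mul_assoc]
  simp only [star_mul, e, map_mul, ← Finset.sum_mul, smul_smul]
  congr 1
  field_simp

theorem householder_mul_householder (x : ι → ℍ[ℝ]) {μ ν : ℍ[ℝ]} (hx : x ≠ 0)
    (h : μ + ν = μ * ν) : householder x μ * householder x ν = 1 := by
  have hs := (sum_normSq_pos hx).ne'
  set s := ∑ l, normSq (x l) with hs'
  have key : (Matrix.of fun i j => s⁻¹ • (x i * μ * star (x j))) *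
      (Matrix.of fun i j => s⁻¹ • (x i * ν * star (x j))) =
      (Matrix.of fun i j => s⁻¹ • (x i * (μ * ν) * star (x j))) := by
    refine Matrix.ext fun i j => ?_
    simp only [Matrix.mul_apply, Matrix.of_apply]
    have e (l : ι) : s⁻¹ • (x i * μ * star (x l)) * s⁻¹ • (x l * ν * star (x j)) =
        (s⁻¹ * s⁻¹ * normSq (x l)) • (x i * (μ * ν) * star (x j)) := by
      rw [smul_mul_smul_comm, ← smul_smul _ (normSq (x l))]
      congr 1
      calc _ = x i * μ * (star (x l) * x l) * ν * star (x j) := by noncomm_ring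
        _ = _ := by
          rw [star_mul_self, mul_coe_eq_smul, smul_mul_assoc, smul_mul_assoc, mul_assoc (x i)]
    rw [Finset.sum_congr rfl fun l _ => e l, ← Finset.sum_smul, ← Finset.mul_sum, ← hs']
    congr 1
    field_simp
  unfold householder
  rw [← hs', sub_mul, mul_sub, mul_sub, key, ← h, one_mul, mul_one, one_mul]
  refine Matrix.ext fun i j => ?_
  simp [mul_add, add_mul]

theorem star_householder (x : ι → ℍ[ℝ]) (μ : ℍ[ℝ]) :
    star (householder x μ) = householder x (star μ) := by
  refine Matrix.ext fun i j => ?_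
  simp [householder, mul_assoc, Matrix.one_apply, eq_comm, apply_ite]

theorem householder_mem_unitary {x : ι → ℍ[ℝ]} {μ : ℍ[ℝ]} (hx : x ≠ 0) (h : normSq μ = 2 * μ.re) :
    householder x μ ∈ unitary (Matrix ι ι ℍ[ℝ]) := by
  rw [Unitary.mem_iff, star_householder]
  constructor
  · refine householder_mul_householder x hx ?_
    rw [star_mul_self, h, star_add_self, two_mul, two_mul, coe_add]
  · refine householder_mul_householder x hx ?_
    rw [self_mul_star, h, self_add_star, two_mul, two_mul, coe_add]

theorem householder_mulVec_single (x : ι → ℍ[ℝ]) (μ : ℍ[ℝ]) (i₀ : ι) :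
    (householder x μ).mulVec (Pi.single i₀ 1) =
      fun i => (Pi.single i₀ 1 : ι → ℍ[ℝ]) i - (∑ l, normSq (x l))⁻¹ • (x i * μ * star (x i₀)) := by
  funext i
  simp [householder, Matrix.one_apply, Pi.single_apply]

end householder

theorem continuous_householder {X ι : Type*} [TopologicalSpace X] [Fintype ι] [DecidableEq ι]
    {x : X → ι → ℍ[ℝ]} {μ : X → ℍ[ℝ]} (hx : Continuous x) (hμ : Continuous μ) (h0 : ∀ a, x a ≠ 0) :
    Continuous fun a => householder (x a) (μ a) := by
  refine continuous_const.sub (continuous_matrix fun i j => ?_)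
  have h (i : ι) : Continuous fun a => x a i := (continuous_apply i).comp hx
  have hs : Continuous fun a => ∑ l, normSq (x a l) :=
    continuous_finsetSum _ fun l _ => Quaternion.continuous_normSq.comp (h l)
  exact (hs.inv₀ fun a => (sum_normSq_pos (h0 a)).ne').smul
    (((h i).mul hμ).mul (continuous_star.comp (h j)))

theorem Complex.continuous_mk {X : Type*} [TopologicalSpace X] {f g : X → ℝ}
    (hf : Continuous f) (hg : Continuous g) : Continuous fun a => (⟨f a, g a⟩ : ℂ) :=
  equivRealProdCLM.symm.continuous.comp (hf.prodMk hg)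

theorem Quaternion.continuous_ofComplexPair {X : Type*} [TopologicalSpace X] {z w : X → ℂ}
    (hz : Continuous z) (hw : Continuous w) : Continuous fun a => ofComplexPair (z a) (w a) := by
  have e (a : X) : ofComplexPair (z a) (w a) =
      (z a).re • ofComplexPair 1 0 + (z a).im • ofComplexPair Complex.I 0 +
        (w a).re • ofComplexPair 0 1 + (w a).im • ofComplexPair 0 Complex.I := by
    ext <;> simp
  simp only [e]
  exact (((Complex.continuous_re.comp hz).smul continuous_const).add
    ((Complex.continuous_im.comp hz).smul continuous_const)).add
    ((Complex.continuous_re.comp hw).smul continuous_const) |>.add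
    ((Complex.continuous_im.comp hw).smul continuous_const)

/-- The index set of the coordinates of the cube. -/
abbrev CubeIndex (N : ℕ) : Type := (Fin (2 * N + 1) × Bool) ⊕ Unit

namespace CubeFamily

open Polynomial

variable {N : ℕ}

/-- The negative of the constant coefficient of the `l`-th linear factor. -/
def num (c : CubeIndex N → ℝ) (l : Fin (2 * N + 1)) : ℂ := ⟨c (.inl (l, false)), c (.inl (l, true))⟩

/-- The leading coefficient of the `l`-th linear factor. -/
def den (c : CubeIndex N → ℝ) (l : Fin (2 * N + 1)) : ℝ :=
  (1 - c (.inl (l, false)) ^ 2) * (1 - c (.inl (l, true)) ^ 2)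

/-- A product of linear factors. -/
noncomputable def poly (c : CubeIndex N → ℝ) : ℂ[X] := ∏ l, (C (den c l : ℂ) * X - C (num c l))

/-- The quaternionic vector with the coefficients of `poly c` as its complex coordinates. -/
noncomputable def vec (c : CubeIndex N → ℝ) (i : Fin (N + 1)) : ℍ[ℝ] :=
  ofComplexPair ((poly c).coeff (2 * N + 1 - i)) ((poly c).coeff i)

/-- The real part of the angular parameter. -/
def angleRe (c : CubeIndex N → ℝ) : ℝ := 2 * (1 - c (.inr ()) ^ 2)

/-- The imaginary part of the angular parameter. -/
def angleIm (c : CubeIndex N → ℝ) : ℝ := 3 * c (.inr ())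

theorem angle_pos (c : CubeIndex N → ℝ) : 0 < angleRe c ^ 2 + angleIm c ^ 2 := by
  unfold angleRe angleIm
  nlinarith [sq_nonneg (c (.inr ()) ^ 2), sq_nonneg (1 - c (.inr ()) ^ 2), sq_nonneg (c (.inr ()))]

/-- A point of the circle of diameter `[0, 2]` in the complex plane. -/
noncomputable def mult (c : CubeIndex N → ℝ) : ℍ[ℝ] :=
  ofComplexPair ((2 * angleRe c / (angleRe c ^ 2 + angleIm c ^ 2) : ℝ) • ⟨angleRe c, angleIm c⟩) 0

theorem normSq_mult (c : CubeIndex N → ℝ) : normSq (mult c) = 2 * (mult c).re := by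
  have := (angle_pos c).ne'
  rw [normSq_def']
  simp only [mult, re_ofComplexPair, imI_ofComplexPair, imJ_ofComplexPair, imK_ofComplexPair,
    Complex.smul_re, Complex.smul_im, smul_eq_mul, Complex.zero_re, Complex.zero_im]
  field_simp
  ring

theorem num_ne_zero_of_den_eq_zero {c : CubeIndex N → ℝ} {l : Fin (2 * N + 1)} (h : den c l = 0) :
    num c l ≠ 0 := by
  intro h0
  have h1 := congrArg Complex.re h0
  have h2 := congrArg Complex.im h0
  simp [num] at h1 h2
  simp [den, h1, h2] at h

theorem poly_ne_zero (c : CubeIndex N → ℝ) : poly c ≠ 0 := by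
  refine Finset.prod_ne_zero_iff.2 fun l _ h => ?_
  have h0 := congrArg (coeff · 0) h
  have h1 := congrArg (coeff · 1) h
  simp at h0 h1
  exact num_ne_zero_of_den_eq_zero h1 h0

theorem natDegree_poly_le (c : CubeIndex N → ℝ) : (poly c).natDegree ≤ 2 * N + 1 := by
  refine (natDegree_prod_le _ _).trans ?_
  refine (Finset.sum_le_card_nsmul _ _ 1 fun l _ => ?_).trans (by simp)
  compute_degree

theorem vec_ne_zero (c : CubeIndex N → ℝ) : vec c ≠ 0 := by
  intro h
  refine poly_ne_zero c (Polynomial.ext fun e => ?_)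
  rw [coeff_zero]
  by_cases he : 2 * N + 1 < e
  · exact coeff_eq_zero_of_natDegree_lt ((natDegree_poly_le c).trans_lt he)
  · have h' (i : Fin (N + 1)) : (poly c).coeff (2 * N + 1 - i) = 0 ∧ (poly c).coeff i = 0 := by
      have hi := congrFun h i
      have h1 := congrArg QuaternionAlgebra.re hi
      have h2 := congrArg QuaternionAlgebra.imI hi
      have h3 := congrArg QuaternionAlgebra.imJ hi
      have h4 := congrArg QuaternionAlgebra.imK hi
      simp [vec] at h1 h2 h3 h4
      exact ⟨Complex.ext h1 h2, Complex.ext h3 h4⟩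
    by_cases hN : e < N + 1
    · exact (h' ⟨e, hN⟩).2
    · have := (h' ⟨2 * N + 1 - e, by omega⟩).1
      simpa [show 2 * N + 1 - (2 * N + 1 - e) = e by omega] using this

theorem continuous_vec : Continuous (vec (N := N)) := by
  have h (e : ℕ) : Continuous fun c : CubeIndex N → ℝ => (poly c).coeff e := by
    refine MonicCoeff.continuous_coeff_prod _
      (fun l (c : CubeIndex N → ℝ) => C (den c l : ℂ) * X - C (num c l)) (fun l e => ?_) e
    have h1 : Continuous fun c : CubeIndex N → ℝ => num c l :=
      Complex.continuous_mk (continuous_apply _) (continuous_apply _)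
    have h2 : Continuous fun c : CubeIndex N → ℝ => den c l := by unfold den; fun_prop
    simp only [coeff_sub, coeff_C_mul, coeff_C]
    split_ifs <;> fun_prop
  exact continuous_pi fun i => continuous_ofComplexPair (h _) (h _)

theorem continuous_mult : Continuous (mult (N := N)) := by
  have h1 : Continuous (angleRe (N := N)) := by unfold angleRe; fun_prop
  have h2 : Continuous (angleIm (N := N)) := by unfold angleIm; fun_prop
  refine continuous_ofComplexPair (Continuous.fun_smul ?_ ?_) continuous_const
  · exact (h1.const_mul 2 |>.div (by fun_prop)) fun c => (angle_pos c).ne'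
  · exact Complex.continuous_mk h1 h2

/-- A family of quaternionic unitary matrices parametrized by a real vector space. -/
noncomputable def family (N : ℕ) :
    C(CubeIndex N → ℝ, unitary (Matrix (Fin (N + 1)) (Fin (N + 1)) ℍ[ℝ])) where
  toFun c := ⟨householder (vec c) (mult c), householder_mem_unitary (vec_ne_zero c) (normSq_mult c)⟩
  continuous_toFun :=
    (continuous_householder continuous_vec continuous_mult vec_ne_zero).subtype_mk _

theorem coe_family (c : CubeIndex N → ℝ) : (family N c).val = householder (vec c) (mult c) := rfl

/-- Only the class of `num c l` up to scale matters if `den c l = 0`. -/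
theorem householder_vec_eq {c c' : CubeIndex N → ℝ} {l : Fin (2 * N + 1)}
    (hl : den c l = 0) (hl' : den c' l = 0) (hnum : ∀ m ≠ l, num c' m = num c m)
    (hden : ∀ m ≠ l, den c' m = den c m) (hmult : mult c' = mult c) :
    householder (vec c') (mult c') = householder (vec c) (mult c) := by
  set Q : ℂ[X] := ∏ m ∈ Finset.univ.erase l, (C (den c m : ℂ) * X - C (num c m)) with hQ
  set y : Fin (N + 1) → ℍ[ℝ] := fun i => ofComplexPair (Q.coeff (2 * N + 1 - i)) (Q.coeff i) with hy
  have key (c'' : CubeIndex N → ℝ) (h0 : den c'' l = 0) (hnum : ∀ m ≠ l, num c'' m = num c m)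
      (hden : ∀ m ≠ l, den c'' m = den c m) : householder (vec c'') (mult c) =
        householder y (mult c) := by
    have hp : poly c'' = C (-num c'' l) * Q := by
      rw [poly, ← Finset.mul_prod_erase _ _ (Finset.mem_univ l), h0, hQ]
      congr 1
      · simp
      · refine Finset.prod_congr rfl fun m hm => ?_
        rw [hnum m (Finset.ne_of_mem_erase hm), hden m (Finset.ne_of_mem_erase hm)]
    have hv : vec c'' = fun i => y i * ofComplexPair (-num c'' l) 0 := by
      funext i
      simp only [vec, hp, coeff_C_mul, hy]
      ext <;> simp <;> ring
    rw [hv]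
    refine householder_mul_right y ?_ ?_
    · intro h
      have h1 := congrArg QuaternionAlgebra.re h
      have h2 := congrArg QuaternionAlgebra.imI h
      simp at h1 h2
      exact num_ne_zero_of_den_eq_zero h0 (Complex.ext h1 h2)
    · ext <;> simp [mult] <;> ring
  rw [hmult, key c' hl' hnum hden, key c hl (fun _ _ => rfl) fun _ _ => rfl]

theorem family_shift (i : CubeIndex N) (c : CubeIndex N → ℝ) (hc : c i = -1) :
    family N (ListChain.shift i c) = family N c := by
  have hi : ListChain.shift i c i = 1 := by simp [ListChain.shift, hc]; norm_num
  have hj : ∀ j ≠ i, ListChain.shift i c j = c j := fun j hj => by simp [ListChain.shift, hj]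
  refine Subtype.ext ?_
  rw [coe_family, coe_family]
  rcases i with ⟨l, ε⟩ | ⟨⟩
  · refine householder_vec_eq (l := l) ?_ ?_ (fun m hm => ?_) (fun m hm => ?_) ?_
    · cases ε <;> simp [den, hc]
    · cases ε <;> simp [den, hi]
    · rw [num, num, hj _ (by simp [hm]), hj _ (by simp [hm])]
    · rw [den, den, hj _ (by simp [hm]), hj _ (by simp [hm])]
    · rw [mult, mult, angleRe, angleRe, angleIm, angleIm, hj _ (by simp)]
  · have h1 : mult c = 0 := by ext <;> simp [mult, angleRe, hc]
    have h2 : mult (ListChain.shift (.inr ()) c) = 0 := by ext <;> simp [mult, angleRe, hi]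
    rw [h1, h2, householder_zero, householder_zero]

end CubeFamily

namespace CubeFamily

variable {N : ℕ}

/-- The space of coefficients and angles. -/
abbrev Params (N : ℕ) : Type := (Fin (2 * N + 1) → ℂ) × ℝ

/-- The space of values of the local coordinates on the sphere. -/
abbrev Target (N : ℕ) : Type := (ℂ × ℝ) × (Fin N → ℍ[ℝ])

/-- The cube coordinates as complex numbers. -/
noncomputable def paramEquiv (N : ℕ) : (CubeIndex N → ℝ) ≃L[ℝ] Params N :=
  LinearEquiv.toContinuousLinearEquiv
    { toFun := fun c => (num c, c (.inr ()))
      map_add' := fun c c' => rfl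
      map_smul' := fun r c => by
        refine Prod.ext (funext fun l => ?_) rfl
        apply Complex.ext <;> simp [num]
      invFun := fun a => Sum.elim (fun l => if l.2 then (a.1 l.1).im else (a.1 l.1).re) fun _ => a.2
      left_inv := fun c => by
        funext i
        rcases i with ⟨l, ε | ε⟩ | ⟨⟩ <;> simp [num]
      right_inv := fun a => by
        refine Prod.ext (funext fun l => ?_) rfl
        apply Complex.ext <;> simp [num] }

/-- Pairing the coefficients of a polynomial to quaternions, as a linear map. -/
noncomputable def pairingMap (N : ℕ) : Params N →ₗ[ℝ] Target N where
  toFun a := ((a.1 0, a.2), fun i => ofComplexPair (a.1 ⟨2 * N - i, by omega⟩) (a.1 ⟨i + 1, by omega⟩))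
  map_add' a b := by
    refine Prod.ext rfl (funext fun i => ?_)
    ext <;> simp
    ring
  map_smul' r a := by
    refine Prod.ext (Prod.ext rfl rfl) (funext fun i => ?_)
    ext <;> simp

theorem pairingMap_injective : Function.Injective (pairingMap N) := by
  rw [injective_iff_map_eq_zero]
  intro a ha
  have h0 : a.1 0 = 0 := congrArg (fun x => x.1.1) ha
  have h1 (i : Fin N) : a.1 ⟨2 * N - i, by omega⟩ = 0 ∧ a.1 ⟨i + 1, by omega⟩ = 0 := by
    have hi := congrFun (congrArg Prod.snd ha) i
    have h1 := congrArg QuaternionAlgebra.re hi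
    have h2 := congrArg QuaternionAlgebra.imI hi
    have h3 := congrArg QuaternionAlgebra.imJ hi
    have h4 := congrArg QuaternionAlgebra.imK hi
    simp [pairingMap] at h1 h2 h3 h4
    exact ⟨Complex.ext h1 h2, Complex.ext h3 h4⟩
  refine Prod.ext (funext fun e => ?_) (congrArg (fun x => x.1.2) ha)
  by_cases he : (e : ℕ) = 0
  · rw [show e = 0 from Fin.ext he]
    exact h0
  by_cases he' : (e : ℕ) ≤ N
  · have := (h1 ⟨e - 1, by omega⟩).2
    refine Eq.trans (congrArg a.1 ?_) this
    exact Fin.ext (by simp; omega)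
  · have := (h1 ⟨2 * N - e, by omega⟩).1
    refine Eq.trans (congrArg a.1 ?_) this
    exact Fin.ext (by simp; omega)

/-- Pairing the coefficients of a polynomial to quaternions. -/
noncomputable def pairing (N : ℕ) : Params N ≃L[ℝ] Target N :=
  ((pairingMap N).linearEquivOfInjective pairingMap_injective (by
    simp [Module.finrank_pi_fintype, Quaternion.finrank_eq_four]; ring)).toContinuousLinearEquiv

theorem pairing_apply (a : Params N) : pairing N a = ((a.1 0, a.2),
    fun i : Fin N => ofComplexPair (a.1 ⟨2 * N - i, by omega⟩) (a.1 ⟨i + 1, by omega⟩)) := rfl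

/-- Scaling of the first component and right multiplication on the second one. -/
noncomputable def scaling (N : ℕ) (R : ℝ) (r : ℍ[ℝ]) : Target N →L[ℝ] Target N :=
  LinearMap.toContinuousLinearMap (LinearMap.prodMap (R • LinearMap.id)
    (LinearMap.pi fun i => (LinearMap.mulRight ℝ r).comp (LinearMap.proj i)))

theorem scaling_apply (R : ℝ) (r : ℍ[ℝ]) (a : Target N) :
    scaling N R r a = (R • a.1, fun i => a.2 i * r) := rfl

theorem det_scaling_pos {R : ℝ} {r : ℍ[ℝ]} (hR : 0 < R) (hr : r ≠ 0) :
    0 < LinearMap.det (scaling N R r : Target N →ₗ[ℝ] Target N) := by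
  rw [scaling, LinearMap.coe_toContinuousLinearMap, LinearMap.det_prodMap]
  refine mul_pos ?_ (LinearMap.det_pi_comp_proj_pos _ fun i => Quaternion.det_mulRight_pos hr)
  rw [LinearMap.det_smul, LinearMap.det_id, mul_one]
  positivity

/-- The nonlinear part of the local coordinates. -/
noncomputable def twist (a : Target N) : Target N :=
  ((⟨a.1.2 * (Complex.normSq a.1.1 - 1) / 2, a.1.2 * a.1.1.im⟩,
    a.1.2 * a.1.1.re - (1 + Complex.normSq a.1.1) / 2), a.2)

theorem twist_eq_zero {τ : ℝ} (hτ : τ ^ 2 = 1) : twist (N := N) (((τ : ℂ), τ), 0) = 0 := by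
  have : τ * τ = 1 := by rw [← hτ]; ring
  refine Prod.ext (Prod.ext (Complex.ext ?_ ?_) ?_) rfl <;> simp [twist, this]

/-- The derivative of `twist`. -/
noncomputable def twistDeriv (N : ℕ) (τ : ℝ) : Target N →L[ℝ] Target N :=
  ((Complex.stretch τ).prodMap (τ • ContinuousLinearMap.id ℝ ℝ)).prodMap
    (ContinuousLinearMap.id ℝ _)

theorem det_twistDeriv_pos {τ : ℝ} (hτ : τ ^ 2 = 1) :
    0 < LinearMap.det (twistDeriv N τ : Target N →ₗ[ℝ] Target N) := by
  rw [twistDeriv, ContinuousLinearMap.coe_prodMap, LinearMap.det_prodMap,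
    ContinuousLinearMap.coe_prodMap, LinearMap.det_prodMap, Complex.det_stretch]
  simp [← sq, hτ]

theorem hasFDerivAt_twist {τ : ℝ} (hτ : τ ^ 2 = 1) :
    HasFDerivAt (twist (N := N)) (twistDeriv N τ) (((τ : ℂ), τ), 0) := by
  have hβ : HasFDerivAt (fun a : Target N => a.1.1)
      ((ContinuousLinearMap.fst ℝ ℂ ℝ).comp (ContinuousLinearMap.fst ℝ (ℂ × ℝ) (Fin N → ℍ[ℝ])))
      (((τ : ℂ), τ), 0) := hasFDerivAt_fst.fst
  have hre := Complex.reCLM.hasFDerivAt.comp _ hβ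
  have him := Complex.imCLM.hasFDerivAt.comp _ hβ
  have hT : HasFDerivAt (fun a : Target N => a.1.2)
      ((ContinuousLinearMap.snd ℝ ℂ ℝ).comp (ContinuousLinearMap.fst ℝ (ℂ × ℝ) (Fin N → ℍ[ℝ])))
      (((τ : ℂ), τ), 0) := hasFDerivAt_fst.snd
  have h2 : HasFDerivAt (fun a : Target N => a.2)
      (ContinuousLinearMap.snd ℝ (ℂ × ℝ) (Fin N → ℍ[ℝ])) (((τ : ℂ), τ), 0) :=
    hasFDerivAt_snd
  have hn := (hre.mul hre).add (him.mul him)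
  have hf := ((((hT.mul (hn.sub_const 1)).mul_const (1 / 2)).smul_const (1 : ℂ)).add
    ((hT.mul him).smul_const Complex.I)).prodMk
      ((hT.mul hre).sub ((hn.const_add 1).mul_const (1 / 2))) |>.prodMk h2
  refine (hf.congr_fderiv ?_).congr_of_eventuallyEq (Filter.Eventually.of_forall fun a => ?_)
  · have h1 : τ * τ = 1 := by rw [← hτ]; ring
    refine ContinuousLinearMap.ext fun a => Prod.ext (Prod.ext (Complex.ext ?_ ?_) ?_) rfl
    · simp [twistDeriv, Complex.stretch, -Complex.real_smul, Complex.smul_re]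
      linear_combination (a.1.1.re + a.1.2 / 2) * h1
    · simp [twistDeriv, Complex.stretch, -Complex.real_smul, Complex.smul_im]
    · simp [twistDeriv, -Complex.real_smul]
      ring
  · refine Prod.ext (Prod.ext (Complex.ext ?_ ?_) ?_) rfl <;>
      simp [twist, Complex.normSq_apply, -Complex.real_smul, Complex.smul_re, Complex.smul_im] <;> ring

end CubeFamily

namespace CubeFamily

variable {N : ℕ}

open Polynomial

theorem eq_of_twist_eq_zero {a : Target N} (h : twist a = 0) :
    ∃ τ : ℝ, τ ^ 2 = 1 ∧ a = (((τ : ℂ), τ), 0) := by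
  have h1 : a.1.2 * (Complex.normSq a.1.1 - 1) / 2 = 0 := congrArg (fun x => x.1.1.re) h
  have h2 : a.1.2 * a.1.1.im = 0 := congrArg (fun x => x.1.1.im) h
  have h3 : a.1.2 * a.1.1.re - (1 + Complex.normSq a.1.1) / 2 = 0 := congrArg (fun x => x.1.2) h
  have h4 : a.2 = 0 := congrArg Prod.snd h
  have hn := Complex.normSq_nonneg a.1.1
  have hT : a.1.2 ≠ 0 := by
    intro h0
    rw [h0, zero_mul] at h3
    linarith
  have hi : a.1.1.im = 0 := (mul_eq_zero.1 h2).resolve_left hT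
  have hn1 : Complex.normSq a.1.1 = 1 := by
    have := (mul_eq_zero.1 (div_eq_zero_iff.1 h1 |>.resolve_right two_ne_zero)).resolve_left hT
    linarith
  have hr : a.1.1.re * a.1.1.re = 1 := by
    rw [Complex.normSq_apply, hi] at hn1
    linarith
  rw [hn1] at h3
  have hTr : a.1.2 = a.1.1.re := by
    linear_combination a.1.1.re * h3 - a.1.2 * hr
  refine ⟨a.1.1.re, by rw [sq, hr], Prod.ext (Prod.ext (Complex.ext ?_ ?_) hTr) h4⟩ <;> simp [hi]

theorem pairing_single (τ : ℝ) : pairing N (Pi.single 0 (τ : ℂ), τ) = (((τ : ℂ), τ), 0) := by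
  rw [pairing_apply]
  refine Prod.ext (Prod.ext (by simp) rfl) (funext fun i => ?_)
  have h1 : (⟨2 * N - i, by omega⟩ : Fin (2 * N + 1)) ≠ 0 := fun h => by
    have := congrArg Fin.val h
    simp at this
    omega
  have h2 : (⟨i + 1, by omega⟩ : Fin (2 * N + 1)) ≠ 0 := fun h => by
    have := congrArg Fin.val h
    simp at this
  simp only [Pi.single_eq_of_ne h1, Pi.single_eq_of_ne h2]
  ext <;> simp

theorem coeffs_eq_of_pairing {z : Fin (2 * N + 1) → ℂ} {T τ : ℝ}
    (h : pairing N (MonicCoeff.coeffs z, T) = (((τ : ℂ), τ), 0)) :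
    ∏ l, (X - C (z l)) = X ^ (2 * N + 1) + C (τ : ℂ) := by
  have hz : MonicCoeff.coeffs z = Pi.single 0 (τ : ℂ) :=
    congrArg Prod.fst ((pairing N).injective (h.trans (pairing_single τ).symm))
  have hd : (∏ l, (X - C (z l))).natDegree = 2 * N + 1 := by
    rw [natDegree_finsetProd_X_sub_C_eq_card]; simp
  have hm : (∏ l, (X - C (z l))).Monic := monic_prod_X_sub_C _ _
  refine Polynomial.ext fun e => ?_
  rcases lt_trichotomy e (2 * N + 1) with he | rfl | he
  · have := congrFun hz ⟨e, he⟩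
    rw [MonicCoeff.coeffs] at this
    refine this.trans ?_
    rw [coeff_add, coeff_X_pow, coeff_C, if_neg he.ne, zero_add, Pi.single_apply]
    simp [Fin.ext_iff]
  · have := hm.coeff_natDegree
    rw [hd] at this
    rw [this]
    simp
  · rw [coeff_eq_zero_of_natDegree_lt (hd.trans_lt he)]
    simp [coeff_X_pow, coeff_C, he.ne', show e ≠ 0 by omega]

/-- The leading coefficient of `poly c`. -/
def lead (c : CubeIndex N → ℝ) : ℝ := ∏ l, den c l

theorem coeff_poly_top (c : CubeIndex N → ℝ) : (poly c).coeff (2 * N + 1) = (lead c : ℂ) := by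
  have := coeff_prod_of_natDegree_le (s := Finset.univ)
    (fun l => C (den c l : ℂ) * X - C (num c l)) 1 (fun l _ => by compute_degree)
  simp only [Finset.card_univ, Fintype.card_fin, mul_one] at this
  rw [poly, this, lead]
  simp [coeff_C]

/-- The roots of `poly c`. -/
noncomputable def ratio (c : CubeIndex N → ℝ) (l : Fin (2 * N + 1)) : ℂ :=
  squareToPlane (num c l).re (num c l).im

theorem den_mul_ratio {c : CubeIndex N → ℝ} {l : Fin (2 * N + 1)} (h : den c l ≠ 0) :
    den c l * ratio c l = num c l := by
  have e : den c l = (1 - (num c l).re ^ 2) * (1 - (num c l).im ^ 2) := rfl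
  rw [e] at h ⊢
  apply Complex.ext <;> rw [ratio, squareToPlane, ← Complex.real_smul]
  · rw [Complex.smul_re, smul_eq_mul, mul_div_cancel₀ _ h]
  · rw [Complex.smul_im, smul_eq_mul, mul_div_cancel₀ _ h]

theorem poly_eq {c : CubeIndex N → ℝ} (h : ∀ l, den c l ≠ 0) :
    poly c = C (lead c : ℂ) * ∏ l, (X - C (ratio c l)) := by
  rw [poly, lead, Complex.ofReal_prod, map_prod, ← Finset.prod_mul_distrib]
  refine Finset.prod_congr rfl fun l _ => ?_
  rw [mul_sub, ← C_mul, den_mul_ratio (h l)]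

theorem coeff_poly {c : CubeIndex N → ℝ} (h : ∀ l, den c l ≠ 0) (e : Fin (2 * N + 1)) :
    (poly c).coeff e = lead c * MonicCoeff.coeffs (ratio c) e := by
  rw [poly_eq h, coeff_C_mul, MonicCoeff.coeffs]

/-- The slope of the angular parameter. -/
noncomputable def slope (c : CubeIndex N → ℝ) : ℝ := angleIm c / angleRe c

/-- The displacement of the first basis vector under `family N c`. -/
noncomputable def defect (c : CubeIndex N → ℝ) (i : Fin (N + 1)) : ℍ[ℝ] :=
  (∑ l, normSq (vec c l))⁻¹ • (vec c i * mult c * star (vec c 0))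

/-- Local coordinates on the sphere. -/
def target (w : Fin (N + 1) → ℍ[ℝ]) : Target N :=
  ((⟨-(w 0).imI, -(w 0).imJ⟩, -(w 0).imK - (w 0).re), fun i => w i.succ)

/-- The factor by which the first component of the local coordinates is scaled. -/
noncomputable def scaleRe (c : CubeIndex N → ℝ) : ℝ :=
  (∑ l, normSq (vec c l))⁻¹ * (4 * angleRe c ^ 2 / (angleRe c ^ 2 + angleIm c ^ 2) * lead c ^ 2)

/-- The quaternion by which the second component of the local coordinates is multiplied. -/
noncomputable def scaleQuat (c : CubeIndex N → ℝ) : ℍ[ℝ] :=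
  ((∑ l, normSq (vec c l))⁻¹ * lead c) • (mult c * star (vec c 0))

theorem _root_.Quaternion.conj_ofComplexPair (a : ℝ) (z w : ℂ) :
    ofComplexPair a z * ofComplexPair w 0 * star (ofComplexPair a z) =
      ofComplexPair ⟨w.re * (a ^ 2 + Complex.normSq z), w.im * (a ^ 2 - Complex.normSq z)⟩
        ⟨-2 * w.im * a * z.im, 2 * w.im * a * z.re⟩ := by
  ext <;> simp [Complex.normSq_apply] <;> ring

theorem vec_zero (c : CubeIndex N → ℝ) :
    vec c 0 = ofComplexPair (lead c) ((poly c).coeff 0) := by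
  rw [vec, Fin.val_zero, Nat.sub_zero, coeff_poly_top]

theorem defect_zero (c : CubeIndex N → ℝ) :
    defect c 0 = ((∑ l, normSq (vec c l))⁻¹ *
      (2 * angleRe c / (angleRe c ^ 2 + angleIm c ^ 2))) • ofComplexPair
        ⟨angleRe c * (lead c ^ 2 + Complex.normSq ((poly c).coeff 0)),
          angleIm c * (lead c ^ 2 - Complex.normSq ((poly c).coeff 0))⟩
        ⟨-2 * angleIm c * lead c * ((poly c).coeff 0).im,
          2 * angleIm c * lead c * ((poly c).coeff 0).re⟩ := by
  rw [defect, vec_zero, mult, conj_ofComplexPair, mul_smul]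
  congr 1
  ext <;> simp [-Complex.real_smul, Complex.smul_re, Complex.smul_im] <;> ring

theorem target_defect {c : CubeIndex N → ℝ} (h : ∀ l, den c l ≠ 0) (hp : angleRe c ≠ 0) :
    target (defect c) = scaling N (scaleRe c) (scaleQuat c)
      (twist (pairing N (MonicCoeff.coeffs (ratio c), slope c))) := by
  have h0 : (poly c).coeff 0 = lead c * MonicCoeff.coeffs (ratio c) 0 := coeff_poly h 0
  have hq := (angle_pos c).ne'
  rw [scaling_apply, pairing_apply]
  refine Prod.ext (Prod.ext (Complex.ext ?_ ?_) ?_) (funext fun i => ?_)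
  · simp [target, defect_zero, twist, h0, scaleRe, slope, Complex.normSq_apply,
      -Complex.real_smul, Complex.smul_re]
    field_simp
    ring
  · simp [target, defect_zero, twist, h0, scaleRe, slope, Complex.normSq_apply,
      -Complex.real_smul, Complex.smul_im]
    field_simp
    ring
  · simp [target, defect_zero, twist, h0, scaleRe, slope, Complex.normSq_apply,
      -Complex.real_smul]
    field_simp
    ring
  · have e1 := coeff_poly h ⟨2 * N - i, by omega⟩
    have e2 := coeff_poly h ⟨i + 1, by omega⟩
    have e3 : vec c i.succ = lead c • ofComplexPair
        (MonicCoeff.coeffs (ratio c) ⟨2 * N - i, by omega⟩)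
        (MonicCoeff.coeffs (ratio c) ⟨i + 1, by omega⟩) := by
      rw [vec, Fin.val_succ, show 2 * N + 1 - (i + 1 : ℕ) = 2 * N - i by omega, e1, e2]
      ext <;> simp
    simp only [target, defect, e3, twist, scaleQuat]
    rw [smul_mul_assoc, smul_mul_assoc, smul_smul, mul_smul_comm, mul_assoc]

theorem lead_ne_zero {c : CubeIndex N → ℝ} (h0 : target (defect c) = 0)
    (hre : 0 < (defect c 0).re) : lead c ≠ 0 := by
  intro hl
  have h3 : -(defect c 0).imK - (defect c 0).re = 0 := congrArg (fun x => x.1.2) h0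
  have : (defect c 0).imK = 0 := by simp [defect_zero, hl]
  linarith

theorem angleRe_ne_zero {c : CubeIndex N → ℝ} (hre : 0 < (defect c 0).re) : angleRe c ≠ 0 := by
  intro h
  simp [defect_zero, h] at hre

theorem vec_zero_ne_zero {c : CubeIndex N → ℝ} (h : lead c ≠ 0) : vec c 0 ≠ 0 := by
  intro h0
  have := congrArg QuaternionAlgebra.re h0
  simp [vec_zero] at this
  exact h this

theorem scaleRe_pos {c : CubeIndex N → ℝ} (h : lead c ≠ 0) (hp : angleRe c ≠ 0) :
    0 < scaleRe c := by
  have h1 := sum_normSq_pos (vec_ne_zero c)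
  have h2 := angle_pos c
  unfold scaleRe
  positivity

theorem scaleQuat_ne_zero {c : CubeIndex N → ℝ} (h : lead c ≠ 0) (hp : angleRe c ≠ 0) :
    scaleQuat c ≠ 0 := by
  have h1 := sum_normSq_pos (vec_ne_zero c)
  refine smul_ne_zero (mul_ne_zero (inv_ne_zero h1.ne') h) (mul_ne_zero ?_ ?_)
  · intro h0
    have := congrArg QuaternionAlgebra.re h0
    have h2 := (angle_pos c).ne'
    simp [mult, -Complex.real_smul, Complex.smul_re, h2, hp] at this
  · rw [star_ne_zero]
    exact vec_zero_ne_zero h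

theorem exists_of_target_defect_eq_zero {c : CubeIndex N → ℝ} (h0 : target (defect c) = 0)
    (hre : 0 < (defect c 0).re) : ∃ τ : ℝ, τ ^ 2 = 1 ∧
      pairing N (MonicCoeff.coeffs (ratio c), slope c) = (((τ : ℂ), τ), 0) := by
  have hl := lead_ne_zero h0 hre
  have hp := angleRe_ne_zero hre
  have hd : ∀ l, den c l ≠ 0 := fun l => (Finset.prod_ne_zero_iff.1 hl) l (Finset.mem_univ l)
  rw [target_defect hd hp] at h0
  have hinj := det_scaling_pos (N := N) (scaleRe_pos hl hp) (scaleQuat_ne_zero hl hp)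
  refine eq_of_twist_eq_zero ?_
  rw [scaling_apply] at h0
  refine Prod.ext ?_ (funext fun i => ?_)
  · exact (smul_eq_zero.1 (congrArg Prod.fst h0)).resolve_left (scaleRe_pos hl hp).ne'
  · exact (mul_eq_zero.1 (congrFun (congrArg Prod.snd h0) i)).resolve_right
      (scaleQuat_ne_zero hl hp)

end CubeFamily

theorem LinearEquiv.det_symm_comp_comp {V W : Type*} [AddCommGroup V] [Module ℝ V]
    [AddCommGroup W] [Module ℝ W] (e : V ≃ₗ[ℝ] W) (f : W →ₗ[ℝ] W) :
    LinearMap.det ((e.symm : W →ₗ[ℝ] V) ∘ₗ f ∘ₗ (e : V →ₗ[ℝ] W)) = LinearMap.det f := by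
  have := LinearMap.det_conj f e.symm
  rwa [LinearEquiv.symm_symm] at this

namespace CubeFamily

variable {N : ℕ}

/-- The roots and the slope as functions of the parameters. -/
noncomputable def blowUp (a : Params N) : Params N :=
  (fun l => squareToPlane (a.1 l).re (a.1 l).im, 3 * a.2 / (2 * (1 - a.2 ^ 2)))

theorem hasFDerivAt_blowUp {c : CubeIndex N → ℝ} (hc : ∀ i, c i ∈ Set.Ioo (-1) 1) :
    ∃ L : Params N →L[ℝ] Params N, 0 < LinearMap.det (L : Params N →ₗ[ℝ] Params N) ∧
      HasFDerivAt blowUp L (paramEquiv N c) := by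
  choose D hD hD' using fun l : Fin (2 * N + 1) =>
    hasFDerivAt_squareToPlane (hc (.inl (l, false))) (hc (.inl (l, true)))
  obtain ⟨d, hd, hd'⟩ := hasDerivAt_intervalToLine (hc (.inr ()))
  refine ⟨(ContinuousLinearMap.pi fun l => (D l).comp (ContinuousLinearMap.proj l)).prodMap
    (d • ContinuousLinearMap.id ℝ ℝ), ?_, ?_⟩
  · rw [ContinuousLinearMap.coe_prodMap, LinearMap.det_prodMap]
    refine mul_pos (LinearMap.det_pi_comp_proj_pos (fun l => (D l : ℂ →ₗ[ℝ] ℂ)) hD) ?_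
    simpa using hd
  · refine HasFDerivAt.prodMk (hasFDerivAt_pi'.2 fun l => ?_) ?_
    · have h1 : HasFDerivAt (fun a : Params N => a.1 l)
          ((ContinuousLinearMap.proj l).comp (ContinuousLinearMap.fst ℝ _ _)) (paramEquiv N c) :=
        ContinuousLinearMap.hasFDerivAt
          ((ContinuousLinearMap.proj l).comp (ContinuousLinearMap.fst ℝ (Fin (2 * N + 1) → ℂ) ℝ))
      exact HasFDerivAt.comp (g := fun z : ℂ => squareToPlane z.re z.im) (paramEquiv N c) (hD' l) h1
    · have h2 : HasFDerivAt (fun a : Params N => a.2) (ContinuousLinearMap.snd ℝ _ _)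
        (paramEquiv N c) := hasFDerivAt_snd
      refine (HasDerivAt.comp_hasFDerivAt (paramEquiv N c) hd' h2).congr_fderiv ?_
      ext <;> simp

/-- The map taking roots to coefficients is an orientation preserving local diffeomorphism. -/
theorem hasFDerivAt_coeffs_prod {z : Fin (2 * N + 1) → ℂ} (hz : Function.Injective z) (T : ℝ) :
    ∃ L : Params N →L[ℝ] Params N, 0 < LinearMap.det (L : Params N →ₗ[ℝ] Params N) ∧
      HasFDerivAt (fun a : Params N => (MonicCoeff.coeffs a.1, a.2)) L (z, T) := by
  refine ⟨((fderiv ℂ MonicCoeff.coeffs z).restrictScalars ℝ).prodMap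
    (ContinuousLinearMap.id ℝ ℝ), ?_, ?_⟩
  · rw [ContinuousLinearMap.coe_prodMap, LinearMap.det_prodMap]
    refine mul_pos (MonicCoeff.det_fderiv_coeffs_pos hz) ?_
    simp
  · have := (MonicCoeff.differentiable_coeffs (2 * N + 1) z).hasFDerivAt.restrictScalars ℝ
    exact HasFDerivAt.prodMap (z, T) this (hasFDerivAt_id T)

theorem Ioo_of_den_ne_zero {c : CubeIndex N → ℝ} (hc : c ∈ Set.Icc (-1) 1)
    (h : ∀ l, den c l ≠ 0) (hp : angleRe c ≠ 0) (i : CubeIndex N) : c i ∈ Set.Ioo (-1) 1 := by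
  have h1 : c i ≠ -1 ∧ c i ≠ 1 := by
    rcases i with ⟨l, ε⟩ | ⟨⟩
    · have := h l
      constructor <;> intro h0 <;> cases ε <;> simp [den, h0] at this
    · constructor <;> intro h0 <;> simp [angleRe, h0] at hp
  exact ⟨lt_of_le_of_ne (hc.1 i) h1.1.symm, lt_of_le_of_ne (hc.2 i) h1.2⟩

theorem continuous_den (l : Fin (2 * N + 1)) : Continuous fun c : CubeIndex N → ℝ => den c l := by
  unfold den; fun_prop

theorem continuous_lead : Continuous (lead (N := N)) :=
  continuous_finsetProd _ fun l _ => continuous_den l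

theorem continuous_angleRe : Continuous (angleRe (N := N)) := by unfold angleRe; fun_prop

theorem continuous_angleIm : Continuous (angleIm (N := N)) := by unfold angleIm; fun_prop

theorem continuous_inv_sum_normSq_vec :
    Continuous fun c : CubeIndex N → ℝ => (∑ l, normSq (vec c l))⁻¹ :=
  (continuous_finsetSum _ fun l _ => Quaternion.continuous_normSq.comp
    ((continuous_apply l).comp continuous_vec)).inv₀ fun c => (sum_normSq_pos (vec_ne_zero c)).ne'

theorem continuous_scaleRe : Continuous (scaleRe (N := N)) := by
  have h1 := continuous_angleRe (N := N)
  have h2 := continuous_angleIm (N := N)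
  have h3 := continuous_lead (N := N)
  refine continuous_inv_sum_normSq_vec.mul (Continuous.mul ?_ (h3.pow 2))
  exact Continuous.div (by fun_prop) (by fun_prop) fun c => (angle_pos c).ne'

theorem continuous_scaleQuat : Continuous (scaleQuat (N := N)) :=
  (continuous_inv_sum_normSq_vec.mul continuous_lead).smul
    (continuous_mult.mul (continuous_star.comp ((continuous_apply 0).comp continuous_vec)))

theorem continuous_scaling :
    Continuous fun c : CubeIndex N → ℝ => scaling N (scaleRe c) (scaleQuat c) := by
  refine continuous_clm_apply.2 fun a => ?_
  simp only [scaling_apply]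
  exact (continuous_scaleRe.smul continuous_const).prodMk
    (continuous_pi fun i => continuous_const.mul continuous_scaleQuat)

/-- The displacement of the first basis vector is an orientation preserving local diffeomorphism
near its zeros. -/
theorem hasFDerivAt_target_defect {c : CubeIndex N → ℝ} (hc : c ∈ Set.Icc (-1) 1)
    (h0 : target (defect c) = 0) (hre : 0 < (defect c 0).re) :
    (∀ i, c i ∈ Set.Ioo (-1) 1) ∧ ∃ L : (CubeIndex N → ℝ) →L[ℝ] (CubeIndex N → ℝ),
      0 < LinearMap.det (L : (CubeIndex N → ℝ) →ₗ[ℝ] (CubeIndex N → ℝ)) ∧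
        HasFDerivAt (fun x => (paramEquiv N).symm ((pairing N).symm (target (defect x)))) L c := by
  have hl := lead_ne_zero h0 hre
  have hp := angleRe_ne_zero hre
  have hd : ∀ l, den c l ≠ 0 := fun l => (Finset.prod_ne_zero_iff.1 hl) l (Finset.mem_univ l)
  have hI := Ioo_of_den_ne_zero hc hd hp
  refine ⟨hI, ?_⟩
  obtain ⟨τ, hτ, hpair⟩ := exists_of_target_defect_eq_zero h0 hre
  have hinj : Function.Injective (ratio c) := by
    refine MonicCoeff.injective_of_prod_eq (by omega) ?_ (coeffs_eq_of_pairing hpair)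
    rintro h
    rw [Complex.ofReal_eq_zero] at h
    simp [h] at hτ
  obtain ⟨D, hD, hD'⟩ := hasFDerivAt_blowUp hI
  obtain ⟨E, hE, hE'⟩ := hasFDerivAt_coeffs_prod hinj (slope c)
  have hdet := det_scaling_pos (N := N) (scaleRe_pos hl hp) (scaleQuat_ne_zero hl hp)
  have h1 := (hE'.comp (paramEquiv N c) hD').comp c (paramEquiv N).hasFDerivAt
  have h2 := (pairing N).hasFDerivAt.comp c h1
  have h3 : HasFDerivAt twist (twistDeriv N τ)
      (pairing N (MonicCoeff.coeffs (ratio c), slope c)) := by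
    rw [hpair]; exact hasFDerivAt_twist hτ
  have h4 := h3.comp c h2
  have h5 := h4.clm_apply_of_eq_zero continuous_scaling.continuousAt
    (by
      have := twist_eq_zero (N := N) hτ
      rw [← hpair] at this
      exact this)
  have h6 := (paramEquiv N).symm.hasFDerivAt.comp c ((pairing N).symm.hasFDerivAt.comp c h5)
  refine ⟨_, ?_, h6.congr_of_eventuallyEq ?_⟩
  · change 0 < LinearMap.det (((paramEquiv N).toLinearEquiv.symm : Params N →ₗ[ℝ] _) ∘ₗ
      ((((pairing N).toLinearEquiv.symm : Target N →ₗ[ℝ] _) ∘ₗ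
        ((scaling N (scaleRe c) (scaleQuat c) : Target N →ₗ[ℝ] _) ∘ₗ
          (twistDeriv N τ : Target N →ₗ[ℝ] _)) ∘ₗ
        ((pairing N).toLinearEquiv : Params N →ₗ[ℝ] _)) ∘ₗ
        ((E : Params N →ₗ[ℝ] _) ∘ₗ (D : Params N →ₗ[ℝ] _))) ∘ₗ
      ((paramEquiv N).toLinearEquiv : (CubeIndex N → ℝ) →ₗ[ℝ] Params N))
    rw [LinearEquiv.det_symm_comp_comp, LinearMap.det_comp, LinearEquiv.det_symm_comp_comp,
      LinearMap.det_comp, LinearMap.det_comp]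
    exact mul_pos (mul_pos hdet (det_twistDeriv_pos hτ)) (mul_pos hE hD)
  · have ho : {x : CubeIndex N → ℝ | lead x ≠ 0 ∧ angleRe x ≠ 0} ∈ nhds c :=
      (IsOpen.inter (isOpen_ne_fun continuous_lead continuous_const)
        (isOpen_ne_fun continuous_angleRe continuous_const)).mem_nhds ⟨hl, hp⟩
    filter_upwards [ho] with x hx
    simp only [Function.comp_apply]
    rw [target_defect (fun l => (Finset.prod_ne_zero_iff.1 hx.1) l (Finset.mem_univ l)) hx.2]
    rfl

end CubeFamily

theorem exists_squareToPlane_eq {z : ℂ} (hz : ‖z‖ = 1) :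
    ∃ u ∈ Set.Icc (-1 : ℝ) 1, ∃ v ∈ Set.Icc (-1 : ℝ) 1,
      (1 - u ^ 2) * (1 - v ^ 2) ≠ 0 ∧ squareToPlane u v = z := by
  have h1 : z.re ^ 2 + z.im ^ 2 = 1 := by
    have := Complex.normSq_eq_norm_sq z
    rw [Complex.normSq_apply, hz] at this
    linarith
  have hx : z.re ^ 2 ≤ 1 := by nlinarith [sq_nonneg z.im]
  have hy : z.im ^ 2 ≤ 1 := by nlinarith [sq_nonneg z.re]
  obtain ⟨r, hr, hr'⟩ := intermediate_value_Icc' (a := (0 : ℝ)) (b := 1) zero_le_one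
    (f := fun r => (1 - (r * z.re) ^ 2) * (1 - (r * z.im) ^ 2) - r) (by fun_prop)
    (show (0 : ℝ) ∈ _ by constructor <;> norm_num; nlinarith [mul_nonneg (sq_nonneg z.re) (sub_nonneg.2 hy)])
  have hr0 : r ≠ 0 := by
    rintro rfl
    norm_num at hr'
  have e : (1 - (r * z.re) ^ 2) * (1 - (r * z.im) ^ 2) = r := sub_eq_zero.1 hr'
  have hm (x : ℝ) (h : x ^ 2 ≤ 1) : r * x ∈ Set.Icc (-1 : ℝ) 1 := by
    rw [Set.mem_Icc, ← abs_le, abs_mul, abs_of_nonneg hr.1]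
    exact mul_le_one₀ hr.2 (abs_nonneg _) (by rwa [← sq_le_one_iff_abs_le_one])
  refine ⟨r * z.re, hm _ hx, r * z.im, hm _ hy, by rwa [e], ?_⟩
  rw [squareToPlane, e]
  apply Complex.ext <;> simp [hr0]

namespace CubeFamily

open Polynomial

variable {N : ℕ}

theorem exists_target_defect_eq_zero (N : ℕ) : ∃ c ∈ Set.Icc (-1 : CubeIndex N → ℝ) 1,
    target (defect c) = 0 ∧ 0 < (defect c 0).re := by
  obtain ⟨z, hz⟩ := MonicCoeff.exists_prod_eq_X_pow_add_one (2 * N + 1) (by omega)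
  have hn (l : Fin (2 * N + 1)) : ‖z l‖ = 1 := by
    have h := congrArg (eval (z l)) hz
    rw [eval_prod, Finset.prod_eq_zero (Finset.mem_univ l) (by simp)] at h
    simp only [eval_add, eval_pow, eval_X, eval_one] at h
    have h' := congrArg norm (eq_neg_of_add_eq_zero_left h.symm)
    rw [norm_pow, norm_neg, norm_one] at h'
    exact (pow_eq_one_iff_of_nonneg (norm_nonneg _) (by omega)).1 h'
  choose u hu v hv hd huv using fun l => exists_squareToPlane_eq (hn l)
  let c : CubeIndex N → ℝ := Sum.elim (fun l => if l.2 then v l.1 else u l.1) fun _ => 1 / 2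
  have hden : ∀ l, den c l ≠ 0 := hd
  have hratio : ratio c = z := funext huv
  have hRe : angleRe c = 3 / 2 := by simp [angleRe, c]; norm_num
  have hIm : angleIm c = 3 / 2 := by simp [angleIm, c]; norm_num
  have hslope : slope c = 1 := by rw [slope, hRe, hIm]; norm_num
  have hlead : lead c ≠ 0 := Finset.prod_ne_zero_iff.2 fun l _ => hden l
  have hpair : pairing N (MonicCoeff.coeffs (ratio c), slope c) = ((((1 : ℝ) : ℂ), 1), 0) := by
    rw [hratio, hslope, ← pairing_single]
    congr 2
    funext e
    rw [MonicCoeff.coeffs, hz, coeff_add, coeff_X_pow, if_neg e.2.ne, zero_add, coeff_one,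
      Pi.single_apply]
    simp only [Fin.ext_iff, Fin.val_zero, Complex.ofReal_one]
  refine ⟨c, ⟨fun i => ?_, fun i => ?_⟩, ?_, ?_⟩
  · rcases i with ⟨l, ε | ε⟩ | ⟨⟩
    · exact (hu l).1
    · exact (hv l).1
    · norm_num [c]
  · rcases i with ⟨l, ε | ε⟩ | ⟨⟩
    · exact (hu l).2
    · exact (hv l).2
    · norm_num [c]
  · rw [target_defect hden (by rw [hRe]; norm_num), hpair, twist_eq_zero (by norm_num), map_zero]
  · have h1 := sum_normSq_pos (vec_ne_zero c)
    have h2 := Complex.normSq_nonneg ((poly c).coeff 0)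
    rw [defect_zero, hRe, hIm]
    simp only [re_smul, re_ofComplexPair, smul_eq_mul]
    positivity

theorem re_eq_one_of_target_eq_zero {y : PiLp 2 (fun _ : Fin (N + 1) => ℍ[ℝ])}
    (hy : y ∈ Metric.sphere 0 1)
    (h : target (fun i => (Pi.single 0 1 : Fin (N + 1) → ℍ[ℝ]) i - y i) = 0) :
    (y 0).re = 1 ∨ (y 0).re = 0 := by
  have h1 : -((1 : ℍ[ℝ]) - y 0).imI = 0 := congrArg (fun x => x.1.1.re) h
  have h2 : -((1 : ℍ[ℝ]) - y 0).imJ = 0 := congrArg (fun x => x.1.1.im) h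
  have h3 : -((1 : ℍ[ℝ]) - y 0).imK - ((1 : ℍ[ℝ]) - y 0).re = 0 := congrArg (fun x => x.1.2) h
  have h4 (i : Fin N) : y i.succ = 0 := by
    have := congrFun (congrArg Prod.snd h) i
    simpa [target] using this
  have h5 : ∑ i, normSq (y i) = 1 := by
    have := PiLp.norm_sq_eq_of_L2 (fun _ : Fin (N + 1) => ℍ[ℝ]) y
    rw [mem_sphere_zero_iff_norm.1 hy, one_pow] at this
    simp only [normSq_eq_norm_mul_self, ← sq]
    exact this.symm
  simp [Fin.sum_univ_succ, h4, normSq_def'] at h1 h2 h3 h5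
  rw [h1, h2, show (y 0).imK = 1 - (y 0).re by linarith] at h5
  have h6 : ((y 0).re - 1) * (y 0).re = 0 := by linear_combination h5 / 2
  exact (mul_eq_zero.1 h6).imp_left fun h => sub_eq_zero.1 h

theorem card_cubeIndex (N : ℕ) : Fintype.card (CubeIndex N) = 4 * N + 2 + 1 := by
  simp
  ring

theorem continuous_target : Continuous (target (N := N)) := by
  have h0 : Continuous fun w : Fin (N + 1) → ℍ[ℝ] => w 0 := continuous_apply 0
  refine Continuous.prodMk (Continuous.prodMk (Complex.continuous_mk ?_ ?_) ?_)
    (continuous_pi fun i => continuous_apply _)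
  · exact (continuous_imI.comp h0).neg
  · exact (continuous_imJ.comp h0).neg
  · exact (continuous_imK.comp h0).neg.sub (continuous_re.comp h0)

theorem singularHomologyFunctor_map_orbitMap_ne_zero
    (θ : TopCat.of (unitary (Matrix (Fin (N + 1)) (Fin (N + 1)) ℍ[ℝ])) ⟶
      TopCat.of (Metric.sphere (0 : PiLp 2 (fun _ : Fin (N + 1) => ℍ[ℝ])) 1))
    (hθ : ∀ A, WithLp.ofLp (θ A).val = Matrix.mulVec A.val (Pi.single 0 (1 : ℍ[ℝ]))) :
    (singularHomologyFunctor (4 * N + 2 + 1)).map θ ≠ 0 := by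
  have key (c : CubeIndex N → ℝ) :
      (fun i => (Pi.single 0 1 : Fin (N + 1) → ℍ[ℝ]) i - (θ (family N c)).val i) = defect c := by
    funext i
    have := congrFun (hθ (family N c)) i
    rw [coe_family, householder_mulVec_single] at this
    rw [this, sub_sub_cancel, defect]
  have key' (c : CubeIndex N → ℝ) : ((θ (family N c)).val 0).re = 1 - (defect c 0).re := by
    have := congrFun (key c) 0
    rw [← this]
    simp
  have hcont (i : Fin (N + 1)) : Continuous fun y : TopCat.of
      (Metric.sphere (0 : PiLp 2 (fun _ : Fin (N + 1) => ℍ[ℝ])) 1) => y.val i :=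
    (continuous_apply i).comp ((PiLp.continuous_ofLp 2 _).comp continuous_subtype_val)
  have : CompactSpace (TopCat.of
      (Metric.sphere (0 : PiLp 2 (fun _ : Fin (N + 1) => ℍ[ℝ])) 1)) := by
    have : ProperSpace (PiLp 2 (fun _ : Fin (N + 1) => ℍ[ℝ])) := FiniteDimensional.proper ℝ _
    exact isCompact_iff_compactSpace.1 (isCompact_sphere _ _)
  have hsymm (w : Target N) : (paramEquiv N).symm ((pairing N).symm w) = 0 ↔ w = 0 := by simp
  refine ListChain.singularHomologyFunctor_map_ne_zero (J := CubeIndex N) (card_cubeIndex N) θ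
    (family N) family_shift
    (g := fun y => (paramEquiv N).symm ((pairing N).symm (target fun i =>
      (Pi.single 0 1 : Fin (N + 1) → ℍ[ℝ]) i - y.val i)))
    (κ := fun y => 1 / 2 - (y.val 0).re) ?_ ?_ ?_ ?_ ?_
  · exact (paramEquiv N).symm.continuous.comp ((pairing N).symm.continuous.comp
      (continuous_target.comp (continuous_pi fun i => continuous_const.sub (hcont i))))
  · exact continuous_const.sub (continuous_re.comp (hcont 0))
  · intro y hy hg
    have := re_eq_one_of_target_eq_zero y.2 ((hsymm _).1 hg)
    rcases this with h | h <;> rw [h] at hy <;> norm_num at hy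
  · intro c hc hκ hg
    simp only [key, key'] at hκ hg ⊢
    exact hasFDerivAt_target_defect hc ((hsymm _).1 hg) (by linarith)
  · obtain ⟨c, hc, h0, hre⟩ := exists_target_defect_eq_zero N
    refine ⟨c, hc, ?_, ?_⟩
    · have := re_eq_one_of_target_eq_zero (θ (family N c)).2 (by rw [key, h0])
      rw [key'] at this ⊢
      rcases this with h | h <;> linarith
    · simp only [key]
      exact (hsymm _).2 h0

end CubeFamily

set_option maxHeartbeats 1000000 in
/-- the orbit map `θ_N : Sp(n) → S^{4n-1}`, `A ↦ A·e₁`, where `Sp(n)` is the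
quaternionic unitary group (`A* A = 1` over `ℍ`) and `S^{4n-1}` is the unit sphere of
`ℍⁿ ≅ ℝ^{4n}`, induces a nonzero map on `(4n-1)`-st singular homology with real coefficients. -/
theorem Sp_orbitMap_nonzero_on_homology
    (n : ℕ) (hn : 1 ≤ n)
    (θ : TopCat.of (unitary (Matrix (Fin n) (Fin n) ℍ[ℝ])) ⟶
      TopCat.of (Metric.sphere (0 : PiLp 2 (fun _ : Fin n => ℍ[ℝ])) 1))
    (hθ : ∀ A : unitary (Matrix (Fin n) (Fin n) ℍ[ℝ]),
      Subtype.val (θ A) =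
        Matrix.mulVec A.val (Pi.single (⟨0, by omega⟩ : Fin n) (1 : ℍ[ℝ]))) :
    (singularHomologyFunctor (4 * n - 1)).map θ ≠ 0 := by
  obtain ⟨N, rfl⟩ : ∃ N, n = N + 1 := ⟨n - 1, by omega⟩
  have := CubeFamily.singularHomologyFunctor_map_orbitMap_ne_zero θ hθ
  rwa [show 4 * (N + 1) - 1 = 4 * N + 2 + 1 by omega]
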